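/- Let H be a non-semisimple Hopf algebra of dimension 4p over an algebraically closed field k of characteristic zero, p an odd prime, with antipode S. Then S^{16} = id_H. Moreover, for every simple H-module V with V ≅ V^{∨∨}, the dimension of the projective cover P(V) is even; in particular dim P(k) is even, where k is the trivial H-module. -/

import Mathlib

attribute [fun_prop] IsLinearMap

open Coalgebra HopfAlgebra TensorProduct

section LinearSideConditions

variable {k X M N A : Type*} [CommSemiring k] [AddCommMonoid X] [Module k X]
  [AddCommMonoid M] [Module k M] [AddCommMonoid N] [Module k N] [Semiring A] [Algebra k A]

namespace IsLinearMap

@[fun_prop]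
theorem fun_id : IsLinearMap k (fun x : X => x) := ⟨fun _ _ => rfl, fun _ _ => rfl⟩

@[fun_prop]
theorem fun_comp {f : M → N} {g : X → M} (hf : IsLinearMap k f) (hg : IsLinearMap k g) :
    IsLinearMap k (fun x => f (g x)) :=
  ⟨fun a b => by rw [hg.map_add, hf.map_add], fun c a => by rw [hg.map_smul, hf.map_smul]⟩

@[fun_prop]
theorem of_linearMap (f : M →ₗ[k] N) : IsLinearMap k (fun x => f x) := f.isLinear

@[fun_prop]
theorem fun_mul_const {f : X → A} (hf : IsLinearMap k f) (a : A) :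
    IsLinearMap k (fun x => f x * a) :=
  ⟨fun x y => by rw [hf.map_add, add_mul], fun c x => by rw [hf.map_smul, smul_mul_assoc]⟩

@[fun_prop]
theorem fun_const_mul {f : X → A} (hf : IsLinearMap k f) (a : A) :
    IsLinearMap k (fun x => a * f x) :=
  ⟨fun x y => by rw [hf.map_add, mul_add], fun c x => by rw [hf.map_smul, mul_smul_comm]⟩

@[fun_prop]
theorem fun_smul_const {f : X → k} (hf : IsLinearMap k f) (m : M) :
    IsLinearMap k (fun x => f x • m) :=
  ⟨fun x y => by rw [hf.map_add, add_smul],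
    fun c x => by rw [hf.map_smul, smul_eq_mul, mul_smul]⟩

@[fun_prop]
theorem fun_const_smul {f : X → M} (hf : IsLinearMap k f) (c : k) :
    IsLinearMap k (fun x => c • f x) :=
  ⟨fun x y => by rw [hf.map_add, smul_add], fun d x => by rw [hf.map_smul, smul_comm]⟩

@[fun_prop]
theorem fun_add {f g : X → M} (hf : IsLinearMap k f) (hg : IsLinearMap k g) :
    IsLinearMap k (fun x => f x + g x) :=
  ⟨fun x y => by rw [hf.map_add, hg.map_add, add_add_add_comm],
    fun d x => by rw [hf.map_smul, hg.map_smul, smul_add]⟩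

@[fun_prop]
theorem fun_sum {ι : Type*} (s : Finset ι) {f : ι → X → M} (hf : ∀ i, IsLinearMap k (f i)) :
    IsLinearMap k (fun x => ∑ i ∈ s, f i x) :=
  ⟨fun x y => by simp only [(hf _).map_add, Finset.sum_add_distrib],
    fun d x => by simp only [(hf _).map_smul, Finset.smul_sum]⟩

@[fun_prop]
theorem fun_tmul_const {f : X → M} (hf : IsLinearMap k f) (n : N) :
    IsLinearMap k (fun x => f x ⊗ₜ[k] n) :=
  ⟨fun x y => by rw [hf.map_add, TensorProduct.add_tmul],
    fun d x => by rw [hf.map_smul, TensorProduct.smul_tmul']⟩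

@[fun_prop]
theorem fun_const_tmul {f : X → M} (hf : IsLinearMap k f) (n : N) :
    IsLinearMap k (fun x => n ⊗ₜ[k] f x) :=
  ⟨fun x y => by rw [hf.map_add, TensorProduct.tmul_add],
    fun d x => by rw [hf.map_smul, TensorProduct.tmul_smul]⟩

end IsLinearMap

end LinearSideConditions

section SweedlerSum

variable (k : Type*) {C M N X A : Type*} [CommSemiring k] [AddCommMonoid C] [Module k C]
  [Coalgebra k C] [AddCommMonoid M] [Module k M] [AddCommMonoid N] [Module k N]
  [AddCommMonoid X] [Module k X] [Semiring A] [Algebra k A]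

/-- The Sweedler sum `∑ F h₁ h₂`. -/
noncomputable def sw (F : C → C → M) (h : C) : M :=
  ∑ i ∈ (ℛ k h).index, F ((ℛ k h).left i) ((ℛ k h).right i)

variable {k}

theorem sw_eq_lift (F : C → C → M) (h : C)
    (hl : ∀ b, IsLinearMap k (fun a => F a b) := by fun_prop)
    (hr : ∀ a, IsLinearMap k (fun b => F a b) := by fun_prop) :
    sw k F h = TensorProduct.lift (LinearMap.mk₂ k F (fun a b c => (hl c).map_add a b)
      (fun c a b => (hl b).map_smul c a) (fun a b c => (hr a).map_add b c)
      (fun c a b => (hr a).map_smul c b)) (comul h) := by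
  rw [← (ℛ k h).eq, map_sum]
  rfl

theorem sw_eq_sum_repr (F : C → C → M) (h : C) {ι : Type*} (r : Coalgebra.Repr k h ι)
    (hl : ∀ b, IsLinearMap k (fun a => F a b) := by fun_prop)
    (hr : ∀ a, IsLinearMap k (fun b => F a b) := by fun_prop) :
    sw k F h = ∑ i ∈ r.index, F (r.left i) (r.right i) := by
  rw [sw_eq_lift F h hl hr, ← r.eq, map_sum]
  rfl

theorem sw_eq_sum {F : C → C → M} {h : C} {ι : Type*} {s : Finset ι} {x y : ι → C}
    (he : comul (R := k) h = ∑ i ∈ s, x i ⊗ₜ[k] y i)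
    (hl : ∀ b, IsLinearMap k (fun a => F a b) := by fun_prop)
    (hr : ∀ a, IsLinearMap k (fun b => F a b) := by fun_prop) :
    sw k F h = ∑ i ∈ s, F (x i) (y i) :=
  sw_eq_sum_repr F h ⟨s, x, y, he.symm⟩ hl hr

theorem sw_tmul (h : C) : sw k (fun a b => a ⊗ₜ[k] b) h = comul h := (ℛ k h).eq

@[fun_prop]
theorem isLinearMap_sw {F : C → C → M} {g : X → C}
    (hl : ∀ b, IsLinearMap k (fun a => F a b)) (hr : ∀ a, IsLinearMap k (fun b => F a b))
    (hg : IsLinearMap k g) :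
    IsLinearMap k (fun x => sw k F (g x)) := by
  simp only [sw_eq_lift F _ hl hr]
  fun_prop

@[fun_prop]
theorem isLinearMap_sw_fun {F : X → C → C → M} (h : C)
    (hF : ∀ a b, IsLinearMap k (fun x => F x a b)) :
    IsLinearMap k (fun x => sw k (fun a b => F x a b) h) :=
  IsLinearMap.fun_sum _ (fun _ => hF _ _)

theorem sw_congr {F G : C → C → M} (h : C) (hFG : ∀ a b, F a b = G a b) :
    sw k F h = sw k G h := by
  rw [show F = G from funext₂ hFG]

theorem map_sw {L : M → N} (F : C → C → M) (h : C) (hL : IsLinearMap k L := by fun_prop) :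
    L (sw k F h) = sw k (fun a b => L (F a b)) h :=
  map_sum hL.mk' _ _

theorem sw_add (F G : C → C → M) (h : C) :
    sw k (fun a b => F a b + G a b) h = sw k F h + sw k G h :=
  Finset.sum_add_distrib

theorem sw_sum {ι : Type*} (s : Finset ι) (F : ι → C → C → M) (h : C) :
    sw k (fun a b => ∑ i ∈ s, F i a b) h = ∑ i ∈ s, sw k (F i) h :=
  Finset.sum_comm

theorem sw_const_mul (x : A) (F : C → C → A) (h : C) :
    sw k (fun a b => x * F a b) h = x * sw k F h :=
  (Finset.mul_sum _ _ _).symm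

theorem sw_mul_const (x : A) (F : C → C → A) (h : C) :
    sw k (fun a b => F a b * x) h = sw k F h * x :=
  (Finset.sum_mul _ _ _).symm

theorem sw_const_smul (x : k) (F : C → C → M) (h : C) :
    sw k (fun a b => x • F a b) h = x • sw k F h :=
  Finset.smul_sum.symm

theorem sw_smul_const (x : M) (F : C → C → k) (h : C) :
    sw k (fun a b => F a b • x) h = sw k F h • x :=
  (Finset.sum_smul).symm

theorem sw_comm {C' : Type*} [AddCommMonoid C'] [Module k C'] [Coalgebra k C']
    (F : C → C → C' → C' → M) (x : C) (y : C') :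
    sw k (fun a b => sw k (fun c d => F a b c d) y) x =
      sw k (fun c d => sw k (fun a b => F a b c d) x) y :=
  Finset.sum_comm

theorem sw_counit_left (F : C → M) (h : C) (hF : IsLinearMap k F := by fun_prop) :
    sw k (fun a b => counit (R := k) a • F b) h = F h := by
  have := map_sw (L := F) (fun a b => counit (R := k) a • b) h hF
  simp only [hF.map_smul] at this
  rw [← this]
  congr 1
  exact sum_counit_smul (ℛ k h)

theorem sw_counit_right (F : C → M) (h : C) (hF : IsLinearMap k F := by fun_prop) :
    sw k (fun a b => counit (R := k) b • F a) h = F h := by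
  have h1 := sum_tmul_counit_eq (ℛ k h)
  have h2 := congrArg (TensorProduct.lift
    ((LinearMap.lsmul k C).flip)) h1
  have h3 : sw k (fun a b => counit (R := k) b • a) h = h := by
    simp only [map_sum, TensorProduct.lift.tmul, LinearMap.flip_apply, LinearMap.lsmul_apply,
      one_smul] at h2
    exact h2
  have := map_sw (L := F) (fun a b => counit (R := k) b • a) h hF
  simp only [hF.map_smul] at this
  rw [← this, h3]

theorem sw_assoc (T : C → C → C → M) (h : C)
    (h1 : ∀ b c, IsLinearMap k (fun a => T a b c) := by fun_prop)
    (h2 : ∀ a c, IsLinearMap k (fun b => T a b c) := by fun_prop)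
    (h3 : ∀ a b, IsLinearMap k (fun c => T a b c) := by fun_prop) :
    sw k (fun x c => sw k (fun a b => T a b c) x) h =
      sw k (fun a x => sw k (fun b c => T a b c) x) h := by
  let T' : C →ₗ[k] (C ⊗[k] C) →ₗ[k] M :=
    { toFun := fun a => TensorProduct.lift (LinearMap.mk₂ k (T a)
        (fun x y c => (h2 a c).map_add x y) (fun d x c => (h2 a c).map_smul d x)
        (fun x c c' => (h3 a x).map_add c c') (fun d x c => (h3 a x).map_smul d c))
      map_add' := fun x y => by ext; simp [(h1 _ _).map_add]
      map_smul' := fun x y => by ext; simp [(h1 _ _).map_smul] }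
  have h4 := congrArg (TensorProduct.lift T') (coassoc_apply (R := k) h)
  rw [← sw_tmul h] at h4
  simp only [sw, map_sum, LinearMap.rTensor_tmul, LinearMap.lTensor_tmul,
    TensorProduct.lift.tmul] at h4
  simp only [sw]
  convert h4 using 2 with i _ i _
  · generalize (ℛ k h).left i = u
    generalize (ℛ k h).right i = v
    rw [← (ℛ k u).eq, TensorProduct.sum_tmul, map_sum, map_sum]
    rfl
  · generalize (ℛ k h).left i = u
    generalize (ℛ k h).right i = v
    rw [← (ℛ k v).eq, map_sum]
    rfl

end SweedlerSum

section SweedlerBialgebra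

variable {k H M A : Type*} [CommSemiring k] [Semiring H] [Bialgebra k H]
  [AddCommMonoid M] [Module k M]

theorem sw_mul (F : H → H → M) (x y : H)
    (hl : ∀ b, IsLinearMap k (fun a => F a b) := by fun_prop)
    (hr : ∀ a, IsLinearMap k (fun b => F a b) := by fun_prop) :
    sw k F (x * y) = sw k (fun a b => sw k (fun c d => F (a * c) (b * d)) y) x := by
  rw [sw_eq_sum_repr F (x * y) ((ℛ k x).mul (ℛ k y)) hl hr]
  simp [sw, Finset.sum_product]

theorem sw_groupLike {g : H} (hg : IsGroupLikeElem k g) (F : H → H → M)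
    (hl : ∀ b, IsLinearMap k (fun a => F a b) := by fun_prop)
    (hr : ∀ a, IsLinearMap k (fun b => F a b) := by fun_prop) :
    sw k F g = F g g := by
  rw [sw_eq_lift F g hl hr, hg.comul_eq_tmul_self]
  rfl

theorem sw_one (F : H → H → M)
    (hl : ∀ b, IsLinearMap k (fun a => F a b) := by fun_prop)
    (hr : ∀ a, IsLinearMap k (fun b => F a b) := by fun_prop) :
    sw k F 1 = F 1 1 :=
  sw_groupLike .one F hl hr

end SweedlerBialgebra

section SweedlerHopf

variable {k H M : Type*} [CommSemiring k] [Semiring H] [HopfAlgebra k H]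
  [AddCommMonoid M] [Module k M]

theorem sw_antipode_mul (F : H → M) (h : H) (hF : IsLinearMap k F := by fun_prop) :
    sw k (fun a b => F (antipode k a * b)) h = counit (R := k) h • F 1 := by
  rw [← map_sw (L := F) (fun a b => antipode k a * b) h hF, ← hF.map_smul]
  congr 1
  exact sum_antipode_mul_eq_smul (ℛ k h)

theorem sw_mul_antipode (F : H → M) (h : H) (hF : IsLinearMap k F := by fun_prop) :
    sw k (fun a b => F (a * antipode k b)) h = counit (R := k) h • F 1 := by
  rw [← map_sw (L := F) (fun a b => a * antipode k b) h hF, ← hF.map_smul]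
  congr 1
  exact sum_mul_antipode_eq_smul (ℛ k h)

end SweedlerHopf

open Coalgebra HopfAlgebra TensorProduct

section AntipodeComul

variable {k H M : Type*} [CommSemiring k] [Semiring H] [HopfAlgebra k H]
  [AddCommMonoid M] [Module k M]

theorem convMul_apply_eq_sw {A : Type*} [Semiring A] [Algebra k A] (f g : H →ₗ[k] A) (x : H) :
    (WithConv.toConv f * WithConv.toConv g : WithConv (H →ₗ[k] A)) x
      = sw k (fun a b => f a * g b) x :=
  (ℛ k x).convMul_apply _ _

theorem comul_antipode (x : H) :
    comul (R := k) (antipode k x) = sw k (fun a b => antipode k b ⊗ₜ[k] antipode k a) x := by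
  let G : H →ₗ[k] H ⊗[k] H :=
    IsLinearMap.mk' (fun x => sw k (fun a b => antipode k b ⊗ₜ[k] antipode k a) x) (by fun_prop)
  have h1 : WithConv.toConv G * WithConv.toConv (comul (R := k) (A := H)) = 1 := by
    ext x
    rw [convMul_apply_eq_sw]
    calc sw k (fun a b => G a * comul b) x
        = sw k (fun a b => sw k (fun a₁ a₂ => sw k (fun b₁ b₂ =>
            (antipode k a₂ * b₁) ⊗ₜ[k] (antipode k a₁ * b₂)) b) a) x := by
          refine sw_congr _ fun a b => ?_
          simp only [← sw_tmul b, G, IsLinearMap.mk'_apply, ← sw_mul_const, ← sw_const_mul,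
            Algebra.TensorProduct.tmul_mul_tmul]
          exact sw_comm _ _ _
      _ = sw k (fun a₁ y => sw k (fun a₂ b => sw k (fun b₁ b₂ =>
            (antipode k a₂ * b₁) ⊗ₜ[k] (antipode k a₁ * b₂)) b) y) x :=
          sw_assoc (fun a₁ a₂ b => sw k (fun b₁ b₂ =>
            (antipode k a₂ * b₁) ⊗ₜ[k] (antipode k a₁ * b₂)) b) x
      _ = sw k (fun a₁ y => (1 : H) ⊗ₜ[k] (antipode k a₁ * y)) x := by
          refine sw_congr _ fun a₁ y => ?_
          rw [← sw_assoc (fun a₂ b₁ b₂ => (antipode k a₂ * b₁) ⊗ₜ[k] (antipode k a₁ * b₂)) y]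
          refine (sw_congr _ fun u b₂ => sw_antipode_mul
            (fun z => z ⊗ₜ[k] (antipode k a₁ * b₂)) u).trans ?_
          exact sw_counit_left (fun b => (1 : H) ⊗ₜ[k] (antipode k a₁ * b)) y
      _ = _ := by
          rw [sw_antipode_mul (fun z => (1 : H) ⊗ₜ[k] z)]
          rw [LinearMap.convOne_apply, Algebra.algebraMap_eq_smul_one,
            Algebra.TensorProduct.one_def]
  exact congrArg (fun f : WithConv (H →ₗ[k] H ⊗[k] H) => f x)
    (left_inv_eq_right_inv h1 LinearMap.comul_right_inv).symm

theorem sw_antipode (F : H → H → M) (x : H)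
    (hl : ∀ b, IsLinearMap k (fun a => F a b) := by fun_prop)
    (hr : ∀ a, IsLinearMap k (fun b => F a b) := by fun_prop) :
    sw k F (antipode k x) = sw k (fun a b => F (antipode k b) (antipode k a)) x :=
  sw_eq_sum (comul_antipode x)

end AntipodeComul

open Coalgebra HopfAlgebra TensorProduct

section Convolution

variable {k H : Type*} [CommSemiring k] [Semiring H] [Bialgebra k H]

/-- The convolution product of two functionals. -/
noncomputable def cv (f g : H →ₗ[k] k) : H →ₗ[k] k :=
  IsLinearMap.mk' (fun x => sw k (fun a b => f a * g b) x) (by fun_prop)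

theorem cv_apply (f g : H →ₗ[k] k) (x : H) : cv f g x = sw k (fun a b => f a * g b) x := rfl

theorem cv_assoc (f g h : H →ₗ[k] k) : cv (cv f g) h = cv f (cv g h) := by
  ext x
  simp only [cv_apply, ← sw_mul_const, ← sw_const_mul, ← mul_assoc]
  exact sw_assoc (fun a b c => f a * g b * h c) x

theorem cv_counit (f : H →ₗ[k] k) : cv f counit = f := by
  ext x
  simpa only [cv_apply, mul_comm, smul_eq_mul] using
    sw_counit_right (k := k) (fun z => f z) x

theorem counit_cv (f : H →ₗ[k] k) : cv counit f = f := by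
  ext x
  exact sw_counit_left (fun z => f z) x

@[fun_prop]
theorem isLinearMap_cv_left {X : Type*} [AddCommMonoid X] [Module k X] {f : X → H →ₗ[k] k}
    (hf : IsLinearMap k f) (g : H →ₗ[k] k) : IsLinearMap k (fun x => cv (f x) g) where
  map_add x y := by ext z; simp [cv_apply, hf.map_add, add_mul, sw_add]
  map_smul c x := by ext z; simp [cv_apply, hf.map_smul, mul_assoc, sw_const_mul]

@[fun_prop]
theorem isLinearMap_cv_right {X : Type*} [AddCommMonoid X] [Module k X] {f : X → H →ₗ[k] k}
    (hf : IsLinearMap k f) (g : H →ₗ[k] k) : IsLinearMap k (fun x => cv g (f x)) where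
  map_add x y := by ext z; simp [cv_apply, hf.map_add, mul_add, sw_add]
  map_smul c x := by ext z; simp [cv_apply, hf.map_smul, mul_left_comm, sw_const_mul]

@[fun_prop]
theorem isLinearMap_linearMap_apply {X M N : Type*} [AddCommMonoid X] [Module k X]
    [AddCommMonoid M] [Module k M] [AddCommMonoid N] [Module k N] {f : X → M →ₗ[k] N}
    (hf : IsLinearMap k f) (m : M) : IsLinearMap k (fun x => f x m) :=
  ⟨fun x y => by rw [hf.map_add]; rfl, fun c x => by rw [hf.map_smul]; rfl⟩

/-- The functional `x ↦ f (a * x)`. -/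
def actl (f : H →ₗ[k] k) (a : H) : H →ₗ[k] k := f ∘ₗ LinearMap.mulLeft k a

@[simp] theorem actl_apply (f : H →ₗ[k] k) (a x : H) : actl f a x = f (a * x) := rfl

@[fun_prop]
theorem isLinearMap_actl {X : Type*} [AddCommMonoid X] [Module k X] {a : X → H}
    (ha : IsLinearMap k a) (f : H →ₗ[k] k) : IsLinearMap k (fun x => actl f (a x)) where
  map_add x y := by ext z; simp [ha.map_add, add_mul]
  map_smul c x := by ext z; simp [ha.map_smul]

theorem sum_coord_smul_apply {ι : Type*} [Fintype ι] (b : Module.Basis ι k H) {M : Type*}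
    [AddCommMonoid M] [Module k M] (F : H → M) (x : H) (hF : IsLinearMap k F := by fun_prop) :
    ∑ i, b.coord i x • F (b i) = F x := by
  conv_rhs => rw [← b.sum_repr x, ← hF.mk'_apply, map_sum]
  simp

theorem sum_apply_smul_coord {ι : Type*} [Fintype ι] (b : Module.Basis ι k H)
    (f : H →ₗ[k] k) : ∑ i, f (b i) • b.coord i = f := by
  refine b.ext fun j => ?_
  classical
  simp [Finsupp.single_apply]

theorem sum_sw_coord {ι : Type*} [Fintype ι] (b : Module.Basis ι k H) {M : Type*}
    [AddCommMonoid M] [Module k M] (Φ : (H →ₗ[k] k) → H → H → M)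
    (h1 : ∀ x y, IsLinearMap k (fun f => Φ f x y) := by fun_prop)
    (h2 : ∀ f y, IsLinearMap k (fun x => Φ f x y) := by fun_prop)
    (h3 : ∀ f x, IsLinearMap k (fun y => Φ f x y) := by fun_prop) :
    ∑ i, sw k (fun x y => Φ (b.coord i) x y) (b i) =
      ∑ j, ∑ l, Φ (cv (b.coord j) (b.coord l)) (b j) (b l) := by
  have key : ∀ (f : H →ₗ[k] k) (x y : H),
      Φ f x y = ∑ j, ∑ l, (b.coord j x * b.coord l y) • Φ f (b j) (b l) := by
    intro f x y
    simp only [mul_smul, ← Finset.smul_sum]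
    rw [← sum_coord_smul_apply b (fun x => Φ f x y) x (h2 _ _)]
    refine Finset.sum_congr rfl fun j _ => ?_
    rw [sum_coord_smul_apply b (fun y => Φ f (b j) y) y (h3 _ _)]
  have h4 : ∀ i, sw k (fun x y => Φ (b.coord i) x y) (b i) =
      ∑ j, ∑ l, cv (b.coord j) (b.coord l) (b i) • Φ (b.coord i) (b j) (b l) := by
    intro i
    rw [sw_congr _ (key _)]
    simp only [sw_sum, sw_smul_const, cv_apply]
  simp only [h4]
  rw [Finset.sum_comm]
  refine Finset.sum_congr rfl fun j _ => ?_
  rw [Finset.sum_comm]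
  refine Finset.sum_congr rfl fun l _ => ?_
  rw [← (h1 _ _).mk'_apply (cv _ _), ← sum_apply_smul_coord b (cv (b.coord j) (b.coord l)),
    map_sum]
  simp only [map_smul, IsLinearMap.mk'_apply, sum_apply_smul_coord]

end Convolution

section Integral

variable {k H : Type*} [Field k] [Ring H] [HopfAlgebra k H]

theorem sw_mul_antipode_left {M : Type*} [AddCommMonoid M] [Module k M] (F : H → H → M) (h x : H)
    (hl : ∀ b, IsLinearMap k (fun a => F a b) := by fun_prop)
    (hr : ∀ a, IsLinearMap k (fun b => F a b) := by fun_prop) : 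
    sw k (fun a b => F (antipode k h * a) b) x =
      sw k (fun h₁ h₂ => sw k (fun a b => F a (h₁ * b)) (antipode k h₂ * x)) h := by
  symm
  calc _ = sw k (fun h₁ h₂ => sw k (fun u v => sw k (fun a b =>
            F (antipode k v * a) (h₁ * (antipode k u * b))) x) h₂) h := by
        refine sw_congr _ fun h₁ h₂ => ?_
        rw [sw_mul (fun a b => F a (h₁ * b))]
        exact (sw_antipode (fun u v => sw k (fun a b => F (u * a) (h₁ * (v * b))) x) h₂).symm ▸ rfl
    _ = sw k (fun h₁ v => sw k (fun z u => sw k (fun a b =>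
            F (antipode k v * a) (z * antipode k u * b)) x) h₁) h := by
        rw [sw_assoc (fun z u v => sw k (fun a b =>
            F (antipode k v * a) (z * antipode k u * b)) x)]
        simp only [mul_assoc]
    _ = sw k (fun h₁ v => counit (R := k) h₁ • sw k (fun a b =>
            F (antipode k v * a) b) x) h := by
        refine sw_congr _ fun h₁ v => ?_
        rw [sw_mul_antipode (fun z => sw k (fun a b => F (antipode k v * a) (z * b)) x) h₁]
        simp only [one_mul]
    _ = _ := sw_counit_left (fun v => sw k (fun a b => F (antipode k v * a) b) x) h

theorem sw_actl_antipode (f g : H →ₗ[k] k) (h x : H) :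
    sw k (fun a b => f (antipode k h * a) * g b) x =
      sw k (fun h₁ h₂ => cv f (actl g h₁) (antipode k h₂ * x)) h :=
  sw_mul_antipode_left (fun a b => f a * g b) h x

variable [FiniteDimensional k H]

/-- The projection of functionals onto right integrals. -/
noncomputable def intProj (f : H →ₗ[k] k) : H →ₗ[k] k :=
  ∑ i, actl (cv f ((Module.finBasis k H).coord i))
    (antipode k (antipode k (Module.finBasis k H i)))

theorem cv_intProj (f g : H →ₗ[k] k) : cv (intProj f) g = g 1 • intProj f := by
  set b := Module.finBasis k H
  ext x
  calc cv (intProj f) g x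
      = ∑ i, sw k (fun u v => cv f (b.coord i) (antipode k (antipode k (b i)) * u) * g v) x := by
        rw [cv_apply, ← sw_sum]
        simp only [intProj, LinearMap.sum_apply, Finset.sum_mul]
        rfl
    _ = ∑ i, sw k (fun u v => cv (cv f (b.coord i)) (actl g (antipode k v))
          (antipode k (antipode k u) * x)) (b i) := by
        refine Finset.sum_congr rfl fun i _ => ?_
        rw [sw_actl_antipode]
        exact sw_antipode (fun u v => cv (cv f (b.coord i)) (actl g u) (antipode k v * x)) (b i)
    _ = ∑ j, ∑ l, cv (cv f (cv (b.coord j) (b.coord l))) (actl g (antipode k (b l)))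
          (antipode k (antipode k (b j)) * x) :=
        sum_sw_coord b (fun φ u v => cv (cv f φ) (actl g (antipode k v))
          (antipode k (antipode k u) * x))
    _ = ∑ j, cv (cv f (b.coord j)) (∑ l, cv (b.coord l) (actl g (antipode k (b l))))
          (antipode k (antipode k (b j)) * x) := by
        refine Finset.sum_congr rfl fun j _ => ?_
        have h : IsLinearMap k (fun φ => cv (cv f (b.coord j)) φ
          (antipode k (antipode k (b j)) * x)) := by fun_prop
        rw [← h.mk'_apply, map_sum]
        refine Finset.sum_congr rfl fun l _ => ?_
        rw [h.mk'_apply, ← cv_assoc, ← cv_assoc]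
    _ = ∑ j, cv (cv f (b.coord j)) (g 1 • counit)
          (antipode k (antipode k (b j)) * x) := by
        congr! 3
        ext y
        simp only [LinearMap.sum_apply, cv_apply, actl_apply, ← sw_sum]
        have : ∀ u v : H, ∑ l, b.coord l u * g (antipode k (b l) * v) = g (antipode k u * v) :=
          fun u v => sum_coord_smul_apply b (fun z => g (antipode k z * v)) u
        rw [sw_congr _ this, sw_antipode_mul (fun z => g z)]
        simp [mul_comm]
    _ = _ := by
        have h : ∀ φ : H →ₗ[k] k, IsLinearMap k (fun ψ => cv φ ψ) := by intro; fun_prop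
        simp only [(h _).map_smul, cv_counit, intProj, LinearMap.smul_apply, LinearMap.sum_apply,
          Finset.smul_sum]
        rfl

theorem sum_intProj (f : H →ₗ[k] k) (x : H) :
    ∑ i, intProj (cv f ((Module.finBasis k H).coord i)) (antipode k (Module.finBasis k H i) * x)
      = f x := by
  set b := Module.finBasis k H
  calc _ = ∑ i, ∑ j, cv f (cv (b.coord i) (b.coord j))
            (antipode k (antipode k (b j)) * (antipode k (b i) * x)) := by
        simp only [intProj, LinearMap.sum_apply, actl_apply, cv_assoc]
        rfl
    _ = ∑ i, sw k (fun u v => cv f (b.coord i)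
            (antipode k (antipode k v) * (antipode k u * x))) (b i) :=
        (sum_sw_coord b (fun φ u v => cv f φ (antipode k (antipode k v) * (antipode k u * x)))).symm
    _ = ∑ i, counit (R := k) (b i) • cv f (b.coord i) x := by
        refine Finset.sum_congr rfl fun i _ => ?_
        simp only [← mul_assoc, ← antipode_mul_antidistrib]
        rw [sw_mul_antipode (fun z => cv f (b.coord i) (antipode k z * x))]
        simp
    _ = f x := by
        conv_rhs => rw [← cv_counit f, ← sum_apply_smul_coord b counit]
        have h : IsLinearMap k (fun φ => cv f φ x) := by fun_prop
        rw [← h.mk'_apply, map_sum]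
        simp

theorem exists_intProj_ne_zero : ∃ f : H →ₗ[k] k, intProj f ≠ 0 := by
  by_contra! h
  have h1 := sum_intProj (k := k) (counit (R := k)) (1 : H)
  simp [h] at h1

end Integral

open Coalgebra HopfAlgebra TensorProduct

section IntegralPair

variable (k H : Type*) [Field k] [Ring H] [HopfAlgebra k H]

/-- A right integral `lam` of the dual and a left integral `Lam`, suitably normalized. -/
structure IntegralPair where
  lam : H →ₗ[k] k
  Lam : H
  lam_right : ∀ h, sw k (fun a b => lam a • b) h = lam h • 1
  Lam_left : ∀ h, h * Lam = counit (R := k) h • Lam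
  lam_antipode_Lam : lam (antipode k Lam) = 1
  nondeg : ∀ a, (∀ x, lam (a * x) = 0) → a = 0

variable {k H}

theorem eq_of_forall_dual {v w : H} (h : ∀ f : H →ₗ[k] k, f v = f w) : v = w :=
  (Module.forall_dual_apply_eq_zero_iff k (v - w)).1 (fun f => by simp [h f]) |> sub_eq_zero.1

theorem antipode_injective_of_integral [FiniteDimensional k H] {lam : H →ₗ[k] k}
    (h0 : lam ≠ 0) (hlam : ∀ g, cv lam g = g 1 • lam) {h : H}
    (hh : ∀ x, lam (antipode k h * x) = 0) : h = 0 := by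
  set b := Module.finBasis k H
  obtain ⟨y, hy⟩ : ∃ y, lam y ≠ 0 := by
    by_contra! hc
    exact h0 (LinearMap.ext hc)
  have h1 : ∀ (g : H →ₗ[k] k) x, sw k (fun u v => g u * lam (antipode k v * x)) h = 0 := by
    intro g x
    have := sw_actl_antipode lam g h x
    simp only [hh, zero_mul, hlam, actl_apply, mul_one, LinearMap.smul_apply, smul_eq_mul] at this
    rw [← this]
    simp [sw]
  refine eq_of_forall_dual (k := k) fun φ => ?_
  have h2 : φ h * lam y = 0 := by
    calc φ h * lam y = sw k (fun u v => counit (R := k) v • (φ u * lam y)) h :=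
          (sw_counit_right (fun u => φ u * lam y) h).symm
      _ = sw k (fun u v => sw k (fun v₁ v₂ => φ u *
            lam (antipode k v₂ * antipode k (antipode k v₁) * y)) v) h := by
          refine sw_congr _ fun u v => ?_
          simp only [← antipode_mul_antidistrib]
          rw [sw_antipode_mul (fun z => φ u * lam (antipode k z * y))]
          simp
      _ = sw k (fun w v₂ => sw k (fun u v₁ => φ u *
            lam (antipode k v₂ * antipode k (antipode k v₁) * y)) w) h :=
          (sw_assoc (fun u v₁ v₂ => φ u *
            lam (antipode k v₂ * antipode k (antipode k v₁) * y)) h).symm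
      _ = sw k (fun w v₂ => ∑ j, cv φ (b.coord j) w *
            lam (antipode k v₂ * (antipode k (antipode k (b j)) * y))) h := by
          refine sw_congr _ fun w v₂ => ?_
          simp only [cv_apply, ← sw_mul_const, ← sw_sum]
          refine sw_congr _ fun u v₁ => ?_
          rw [← sum_coord_smul_apply b (fun z => φ u *
            lam (antipode k v₂ * antipode k (antipode k z) * y)) v₁]
          refine Finset.sum_congr rfl fun j _ => ?_
          rw [smul_eq_mul, mul_assoc, mul_assoc]
          ring
      _ = 0 := by
          rw [sw_sum]
          simp only [h1, Finset.sum_const_zero]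
  simpa [hy] using h2

theorem nonempty_integralPair [FiniteDimensional k H] : Nonempty (IntegralPair k H) := by
  obtain ⟨f, hf⟩ := exists_intProj_ne_zero (k := k) (H := H)
  set lam := intProj f with hlamdef
  have hlam : ∀ g, cv lam g = g 1 • lam := cv_intProj f
  have hinj : ∀ h : H, (∀ x, lam (antipode k h * x) = 0) → h = 0 :=
    fun h hh => antipode_injective_of_integral hf hlam hh
  have hSinj : Function.Injective (antipode k (A := H)) := by
    rw [injective_iff_map_eq_zero]
    intro a ha
    exact hinj a (by simp [ha])
  have hSsurj : Function.Surjective (antipode k (A := H)) :=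
    LinearMap.injective_iff_surjective.1 hSinj
  have hnd : ∀ a : H, (∀ x, lam (a * x) = 0) → a = 0 := by
    intro a ha
    obtain ⟨h, rfl⟩ := hSsurj a
    rw [hinj h ha, map_zero]
  let Ψ : H →ₗ[k] (H →ₗ[k] k) := IsLinearMap.mk' (fun a => actl lam a) (by fun_prop)
  have hΨinj : Function.Injective Ψ := by
    rw [injective_iff_map_eq_zero]
    intro a ha
    exact hnd a fun x => LinearMap.congr_fun ha x
  have hΨsurj : Function.Surjective Ψ :=
    (LinearMap.injective_iff_surjective_of_finrank_eq_finrank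
      (Subspace.dual_finrank_eq (K := k) (V := H)).symm).1 hΨinj
  obtain ⟨L', hL'⟩ := hΨsurj counit
  have hL1 : ∀ x, lam (L' * x) = counit (R := k) x := fun x => LinearMap.congr_fun hL' x
  have hL2 : ∀ h, L' * h = counit (R := k) h • L' := by
    intro h
    apply hΨinj
    ext x
    change lam (L' * h * x) = lam (counit (R := k) h • L' * x)
    rw [mul_assoc, hL1, smul_mul_assoc, map_smul, hL1, Bialgebra.counit_mul, smul_eq_mul]
  obtain ⟨L, rfl⟩ := hSsurj L'
  refine ⟨⟨lam, L, ?_, ?_, ?_, hnd⟩⟩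
  · intro h
    refine eq_of_forall_dual (k := k) fun g => ?_
    rw [map_sw (L := g)]
    simp only [map_smul, smul_eq_mul]
    have := LinearMap.congr_fun (hlam g) h
    rw [cv_apply] at this
    rw [this]
    simp [mul_comm]
  · intro h
    apply hSinj
    rw [antipode_mul_antidistrib, hL2, counit_antipode, map_smul]
  · simpa using hL1 1

namespace IntegralPair

variable [FiniteDimensional k H] (I : IntegralPair k H)

theorem cv_lam (g : H →ₗ[k] k) : cv I.lam g = g 1 • I.lam := by
  ext x
  have := congrArg g (I.lam_right x)
  rw [map_sw (L := g)] at this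
  simp only [map_smul, smul_eq_mul] at this
  rw [cv_apply, this, LinearMap.smul_apply, smul_eq_mul, mul_comm]

omit [FiniteDimensional k H] in
theorem lam_ne_zero : I.lam ≠ 0 := by
  intro h
  simpa [h] using I.lam_antipode_Lam

include I in
protected theorem antipode_injective : Function.Injective (antipode k (A := H)) := by
  rw [injective_iff_map_eq_zero]
  intro a ha
  exact antipode_injective_of_integral I.lam_ne_zero I.cv_lam (by simp [ha])

end IntegralPair

theorem antipode_injective [FiniteDimensional k H] : Function.Injective (antipode k (A := H)) :=
  (nonempty_integralPair (k := k) (H := H)).some.antipode_injective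

theorem antipode_surjective [FiniteDimensional k H] :
    Function.Surjective (antipode k (A := H)) :=
  LinearMap.injective_iff_surjective.1 antipode_injective

open Coalgebra HopfAlgebra TensorProduct

section IntegralCalculus

variable {k H : Type*} [Field k] [Ring H] [HopfAlgebra k H]

/-- The antipode as a linear equivalence. -/
noncomputable def antipodeEquiv (k H : Type*) [Field k] [Ring H] [HopfAlgebra k H]
    [FiniteDimensional k H] : H ≃ₗ[k] H :=
  LinearEquiv.ofBijective (antipode k) ⟨antipode_injective, antipode_surjective⟩

@[simp] theorem antipodeEquiv_apply [FiniteDimensional k H] (h : H) :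
    antipodeEquiv k H h = antipode k h := rfl

@[simp] theorem antipode_symm_apply [FiniteDimensional k H] (h : H) :
    antipode k ((antipodeEquiv k H).symm h) = h := (antipodeEquiv k H).apply_symm_apply h

namespace IntegralPair

variable (I : IntegralPair k H) {M : Type*} [AddCommMonoid M] [Module k M]

theorem sw_antipode_mul_Lam (F : H → H → M) (h : H)
    (hl : ∀ b, IsLinearMap k (fun a => F a b) := by fun_prop)
    (hr : ∀ a, IsLinearMap k (fun b => F a b) := by fun_prop) :
    sw k (fun a b => F (antipode k h * a) b) I.Lam = sw k (fun a b => F a (h * b)) I.Lam := by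
  rw [sw_mul_antipode_left F h I.Lam hl hr]
  have h1 : ∀ h₁ h₂, sw k (fun a b => F a (h₁ * b)) (antipode k h₂ * I.Lam) =
      counit (R := k) h₂ • sw k (fun a b => F a (h₁ * b)) I.Lam := by
    intro h₁ h₂
    have hL : IsLinearMap k (fun z => sw k (fun a b => F a (h₁ * b)) z) := by fun_prop
    rw [I.Lam_left, hL.map_smul, counit_antipode]
  rw [sw_congr _ h1]
  exact sw_counit_right (fun h₁ => sw k (fun a b => F a (h₁ * b)) I.Lam) h

variable [FiniteDimensional k H]

theorem casimir (F : H → H → M) (h : H)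
    (hl : ∀ b, IsLinearMap k (fun a => F a b) := by fun_prop)
    (hr : ∀ a, IsLinearMap k (fun b => F a b) := by fun_prop) :
    sw k (fun a b => F (h * a) (antipode k b)) I.Lam =
      sw k (fun a b => F a (antipode k b * h)) I.Lam := by
  obtain ⟨h, rfl⟩ := antipode_surjective (k := k) h
  rw [I.sw_antipode_mul_Lam (fun a b => F a (antipode k b)) h]
  simp only [antipode_mul_antidistrib]

theorem sw_lam_smul (x : H) : sw k (fun a b => I.lam (antipode k b * x) • a) I.Lam = x := by
  rw [← I.casimir (fun a b => I.lam b • a) x]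
  simp only [← mul_smul_comm, sw_const_mul]
  conv_rhs => rw [← mul_one x]
  congr 1
  apply antipode_injective (k := k)
  rw [map_sw (L := antipode k)]
  simp only [map_smul]
  rw [← sw_antipode (fun a b => I.lam a • b), I.lam_right, I.lam_antipode_Lam, antipode_one,
    one_smul]

theorem sw_lam_smul_antipode (y : H) :
    sw k (fun a b => I.lam (y * a) • antipode k b) I.Lam = y := by
  refine sub_eq_zero.1 (I.nondeg _ fun x => ?_)
  rw [sub_mul, map_sub, sub_eq_zero]
  conv_rhs => rw [← I.sw_lam_smul x, ← sw_const_mul, map_sw (L := I.lam)]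
  rw [← sw_mul_const, map_sw (L := I.lam)]
  refine sw_congr _ fun a b => ?_
  simp [mul_comm]

theorem trace_eq (F : H →ₗ[k] H) :
    LinearMap.trace k H F = sw k (fun a b => I.lam (antipode k b * F a)) I.Lam := by
  have h1 : F = sw k (fun a b => LinearMap.smulRight (actl I.lam (antipode k b)) (F a)) I.Lam := by
    ext x
    rw [sw, LinearMap.sum_apply]
    conv_lhs => rw [← I.sw_lam_smul x]
    rw [map_sw (L := F)]
    simp [sw]
  conv_lhs => rw [h1]
  rw [sw, map_sum]
  simp [sw]

theorem eq_smul_lam (δ : H →ₗ[k] k) (hδ : ∀ h, sw k (fun a b => δ a • b) h = δ h • 1) :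
    δ = δ (antipode k I.Lam) • I.lam := by
  ext y
  conv_lhs => rw [← I.sw_lam_smul_antipode y]
  rw [map_sw (L := δ)]
  have h1 : sw k (fun a b => δ (antipode k b) • a) I.Lam = δ (antipode k I.Lam) • 1 := by
    apply antipode_injective (k := k)
    rw [map_sw (L := antipode k)]
    simp only [map_smul, antipode_one]
    rw [← sw_antipode (fun a b => δ a • b), hδ]
  calc _ = I.lam (y * sw k (fun a b => δ (antipode k b) • a) I.Lam) := by
        rw [← sw_const_mul, map_sw (L := I.lam)]
        refine sw_congr _ fun a b => ?_
        simp [mul_comm]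
    _ = _ := by
        rw [h1]
        simp

theorem isSemisimpleRing (hε : counit (R := k) I.Lam ≠ 0) : IsSemisimpleRing H := by
  refine (isSemisimpleModule_iff H H).2 ⟨fun J => ?_⟩
  obtain ⟨π, hπ⟩ := LinearMap.exists_leftInverse_of_injective (J.restrictScalars k).subtype
    (Submodule.ker_subtype _)
  have hπ' : ∀ m (hm : m ∈ J), (π m : H) = m := fun m hm =>
    congrArg Subtype.val (LinearMap.congr_fun hπ ⟨m, hm⟩)
  let q : H →ₗ[k] H := (J.restrictScalars k).subtype ∘ₗ π
  have hq : ∀ m, q m ∈ J := fun m => (π m).2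
  have hq' : ∀ m ∈ J, q m = m := hπ'
  let f : H →ₗ[k] H := IsLinearMap.mk'
    (fun m => sw k (fun a b => a * q (antipode k b * m)) I.Lam) (by fun_prop)
  have hfJ : ∀ m, f m ∈ J := fun m => J.sum_mem fun i _ => J.smul_mem _ (hq _)
  have hfH : ∀ h m, f (h * m) = h * f m := by
    intro h m
    have := I.casimir (fun a b => a * q (b * m)) h
    simp only [mul_assoc, sw_const_mul] at this
    exact this.symm
  have hf1 : ∀ m ∈ J, f m = counit (R := k) I.Lam • m := by
    intro m hm
    have h1 : ∀ a b, a * q (antipode k b * m) = a * antipode k b * m := fun a b => by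
      rw [hq' (antipode k b * m) (J.smul_mem _ hm), mul_assoc]
    change sw k (fun a b => a * q (antipode k b * m)) I.Lam = _
    rw [sw_congr _ h1, sw_mul_antipode (fun z => z * m), one_mul]
  let g : H →ₗ[H] J :=
    { toFun := fun m => ⟨(counit (R := k) I.Lam)⁻¹ • f m, by
        rw [Algebra.smul_def]; exact J.smul_mem _ (hfJ m)⟩
      map_add' := fun x y => Subtype.ext (by simp)
      map_smul' := fun h x => Subtype.ext (by
        simp only [smul_eq_mul, hfH, RingHom.id_apply, SetLike.mk_smul_mk, mul_smul_comm]) }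
  exact ⟨_, LinearMap.isCompl_of_proj (f := g) fun x => Subtype.ext (by
    change (counit (R := k) I.Lam)⁻¹ • f x = x
    rw [hf1 x x.2, smul_smul, inv_mul_cancel₀ hε, one_smul])⟩

omit [FiniteDimensional k H] in
theorem character_Lam (hε : counit (R := k) I.Lam = 0) (χ : H →ₐ[k] k) : χ I.Lam = 0 := by
  by_cases h : ∃ h, χ h ≠ counit (R := k) h
  · obtain ⟨h, hh⟩ := h
    have := congrArg χ (I.Lam_left h)
    rw [map_mul, map_smul, smul_eq_mul] at this
    by_contra h0
    exact hh (mul_right_cancel₀ h0 this)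
  · push Not at h
    rw [h, hε]

theorem trace_antipode_sq_mul (hε : counit (R := k) I.Lam = 0) (a : H) :
    LinearMap.trace k H (LinearMap.mulRight k a ∘ₗ antipode k ∘ₗ antipode k) = 0 := by
  rw [I.trace_eq]
  have h1 : ∀ u v : H, I.lam (antipode k v *
      (LinearMap.mulRight k a ∘ₗ antipode k ∘ₗ antipode k) u) =
      I.lam (antipode k (antipode k u * v) * a) := fun u v => by
    simp [antipode_mul_antidistrib, mul_assoc]
  rw [sw_congr _ h1, sw_antipode_mul (fun z => I.lam (antipode k z * a)), hε, zero_smul]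

end IntegralPair

/-- The left hit operator `h ↦ χ(h₁) h₂` of a functional. -/
noncomputable def hitL (χ : H →ₗ[k] k) : H →ₗ[k] H :=
  IsLinearMap.mk' (fun h => sw k (fun a b => χ a • b) h) (by fun_prop)

/-- The right hit operator `h ↦ h₁ χ(h₂)` of a functional. -/
noncomputable def hitR (χ : H →ₗ[k] k) : H →ₗ[k] H :=
  IsLinearMap.mk' (fun h => sw k (fun a b => χ b • a) h) (by fun_prop)

theorem hitL_apply (χ : H →ₗ[k] k) (h : H) : hitL χ h = sw k (fun a b => χ a • b) h := rfl

theorem hitR_apply (χ : H →ₗ[k] k) (h : H) : hitR χ h = sw k (fun a b => χ b • a) h := rfl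

theorem IntegralPair.trace_antipode_sq_hitL [FiniteDimensional k H] (I : IntegralPair k H)
    (hε : counit (R := k) I.Lam = 0) (χ : H →ₐ[k] k) :
    LinearMap.trace k H ((antipode k ∘ₗ antipode k) ∘ₗ hitL χ.toLinearMap) = 0 := by
  rw [I.trace_eq]
  calc _ = sw k (fun w v => sw k (fun x u => χ x • I.lam
            (antipode k (antipode k u * v))) w) I.Lam := by
        refine sw_congr _ fun w v => ?_
        simp only [LinearMap.comp_apply, hitL_apply]
        rw [map_sw (L := fun z => I.lam (antipode k v * antipode k (antipode k z)))]
        refine sw_congr _ fun x u => ?_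
        simp [antipode_mul_antidistrib]
    _ = sw k (fun x w => sw k (fun u v => χ x • I.lam
            (antipode k (antipode k u * v))) w) I.Lam :=
        sw_assoc (fun x u v => χ.toLinearMap x • I.lam (antipode k (antipode k u * v))) _
    _ = sw k (fun x w => counit (R := k) w • (χ x • I.lam 1)) I.Lam := by
        refine sw_congr _ fun x w => ?_
        rw [sw_antipode_mul (fun z => χ x • I.lam (antipode k z)), antipode_one]
    _ = χ I.Lam • I.lam 1 := sw_counit_right (fun x => χ.toLinearMap x • I.lam 1) _
    _ = 0 := by rw [I.character_Lam hε, zero_smul]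

end IntegralCalculus

open Coalgebra HopfAlgebra TensorProduct

section DualHopf

variable (k H : Type*) [Field k] [Ring H] [HopfAlgebra k H]

/-- The dual of a Hopf algebra, with the convolution product. -/
def DualHopf := WithConv (H →ₗ[k] k)

noncomputable instance : Ring (DualHopf k H) := inferInstanceAs (Ring (WithConv (H →ₗ[k] k)))

noncomputable instance : Algebra k (DualHopf k H) :=
  inferInstanceAs (Algebra k (WithConv (H →ₗ[k] k)))

variable {k H}

namespace DualHopf

/-- A functional, regarded as an element of the dual Hopf algebra. -/
def mk (f : H →ₗ[k] k) : DualHopf k H := WithConv.toConv f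

/-- The functional underlying an element of the dual Hopf algebra. -/
def fn (f : DualHopf k H) : H →ₗ[k] k := f.ofConv

@[simp] theorem fn_mk (f : H →ₗ[k] k) : (mk f).fn = f := rfl

@[simp] theorem mk_fn (f : DualHopf k H) : mk f.fn = f := rfl

theorem fn_injective : Function.Injective (fn : DualHopf k H → H →ₗ[k] k) :=
  WithConv.ofConv_injective

@[fun_prop]
theorem isLinearMap_mk {X : Type*} [AddCommMonoid X] [Module k X] {f : X → H →ₗ[k] k}
    (hf : IsLinearMap k f) : IsLinearMap k (fun x => (mk (f x) : DualHopf k H)) :=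
  ⟨fun x y => by rw [hf.map_add]; rfl, fun c x => by rw [hf.map_smul]; rfl⟩

@[fun_prop]
theorem isLinearMap_fn {X : Type*} [AddCommMonoid X] [Module k X] {f : X → DualHopf k H}
    (hf : IsLinearMap k f) : IsLinearMap k (fun x => (f x).fn) :=
  ⟨fun x y => by rw [hf.map_add]; rfl, fun c x => by rw [hf.map_smul]; rfl⟩

variable (k H) in
/-- The identification of the dual Hopf algebra with the space of functionals. -/
noncomputable def equiv : DualHopf k H ≃ₗ[k] (H →ₗ[k] k) := WithConv.linearEquiv k (H →ₗ[k] k)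

theorem mul_eq (f g : DualHopf k H) : f * g = mk (cv f.fn g.fn) := by
  refine fn_injective (LinearMap.ext fun x => ?_)
  exact convMul_apply_eq_sw _ _ _

theorem one_eq : (1 : DualHopf k H) = mk counit := rfl

variable [FiniteDimensional k H]

instance : FiniteDimensional k (DualHopf k H) :=
  (equiv k H).symm.finiteDimensional

variable (k H) in
theorem finrank_eq : Module.finrank k (DualHopf k H) = Module.finrank k H :=
  (equiv k H).finrank_eq.trans (Subspace.dual_finrank_eq (K := k) (V := H))

/-- The dual basis. -/
noncomputable def db (i : Fin (Module.finrank k H)) : DualHopf k H :=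
  mk ((Module.finBasis k H).coord i)

noncomputable instance : CoalgebraStruct k (DualHopf k H) where
  comul := IsLinearMap.mk' (fun f => ∑ i, ∑ j,
    f.fn (Module.finBasis k H i * Module.finBasis k H j) • (db i ⊗ₜ[k] db j)) (by fun_prop)
  counit := IsLinearMap.mk' (fun f => f.fn 1) (by fun_prop)

theorem comul_apply (f : DualHopf k H) : comul (R := k) f = ∑ i, ∑ j,
    f.fn (Module.finBasis k H i * Module.finBasis k H j) • (db i ⊗ₜ[k] db j) := rfl

theorem counit_apply (f : DualHopf k H) : counit (R := k) f = f.fn 1 := rfl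

theorem sum_smul_db (f : DualHopf k H) : ∑ i, f.fn (Module.finBasis k H i) • db i = f := by
  apply fn_injective
  change equiv k H _ = _
  rw [map_sum]
  exact sum_apply_smul_coord (Module.finBasis k H) f.fn

theorem sum_smul_db' (f : H →ₗ[k] k) :
    ∑ i, f (Module.finBasis k H i) • (db i : DualHopf k H) = mk f :=
  sum_smul_db (mk f)

theorem sum_sum_db {M : Type*} [AddCommMonoid M] [Module k M] (φ : H →ₗ[k] k) (F : DualHopf k H → M)
    (hF : IsLinearMap k F := by fun_prop) :
    ∑ i, φ (Module.finBasis k H i) • F (db i) = F (mk φ) := by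
  rw [← sum_smul_db' φ, ← hF.mk'_apply, map_sum]
  simp

theorem sum_db_apply {M : Type*} [AddCommMonoid M] [Module k M] (x : H) (F : H → M)
    (hF : IsLinearMap k F := by fun_prop) :
    ∑ i, (db i).fn x • F (Module.finBasis k H i) = F x :=
  sum_coord_smul_apply _ F x hF

noncomputable instance : Coalgebra k (DualHopf k H) where
  coassoc := by
    refine LinearMap.ext fun f => ?_
    simp only [LinearMap.comp_apply, comul_apply f, map_sum, map_smul, LinearMap.rTensor_tmul,
      LinearMap.lTensor_tmul, LinearEquiv.coe_coe]
    trans ∑ l, TensorProduct.assoc k (DualHopf k H) (DualHopf k H) (DualHopf k H)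
      (comul (mk (f.fn ∘ₗ LinearMap.mulRight k (Module.finBasis k H l))) ⊗ₜ db l)
    · rw [Finset.sum_comm]
      refine Finset.sum_congr rfl fun l _ => ?_
      exact sum_sum_db (f.fn ∘ₗ LinearMap.mulRight k (Module.finBasis k H l)) (fun φ =>
        TensorProduct.assoc k (DualHopf k H) (DualHopf k H) (DualHopf k H) (comul φ ⊗ₜ db l))
        (IsLinearMap.fun_comp (LinearMap.isLinear (TensorProduct.assoc k _ _ _).toLinearMap)
          (by fun_prop))
    trans ∑ i, db i ⊗ₜ[k] comul (R := k)
      (mk (f.fn ∘ₗ LinearMap.mulLeft k (Module.finBasis k H i)) : DualHopf k H)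
    · simp only [comul_apply, fn_mk, LinearMap.comp_apply, LinearMap.mulRight_apply,
        LinearMap.mulLeft_apply, TensorProduct.sum_tmul, TensorProduct.tmul_sum,
        ← TensorProduct.smul_tmul', TensorProduct.tmul_smul, map_sum, map_smul,
        TensorProduct.assoc_tmul, ← mul_assoc]
      rw [Finset.sum_comm]
      refine Finset.sum_congr rfl fun i _ => ?_
      rw [Finset.sum_comm]
    · refine Finset.sum_congr rfl fun i _ => ?_
      exact (sum_sum_db (f.fn ∘ₗ LinearMap.mulLeft k (Module.finBasis k H i)) (fun φ =>
        db i ⊗ₜ[k] comul (R := k) φ)).symm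
  rTensor_counit_comp_comul := by
    refine LinearMap.ext fun f => ?_
    simp only [LinearMap.comp_apply, comul_apply, map_sum, map_smul, LinearMap.rTensor_tmul,
      counit_apply, TensorProduct.mk_apply]
    rw [Finset.sum_comm]
    trans ∑ j, f.fn (1 * Module.finBasis k H j) • ((1 : k) ⊗ₜ[k] (db j : DualHopf k H))
    · refine Finset.sum_congr rfl fun j _ => ?_
      rw [← sum_db_apply (k := k) (1 : H) (fun z => f.fn (z * Module.finBasis k H j)), Finset.sum_smul]
      refine Finset.sum_congr rfl fun i _ => ?_
      rw [smul_eq_mul, mul_comm, mul_smul, TensorProduct.smul_tmul' _ (1 : k), smul_eq_mul, mul_one]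
    · simp only [one_mul]
      exact sum_sum_db f.fn (fun φ => (1 : k) ⊗ₜ[k] φ)
  lTensor_counit_comp_comul := by
    refine LinearMap.ext fun f => ?_
    simp only [LinearMap.comp_apply, comul_apply, map_sum, map_smul, LinearMap.lTensor_tmul,
      counit_apply, TensorProduct.mk_apply, LinearMap.flip_apply]
    trans ∑ i, f.fn (Module.finBasis k H i * 1) • ((db i : DualHopf k H) ⊗ₜ[k] (1 : k))
    · refine Finset.sum_congr rfl fun j _ => ?_
      rw [← sum_db_apply (k := k) (1 : H) (fun z => f.fn (Module.finBasis k H j * z)), Finset.sum_smul]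
      refine Finset.sum_congr rfl fun i _ => ?_
      rw [smul_eq_mul, mul_comm, mul_smul, ← TensorProduct.tmul_smul _ _ (1 : k), smul_eq_mul, mul_one]
    · simp only [mul_one]
      exact sum_sum_db f.fn (fun φ => φ ⊗ₜ[k] (1 : k))

theorem sw_eq {M : Type*} [AddCommMonoid M] [Module k M]
    (F : DualHopf k H → DualHopf k H → M) (f : DualHopf k H)
    (hl : ∀ b, IsLinearMap k (fun a => F a b) := by fun_prop)
    (hr : ∀ a, IsLinearMap k (fun b => F a b) := by fun_prop) :
    sw k F f = ∑ i, ∑ j, f.fn (Module.finBasis k H i * Module.finBasis k H j) •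
      F (db i) (db j) := by
  rw [sw_eq_lift F f hl hr, comul_apply]
  simp

theorem sw_apply_mul_apply (f : DualHopf k H) (x y : H) :
    sw k (fun a b => a.fn x * b.fn y) f = f.fn (x * y) := by
  rw [sw_eq (fun a b => a.fn x * b.fn y)]
  simp only [mul_comm _ ((db _).fn x * (db _).fn y), smul_eq_mul]
  have h1 : ∀ i, ∑ j, (db j).fn y * f.fn (Module.finBasis k H i * Module.finBasis k H j) =
      f.fn (Module.finBasis k H i * y) := fun i =>
    sum_db_apply (k := k) y (fun z => f.fn (Module.finBasis k H i * z))
  simp only [mul_assoc, ← Finset.mul_sum, h1]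
  exact sum_db_apply (k := k) x (fun z => f.fn (z * y))

theorem comul_mul (f g : DualHopf k H) :
    comul (R := k) (f * g) = comul f * comul g := by
  set b := Module.finBasis k H
  calc comul (R := k) (f * g) = ∑ i, sw k (fun x y => ∑ j, sw k (fun x' y' =>
          (f.fn (x * x') * g.fn (y * y')) • (db i : DualHopf k H) ⊗ₜ[k]
            (db j : DualHopf k H)) (b j)) (b i) := by
        rw [comul_apply]
        refine Finset.sum_congr rfl fun i _ => ?_
        rw [sw_sum]
        refine Finset.sum_congr rfl fun j _ => ?_
        rw [mul_eq]
        simp only [sw_smul_const]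
        congr 1
        exact sw_mul (fun x y => f.fn x * g.fn y) (b i) (b j)
    _ = ∑ i, ∑ l, ∑ j, sw k (fun x' y' =>
          (f.fn (b i * x') * g.fn (b l * y')) •
          (db i * db l : DualHopf k H) ⊗ₜ[k] (db j : DualHopf k H)) (b j) := by
        refine (sum_sw_coord b (fun φ x y => ∑ j, sw k (fun x' y' =>
          (f.fn (x * x') * g.fn (y * y')) • (mk φ : DualHopf k H) ⊗ₜ[k]
            (db j : DualHopf k H)) (b j))).trans ?_
        simp only [mul_eq]
        rfl
    _ = ∑ i, ∑ l, ∑ j, ∑ m,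
          (f.fn (b i * b j) * g.fn (b l * b m)) •
          (db i * db l : DualHopf k H) ⊗ₜ[k] (db j * db m : DualHopf k H) := by
        refine Finset.sum_congr rfl fun i _ => Finset.sum_congr rfl fun l _ => ?_
        generalize (db i * db l : DualHopf k H) = c
        refine (sum_sw_coord b (fun φ x' y' => (f.fn (b i * x') * g.fn (b l * y')) •
          c ⊗ₜ[k] (mk φ : DualHopf k H))).trans ?_
        simp only [mul_eq]
        rfl
    _ = comul f * comul g := by
        rw [comul_apply f, comul_apply g]
        simp only [Finset.sum_mul, Finset.mul_sum, smul_mul_smul_comm,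
          Algebra.TensorProduct.tmul_mul_tmul]
        rw [Finset.sum_comm]
        refine Finset.sum_congr rfl fun l _ => ?_
        conv_rhs => rw [Finset.sum_comm]
        refine Finset.sum_congr rfl fun i _ => ?_
        rw [Finset.sum_comm]

noncomputable instance : Bialgebra k (DualHopf k H) :=
  Bialgebra.mk' k (DualHopf k H)
    (by rw [counit_apply, one_eq]; exact Bialgebra.counit_one)
    (by
      intro a b
      simp only [counit_apply, mul_eq]
      exact sw_one (fun x y => a.fn x * b.fn y))
    (by
      rw [comul_apply]
      simp only [one_eq, fn_mk, Bialgebra.counit_mul, mul_smul, ← Finset.smul_sum]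
      have h1 : ∀ i, ∑ j, counit (R := k) (Module.finBasis k H j) •
          ((db i : DualHopf k H) ⊗ₜ[k] (db j : DualHopf k H)) = db i ⊗ₜ 1 := fun i =>
        sum_sum_db (counit (R := k) (A := H)) (fun φ => db i ⊗ₜ[k] φ)
      simp only [h1]
      exact sum_sum_db (counit (R := k) (A := H)) (fun φ => φ ⊗ₜ[k] 1))
    (comul_mul _ _)

noncomputable instance : HopfAlgebraStruct k (DualHopf k H) where
  antipode := IsLinearMap.mk' (fun f => mk (f.fn ∘ₗ antipode k))
    ⟨fun _ _ => rfl, fun _ _ => rfl⟩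

theorem antipode_apply (f : DualHopf k H) : antipode k f = mk (f.fn ∘ₗ antipode k) := rfl

noncomputable instance : HopfAlgebra k (DualHopf k H) where
  mul_antipode_rTensor_comul := by
    refine LinearMap.ext fun f => ?_
    rw [LinearMap.comp_apply, LinearMap.comp_apply, ← sw_tmul f,
      map_sw (L := LinearMap.rTensor _ _), map_sw (L := LinearMap.mul' k _)]
    simp only [LinearMap.rTensor_tmul, LinearMap.mul'_apply]
    refine fn_injective (LinearMap.ext fun x => ?_)
    rw [map_sw (L := fun z : DualHopf k H => z.fn x)]
    simp only [mul_eq, antipode_apply, fn_mk, cv_apply, LinearMap.comp_apply]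
    rw [sw_comm]
    simp only [sw_apply_mul_apply]
    rw [sw_antipode_mul (fun z => f.fn z)]
    rw [Algebra.linearMap_apply, Algebra.algebraMap_eq_smul_one, counit_apply]
    exact mul_comm _ _
  mul_antipode_lTensor_comul := by
    refine LinearMap.ext fun f => ?_
    rw [LinearMap.comp_apply, LinearMap.comp_apply, ← sw_tmul f,
      map_sw (L := LinearMap.lTensor _ _), map_sw (L := LinearMap.mul' k _)]
    simp only [LinearMap.lTensor_tmul, LinearMap.mul'_apply]
    refine fn_injective (LinearMap.ext fun x => ?_)
    rw [map_sw (L := fun z : DualHopf k H => z.fn x)]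
    simp only [mul_eq, antipode_apply, fn_mk, cv_apply, LinearMap.comp_apply]
    rw [sw_comm]
    simp only [sw_apply_mul_apply]
    rw [sw_mul_antipode (fun z => f.fn z)]
    rw [Algebra.linearMap_apply, Algebra.algebraMap_eq_smul_one, counit_apply]
    exact mul_comm _ _

theorem isGroupLikeElem_of_algHom (χ : H →ₐ[k] k) :
    IsGroupLikeElem k (mk χ.toLinearMap : DualHopf k H) where
  counit_eq_one := map_one χ
  comul_eq_tmul_self := by
    rw [comul_apply]
    simp only [fn_mk, AlgHom.toLinearMap_apply, map_mul, mul_smul, ← Finset.smul_sum]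
    have h1 : ∀ i, ∑ j, χ (Module.finBasis k H j) •
        ((db i : DualHopf k H) ⊗ₜ[k] (db j : DualHopf k H)) = db i ⊗ₜ (mk χ.toLinearMap) := fun i =>
      sum_sum_db χ.toLinearMap (fun φ => db i ⊗ₜ[k] φ)
    simp only [h1]
    exact sum_sum_db χ.toLinearMap (fun φ => φ ⊗ₜ[k] mk χ.toLinearMap)

/-- The character given by a group-like element of the dual. -/
noncomputable def toAlgHom {f : DualHopf k H} (hf : IsGroupLikeElem k f) : H →ₐ[k] k :=
  AlgHom.ofLinearMap f.fn hf.counit_eq_one fun x y => by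
    rw [← sw_apply_mul_apply, sw_groupLike hf (fun a b => a.fn x * b.fn y)]

theorem toAlgHom_apply {f : DualHopf k H} (hf : IsGroupLikeElem k f) (x : H) :
    toAlgHom hf x = f.fn x := rfl

end DualHopf

end DualHopf

open Coalgebra HopfAlgebra TensorProduct

section RootSums

variable {k : Type*} [Field k] [IsAlgClosed k] [CharZero k]

theorem IsPrimitiveRoot.cyclotomic_dvd_of_aeval_eq_zero {ζ : k} {n : ℕ} (hn : 0 < n)
    (hζ : IsPrimitiveRoot ζ n) {Q : Polynomial ℤ} (hQ : Polynomial.aeval ζ Q = 0) :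
    Polynomial.cyclotomic n ℤ ∣ Q := by
  rw [Polynomial.cyclotomic_eq_minpoly hζ hn]
  exact minpoly.isIntegrallyClosed_dvd (hζ.isIntegral hn) hQ

theorem IsPrimitiveRoot.aeval_eq_zero_of_cyclotomic_dvd {R : Type*} [CommRing R] [IsDomain R]
    {ζ : R} {n : ℕ} (hn : 0 < n) (hζ : IsPrimitiveRoot ζ n) {Q : Polynomial ℤ}
    (hQ : Polynomial.cyclotomic n ℤ ∣ Q) : Polynomial.aeval ζ Q = 0 := by
  obtain ⟨R, rfl⟩ := hQ
  have := (hζ.isRoot_cyclotomic hn)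
  rw [Polynomial.IsRoot.def, ← Polynomial.map_cyclotomic_int n, Polynomial.eval_map] at this
  rw [map_mul, Polynomial.aeval_def]
  exact mul_eq_zero_of_left this _

variable {ι : Type*} [Fintype ι]

theorem exists_primitiveRoot_pow {n : ℕ} (hn : 0 < n) {a : ι → k} (ha : ∀ i, a i ^ n = 1) :
    ∃ (ζ : k) (e : ι → ℕ), IsPrimitiveRoot ζ n ∧ ∀ i, a i = ζ ^ e i := by
  have : NeZero n := ⟨hn.ne'⟩
  obtain ⟨ζ, hζ⟩ := HasEnoughRootsOfUnity.exists_primitiveRoot k n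
  choose e _ he using fun i => hζ.eq_pow_of_pow_eq_one (ha i)
  exact ⟨ζ, e, hζ, fun i => (he i).symm⟩

theorem sum_inv_eq_zero_of_pow_eq_one {n : ℕ} (hn : 0 < n) {a : ι → k} (ha : ∀ i, a i ^ n = 1)
    (h0 : ∑ i, a i = 0) : ∑ i, (a i)⁻¹ = 0 := by
  obtain ⟨ζ, e, hζ, he⟩ := exists_primitiveRoot_pow hn ha
  have h1 : Polynomial.aeval ζ (∑ i, (Polynomial.X : Polynomial ℤ) ^ e i) = 0 := by
    simpa [he] using h0
  have h2 := hζ.inv.aeval_eq_zero_of_cyclotomic_dvd hn (hζ.cyclotomic_dvd_of_aeval_eq_zero hn h1)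
  simpa [he] using h2

theorem eq_one_of_sum_eq_card {n : ℕ} (hn : 0 < n) {a : ι → k} (ha : ∀ i, a i ^ n = 1)
    (h0 : ∑ i, a i = Fintype.card ι) (i : ι) : a i = 1 := by
  obtain ⟨ζ, e, hζ, he⟩ := exists_primitiveRoot_pow hn ha
  have h1 : Polynomial.aeval ζ
      (∑ i, (Polynomial.X : Polynomial ℤ) ^ e i - Polynomial.C (Fintype.card ι : ℤ)) = 0 := by
    simpa [he, sub_eq_zero] using h0
  have hξ := Complex.isPrimitiveRoot_exp n hn.ne'
  set ξ := Complex.exp (2 * Real.pi * Complex.I / n)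
  have h2 := hξ.aeval_eq_zero_of_cyclotomic_dvd hn (hζ.cyclotomic_dvd_of_aeval_eq_zero hn h1)
  have hnorm : ∀ j, ‖ξ ^ e j‖ = 1 := fun j => by
    rw [norm_pow, hξ.norm'_eq_one hn.ne', one_pow]
  have h3 : ∑ j, (1 - (ξ ^ e j).re) = 0 := by
    have : (∑ j, ξ ^ e j) = Fintype.card ι := by simpa [sub_eq_zero] using h2
    have := congrArg Complex.re this
    simp only [Complex.re_sum, Complex.natCast_re] at this
    simp [this]
  have h4 : ∀ j, 0 ≤ 1 - (ξ ^ e j).re := fun j =>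
    sub_nonneg.2 ((Complex.re_le_norm _).trans (hnorm j).le)
  have h5 := (Finset.sum_eq_zero_iff_of_nonneg fun j _ => h4 j).1 h3 i (Finset.mem_univ i)
  have h6 : ξ ^ e i = 1 := by
    have hre : (ξ ^ e i).re = 1 := by linarith
    have hsq := Complex.sq_norm (ξ ^ e i)
    rw [hnorm, Complex.normSq_apply, hre] at hsq
    have him : (ξ ^ e i).im = 0 := by nlinarith
    exact Complex.ext hre him
  rw [he i, (hζ.pow_eq_one_iff_dvd _).2 ((hξ.pow_eq_one_iff_dvd _).1 h6)]

theorem two_dvd_card_of_sum_eq_zero {a : ι → k} (ha : ∀ i, a i ^ 8 = 1)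
    (h0 : ∑ i, a i = 0) : 2 ∣ Fintype.card ι := by
  obtain ⟨ζ, e, hζ, he⟩ := exists_primitiveRoot_pow (by norm_num) ha
  have h1 : Polynomial.aeval ζ (∑ i, (Polynomial.X : Polynomial ℤ) ^ e i) = 0 := by
    simpa [he] using h0
  have h2 := map_dvd (Polynomial.evalRingHom (1 : ℤ))
    (hζ.cyclotomic_dvd_of_aeval_eq_zero (by norm_num) h1)
  have h3 : Polynomial.eval (1 : ℤ) (Polynomial.cyclotomic 8 ℤ) = 2 := by
    have : Fact (Nat.Prime 2) := ⟨Nat.prime_two⟩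
    simpa using Polynomial.eval_one_cyclotomic_prime_pow (R := ℤ) (p := 2) 2
  simp only [Polynomial.coe_evalRingHom, h3, Polynomial.eval_finsetSum, Polynomial.eval_pow,
    Polynomial.eval_X, one_pow, Finset.sum_const, Finset.card_univ, nsmul_eq_mul, mul_one] at h2
  exact_mod_cast h2

/-- Four roots of unity with sum zero, one of which is `1`, come in opposite pairs. -/
theorem exists_opposite_of_sum_eq_zero {n : ℕ} (hn : 0 < n) {x y z : k} (hx : x ^ n = 1)
    (hy : y ^ n = 1) (hz : z ^ n = 1) (h0 : 1 + x + y + z = 0) :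
    (x = -1 ∧ z = -y) ∨ (y = -1 ∧ z = -x) ∨ (z = -1 ∧ y = -x) := by
  have hinv := sum_inv_eq_zero_of_pow_eq_one (a := ![1, x, y, z]) hn
    (by intro i; fin_cases i <;> simp [hx, hy, hz]) (by simpa [Fin.sum_univ_four] using h0)
  simp only [Fin.sum_univ_four, Matrix.cons_val_zero, Matrix.cons_val_one, Matrix.cons_val,
    inv_one] at hinv
  have hx0 : x ≠ 0 := fun h => by simp [h, hn.ne'] at hx
  have hy0 : y ≠ 0 := fun h => by simp [h, hn.ne'] at hy
  have hz0 : z ≠ 0 := fun h => by simp [h, hn.ne'] at hz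
  field_simp at hinv
  have hp : (x + 1) * ((y + 1) * (z + 1)) = 0 := by linear_combination hinv + h0
  rcases mul_eq_zero.1 hp with h | h
  · left; exact ⟨by linear_combination h, by linear_combination h0 - h⟩
  rcases mul_eq_zero.1 h with h | h
  · right; left; exact ⟨by linear_combination h, by linear_combination h0 - h⟩
  · right; right; exact ⟨by linear_combination h, by linear_combination h0 - h⟩

end RootSums

section Eigenbasis

variable {k V : Type*} [Field k] [IsAlgClosed k] [CharZero k] [AddCommGroup V] [Module k V]
  [FiniteDimensional k V]

theorem Module.End.exists_eigenbasis {T : Module.End k V} {n : ℕ} (hn : 0 < n) (hT : T ^ n = 1) :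
    ∃ (b : Module.Basis (Fin (Module.finrank k V)) k V) (a : Fin (Module.finrank k V) → k),
      (∀ i, T (b i) = a i • b i) ∧ (∀ i, a i ^ n = 1) := by
  have hss : T.IsSemisimple := by
    refine Module.End.isSemisimple_of_squarefree_aeval_eq_zero
      (p := Polynomial.X ^ n - Polynomial.C 1) ?_ ?_
    · exact (Polynomial.separable_X_pow_sub_C (1 : k) (Nat.cast_ne_zero.2 hn.ne')
        one_ne_zero).squarefree
    · simp [hT]
  have htop : ⨆ μ, T.eigenspace μ = ⊤ := by
    rw [← Module.End.iSup_maxGenEigenspace_eq_top T]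
    exact iSup_congr fun μ => (hss.isFinitelySemisimple.maxGenEigenspace_eq_eigenspace μ).symm
  have hspan : ⊤ ≤ Submodule.span k {v : V | ∃ μ : k, T v = μ • v} := by
    rw [← htop]
    exact iSup_le fun μ v hv => Submodule.subset_span ⟨μ, Module.End.mem_eigenspace_iff.1 hv⟩
  let b0 := Module.Basis.ofSpan hspan
  have : Fintype (LinearIndepOn.extend (K := k) (V := V) (v := id) (s := ∅) (t := {v : V | ∃ μ : k, T v = μ • v}) (linearIndepOn_empty k id) (Set.empty_subset _)) := FiniteDimensional.fintypeBasisIndex b0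
  let b := b0.reindex (Fintype.equivFinOfCardEq (Module.finrank_eq_card_basis b0).symm)
  have hb : ∀ i, ∃ μ : k, T (b i) = μ • b i := fun i => by
    have := Module.Basis.ofSpan_subset hspan
    rw [Module.Basis.reindex_apply]
    exact this (Set.mem_range_self _)
  choose a ha using hb
  refine ⟨b, a, ha, fun i => ?_⟩
  have : ∀ m : ℕ, (T ^ m) (b i) = a i ^ m • b i := fun m => by
    induction m with
    | zero => simp
    | succ m ih => rw [pow_succ', Module.End.mul_apply, ih, map_smul, ha, smul_smul, pow_succ]
  have h1 := this n
  rw [hT, Module.End.one_apply] at h1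
  by_contra hne
  have h2 : (a i ^ n - 1) • b i = 0 := by rw [sub_smul, ← h1, one_smul, sub_self]
  exact (smul_eq_zero.1 h2).elim (fun h => hne (sub_eq_zero.1 h)) (b.ne_zero i)

theorem LinearMap.trace_eq_sum_of_eigenbasis {ι : Type*} [Fintype ι] {T : V →ₗ[k] V}
    (b : Module.Basis ι k V) {a : ι → k} (h : ∀ i, T (b i) = a i • b i) :
    LinearMap.trace k V T = ∑ i, a i := by
  classical
  rw [LinearMap.trace_eq_matrix_trace k b, Matrix.trace]
  exact Finset.sum_congr rfl fun i _ => by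
    rw [Matrix.diag_apply, LinearMap.toMatrix_apply, h]; simp

/-- An operator of finite order and trace zero on a four-dimensional space which has the
eigenvalue `1` has eigenvalues `1, -1, b, -b`. -/
theorem Module.End.exists_eigenbasis_four {T : Module.End k V} (hV : Module.finrank k V = 4) {n : ℕ}
    (hn : 0 < n) (hT : T ^ n = 1) (htr : LinearMap.trace k V T = 0)
    {w : V} (hw : w ≠ 0) (hTw : T w = w) :
    ∃ (b : Module.Basis (Fin 4) k V) (c : k), c ≠ 0 ∧
      T (b 0) = b 0 ∧ T (b 1) = - b 1 ∧ T (b 2) = c • b 2 ∧ T (b 3) = -(c • b 3) := by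
  obtain ⟨b', a', hb', ha'⟩ := Module.End.exists_eigenbasis hn hT
  obtain ⟨b, a, hb, ha⟩ : ∃ (b : Module.Basis (Fin 4) k V) (a : Fin 4 → k),
      (∀ i, T (b i) = a i • b i) ∧ (∀ i, a i ^ n = 1) :=
    ⟨b'.reindex (finCongr hV), fun i => a' ((finCongr hV).symm i), fun i => by
      rw [Module.Basis.reindex_apply, hb'], fun i => ha' _⟩
  have hsum := LinearMap.trace_eq_sum_of_eigenbasis b hb
  rw [htr] at hsum
  have h1 : ∃ i, a i = 1 := by
    by_contra! hne
    refine hw (b.repr.map_eq_zero_iff.1 (Finsupp.ext fun i => ?_))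
    have h2 : b.repr (T w) i = a i * b.repr w i := by
      conv_lhs => rw [← b.sum_repr w]
      simp only [map_sum, map_smul, hb, Finsupp.coe_finsetSum, Finset.sum_apply,
        Finsupp.smul_apply, Module.Basis.repr_self, smul_eq_mul, Finsupp.coe_smul, Pi.smul_apply]
      rw [Finset.sum_eq_single i (fun j _ hj => by simp [Finsupp.single_eq_of_ne hj.symm])
        (by simp)]
      simp [mul_comm]
    rw [hTw] at h2
    have h3 : (a i - 1) * b.repr w i = 0 := by linear_combination -h2
    simpa [sub_eq_zero, hne i] using h3
  obtain ⟨i, hi⟩ := h1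
  wlog hi0 : i = 0 generalizing b a i
  · exact this (b.reindex (Equiv.swap i 0)) (fun j => a (Equiv.swap i 0 j))
      (fun j => by rw [Module.Basis.reindex_apply, Equiv.symm_swap, hb]) (fun j => ha _)
      (by rw [hsum]; exact (Equiv.sum_comp (Equiv.swap i 0) a).symm) 0
      (by simpa using hi) rfl
  subst hi0
  have hc0 : ∀ i, a i ≠ 0 := fun i h => by simpa [h, hn.ne'] using ha i
  have key : ∀ σ : Equiv.Perm (Fin 4), a (σ 0) = 1 → a (σ 1) = -1 → a (σ 3) = -a (σ 2) →
      ∃ (b : Module.Basis (Fin 4) k V) (c : k), c ≠ 0 ∧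
      T (b 0) = b 0 ∧ T (b 1) = - b 1 ∧ T (b 2) = c • b 2 ∧ T (b 3) = -(c • b 3) :=
    fun σ h0 h1 h3 => ⟨b.reindex σ.symm, a (σ 2), hc0 _, by simp [hb, h0], by simp [hb, h1],
      by simp [hb], by simp [hb, h3]⟩
  rw [Fin.sum_univ_four, hi] at hsum
  rcases exists_opposite_of_sum_eq_zero hn (ha 1) (ha 2) (ha 3) hsum.symm with h | h | h
  · exact key 1 hi h.1 h.2
  · exact key (Equiv.swap 1 2) hi (by simpa using h.1)
      (by simpa [Equiv.swap_apply_of_ne_of_ne] using h.2)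
  · exact key (Equiv.swap 1 3) hi (by simpa using h.1)
      (by simp only [Equiv.swap_apply_right, Equiv.swap_apply_of_ne_of_ne (show (2 : Fin 4) ≠ 1 by decide) (show (2 : Fin 4) ≠ 3 by decide)]; rw [h.2, neg_neg])

end Eigenbasis

open Coalgebra HopfAlgebra TensorProduct

section CyclicIdempotents

variable {k A : Type*} [Field k] [CharZero k] [Ring A] [Algebra k A]

/-- The projection onto the `ζ`-eigenspace of multiplication by an element `g` with `g ^ n = 1`. -/
noncomputable def eigIdem (n : ℕ) (ζ : k) (g : A) : A :=
  (n : k)⁻¹ • ∑ j ∈ Finset.range n, (ζ⁻¹ • g) ^ j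

variable {n : ℕ} {ζ : k} {g : A}

theorem mul_eigIdem (hζ : ζ ^ n = 1) (hg : g ^ n = 1) (hn : 0 < n) :
    g * eigIdem n ζ g = ζ • eigIdem n ζ g := by
  have hu : (ζ⁻¹ • g) ^ n = 1 := by rw [smul_pow, inv_pow, hζ, hg, inv_one, one_smul]
  have hζ0 : ζ ≠ 0 := fun h => by simp [h, hn.ne'] at hζ
  have h1 : (ζ⁻¹ • g) * eigIdem n ζ g = eigIdem n ζ g := by
    rw [eigIdem, mul_smul_comm, Finset.mul_sum]
    congr 1
    have h2 := Finset.sum_range_succ' (fun j => (ζ⁻¹ • g) ^ j) n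
    rw [Finset.sum_range_succ, hu, pow_zero, add_left_inj] at h2
    rw [h2]
    exact Finset.sum_congr rfl fun j _ => (pow_succ' _ _).symm
  rw [smul_mul_assoc] at h1
  conv_rhs => rw [← h1]
  rw [smul_smul, mul_inv_cancel₀ hζ0, one_smul]

theorem commute_eigIdem : Commute g (eigIdem n ζ g) :=
  (Commute.sum_right _ _ _ fun _ _ => (((Commute.refl g).smul_right _).pow_right _)).smul_right _

theorem eigIdem_mul_of_mul_eq {x : A} {η : k} (hx : g * x = η • x) (h : η ≠ ζ) (hη : η ^ n = 1)
    (hζ : ζ ^ n = 1) : eigIdem n ζ g * x = 0 := by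
  rcases Nat.eq_zero_or_pos n with rfl | hn
  · simp [eigIdem]
  have hζ0 : ζ ≠ 0 := fun h => by simp [h, hn.ne'] at hζ
  have h1 : ∀ j : ℕ, (ζ⁻¹ • g) ^ j * x = (ζ⁻¹ * η) ^ j • x := fun j => by
    induction j with
    | zero => simp
    | succ j ih => rw [pow_succ, mul_assoc, smul_mul_assoc, hx, smul_smul, mul_smul_comm, ih,
        smul_smul, pow_succ']
  rw [eigIdem, smul_mul_assoc, Finset.sum_mul]
  simp only [h1]
  rw [← Finset.sum_smul, geom_sum_eq, mul_pow, hη, inv_pow, hζ]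
  · simp
  · exact fun h2 => h (by field_simp at h2; exact h2)

theorem eigIdem_mul_of_mul_eq_self {x : A} (hx : g * x = ζ • x) (hζ : ζ ^ n = 1) (hn : 0 < n) :
    eigIdem n ζ g * x = x := by
  have hζ0 : ζ ≠ 0 := fun h => by simp [h, hn.ne'] at hζ
  have h1 : ∀ j : ℕ, (ζ⁻¹ • g) ^ j * x = x := fun j => by
    induction j with
    | zero => simp
    | succ j ih => rw [pow_succ, mul_assoc, smul_mul_assoc, hx, smul_smul, inv_mul_cancel₀ hζ0,
        one_smul, ih]
  rw [eigIdem, smul_mul_assoc, Finset.sum_mul]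
  simp only [h1, Finset.sum_const, Finset.card_range]
  rw [← Nat.cast_smul_eq_nsmul k, smul_smul, inv_mul_cancel₀ (Nat.cast_ne_zero.2 hn.ne'), one_smul]

theorem eigIdem_mul_self (hζ : ζ ^ n = 1) (hg : g ^ n = 1) (hn : 0 < n) :
    eigIdem n ζ g * eigIdem n ζ g = eigIdem n ζ g :=
  eigIdem_mul_of_mul_eq_self (mul_eigIdem hζ hg hn) hζ hn

theorem eigIdem_mul_eigIdem {η : k} (hζ : ζ ^ n = 1) (hη : η ^ n = 1) (hg : g ^ n = 1) (hn : 0 < n)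
    (h : ζ ≠ η) : eigIdem n ζ g * eigIdem n η g = 0 :=
  eigIdem_mul_of_mul_eq (mul_eigIdem hη hg hn) h.symm hη hζ

theorem sum_eigIdem (hζ : IsPrimitiveRoot ζ n) (hn : 0 < n) :
    ∑ i ∈ Finset.range n, eigIdem n (ζ ^ i) g = 1 := by
  have hζ0 : ζ ≠ 0 := hζ.ne_zero hn.ne'
  simp only [eigIdem]
  rw [← Finset.smul_sum, Finset.sum_comm]
  have h1 : ∀ j ∈ Finset.range n, j ≠ 0 → ∑ i ∈ Finset.range n, ((ζ ^ i)⁻¹ • g) ^ j = 0 := by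
    intro j hj hj0
    have h2 : ∀ i, ((ζ ^ i)⁻¹ • g) ^ j = ((ζ ^ j)⁻¹) ^ i • g ^ j := fun i => by
      rw [smul_pow, inv_pow, inv_pow, ← pow_mul, ← pow_mul, mul_comm]
    simp only [h2]
    rw [← Finset.sum_smul, geom_sum_eq, inv_pow, ← pow_mul, mul_comm, pow_mul, hζ.pow_eq_one]
    · simp
    · intro h3
      rw [inv_eq_one] at h3
      exact hj0 (Nat.eq_zero_of_dvd_of_lt ((hζ.pow_eq_one_iff_dvd j).1 h3) (Finset.mem_range.1 hj))
  rw [Finset.sum_eq_single 0 h1 (fun h => absurd (Finset.mem_range.2 hn) h)]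
  simp only [pow_zero, Finset.sum_const, Finset.card_range]
  rw [← Nat.cast_smul_eq_nsmul k, smul_smul, inv_mul_cancel₀ (Nat.cast_ne_zero.2 hn.ne'), one_smul]

end CyclicIdempotents

section NicholsZoeller

variable {k H : Type*} [Field k] [Ring H] [HopfAlgebra k H]

/-- The canonical map `h ⊗ h' ↦ h f(h'₁) ⊗ h'₂`. -/
noncomputable def canMap (f : H →ₗ[k] H) : H ⊗[k] H →ₗ[k] H ⊗[k] H :=
  TensorProduct.lift (LinearMap.mk₂ k (fun h h' => sw k (fun a b => (h * f a) ⊗ₜ[k] b) h')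
    (fun x y z => (show IsLinearMap k fun x => sw k (fun a b => (x * f a) ⊗ₜ[k] b) z by
      fun_prop).map_add x y)
    (fun c x z => (show IsLinearMap k fun x => sw k (fun a b => (x * f a) ⊗ₜ[k] b) z by
      fun_prop).map_smul c x)
    (fun x y z => (show IsLinearMap k fun y => sw k (fun a b => (x * f a) ⊗ₜ[k] b) y by
      fun_prop).map_add y z)
    (fun c x y => (show IsLinearMap k fun y => sw k (fun a b => (x * f a) ⊗ₜ[k] b) y by
      fun_prop).map_smul c y))

theorem canMap_tmul (f : H →ₗ[k] H) (h h' : H) :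
    canMap f (h ⊗ₜ h') = sw k (fun a b => (h * f a) ⊗ₜ[k] b) h' := rfl

theorem canMap_comp (f f' : H →ₗ[k] H)
    (hff : ∀ h : H, sw k (fun a b => f a * f' b) h = counit (R := k) h • (1 : H)) :
    canMap f' ∘ₗ canMap f = LinearMap.id := by
  refine TensorProduct.ext' fun h h' => ?_
  rw [LinearMap.comp_apply, canMap_tmul, map_sw (L := canMap f')]
  simp only [canMap_tmul]
  rw [← sw_assoc (fun a c d => (h * f a * f' c) ⊗ₜ[k] d) h']
  refine (sw_congr _ fun x d => ?_).trans (sw_counit_left (fun d => h ⊗ₜ[k] d) h')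
  rw [← sw_congr (k := k) (F := fun a b => (h * (f a * f' b)) ⊗ₜ[k] d) x
    (fun a b => by rw [mul_assoc]), ← map_sw (L := fun y => (h * y) ⊗ₜ[k] d) (fun a b => f a * f' b) x, hff,
    mul_smul_comm, mul_one, smul_tmul']

/-- The canonical map as a linear automorphism. -/
noncomputable def canEquiv : (H ⊗[k] H) ≃ₗ[k] (H ⊗[k] H) :=
  LinearEquiv.ofLinearMap (canMap LinearMap.id) (canMap (antipode k))
    (canMap_comp _ _ fun h => sw_antipode_mul (fun x => x) h)
    (canMap_comp _ _ fun h => sw_mul_antipode (fun x => x) h)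

variable [FiniteDimensional k H]

theorem IsGroupLikeElem.trace_mulRight_mul_self {g : H} (hg : IsGroupLikeElem k g) :
    LinearMap.trace k H (LinearMap.mulRight k g) * LinearMap.trace k H (LinearMap.mulRight k g) =
      Module.finrank k H * LinearMap.trace k H (LinearMap.mulRight k g) := by
  have h1 : TensorProduct.map (LinearMap.mulRight k g) (LinearMap.mulRight k g) =
      canEquiv.conj (TensorProduct.map LinearMap.id (LinearMap.mulRight k g)) := by
    rw [LinearEquiv.conj_apply, LinearEquiv.eq_comp_toLinearMap_symm]
    refine TensorProduct.ext' fun h h' => ?_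
    change TensorProduct.map _ _ (canMap LinearMap.id (h ⊗ₜ h')) = canMap LinearMap.id (h ⊗ₜ (h' * g))
    rw [canMap_tmul, canMap_tmul, map_sw (L := TensorProduct.map _ _)]
    simp only [LinearMap.id_coe, id_eq]
    rw [sw_mul (fun a b => (h * a) ⊗ₜ[k] b)]
    refine sw_congr h' fun a b => ?_
    rw [sw_groupLike hg (fun c d => (h * (a * c)) ⊗ₜ[k] (b * d))]
    simp [mul_assoc]
  rw [← LinearMap.trace_tensorProduct', h1, LinearMap.trace_conj', LinearMap.trace_tensorProduct',
    LinearMap.trace_id]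

theorem finite_groupLike : Finite (GroupLike k H) :=
  (linearIndep_groupLikeVal (R := k) (A := H)).finite

variable [IsAlgClosed k] [CharZero k]

theorem IsGroupLikeElem.trace_mulRight {g : H} (hg : IsGroupLikeElem k g) (h1 : g ≠ 1) :
    LinearMap.trace k H (LinearMap.mulRight k g) = 0 := by
  have : Finite (GroupLike k H) := finite_groupLike
  obtain ⟨n, hn, hgn⟩ := (isOfFinOrder_of_finite (⟨g, hg⟩ : GroupLike k H)).exists_pow_eq_one
  replace hgn : g ^ n = 1 := congrArg GroupLike.val hgn
  by_contra hne
  have h2 := mul_right_cancel₀ hne hg.trace_mulRight_mul_self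
  have hT : (LinearMap.mulRight k g : Module.End k H) ^ n = 1 := by
    rw [LinearMap.pow_mulRight, hgn]; exact LinearMap.mulRight_one k H
  obtain ⟨b, a, hb, ha⟩ := Module.End.exists_eigenbasis hn hT
  rw [LinearMap.trace_eq_sum_of_eigenbasis b hb] at h2
  have h3 := eq_one_of_sum_eq_card hn ha (by rw [h2, Fintype.card_fin])
  have h4 : LinearMap.mulRight k g = LinearMap.id := b.ext fun i => by rw [hb, h3, one_smul]; rfl
  exact h1 (by simpa using LinearMap.congr_fun h4 1)

/-- The eigenspaces of right multiplication by a group-like element all have the same dimension. -/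
theorem IsGroupLikeElem.mul_finrank_range {g : H} (hg : IsGroupLikeElem k g) {n : ℕ} (hn : 0 < n)
    (hgn : g ^ n = 1) (hlt : ∀ j, 0 < j → j < n → g ^ j ≠ 1) {ζ : k} (hζ : ζ ^ n = 1) :
    n * Module.finrank k (LinearMap.range (LinearMap.mulRight k (eigIdem n ζ g))) =
      Module.finrank k H := by
  have hid : IsIdempotentElem (LinearMap.mulRight k (eigIdem n ζ g) : Module.End k H) := by
    refine LinearMap.ext fun x => ?_
    simp [mul_assoc, eigIdem_mul_self hζ hgn hn]
  have htr := (LinearMap.IsIdempotentElem.isProj_range _ hid).trace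
  have h2 : LinearMap.mulRight k (eigIdem n ζ g) =
      (n : k)⁻¹ • ∑ j ∈ Finset.range n, (ζ⁻¹) ^ j • LinearMap.mulRight k (g ^ j) := by
    refine LinearMap.ext fun x => ?_
    simp [eigIdem, smul_pow, Finset.mul_sum]
  have hj : ∀ j ∈ Finset.range n, j ≠ 0 → (ζ⁻¹) ^ j •
      LinearMap.trace k H (LinearMap.mulRight k (g ^ j)) = 0 := fun j hj h0 => by
    rw [(hg.pow (n := j)).trace_mulRight (hlt j (Nat.pos_of_ne_zero h0) (Finset.mem_range.1 hj)),
      smul_zero]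
  rw [h2, map_smul, map_sum] at htr
  simp only [map_smul] at htr
  rw [Finset.sum_eq_single 0 hj (fun h => absurd (Finset.mem_range.2 hn) h), pow_zero, pow_zero,
    one_smul, LinearMap.mulRight_one, LinearMap.trace_id, ← h2] at htr
  have : (n : k) ≠ 0 := Nat.cast_ne_zero.2 hn.ne'
  rw [smul_eq_mul, inv_mul_eq_iff_eq_mul₀ this] at htr
  exact_mod_cast htr.symm

theorem IsGroupLikeElem.pow_finrank_eq_one {g : H} (hg : IsGroupLikeElem k g) :
    g ^ Module.finrank k H = 1 := by
  have : Finite (GroupLike k H) := finite_groupLike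
  let γ : GroupLike k H := ⟨g, hg⟩
  have hv : ∀ j : ℕ, g ^ j = 1 ↔ γ ^ j = 1 := fun j =>
    ⟨fun h => GroupLike.val_injective h, fun h => congrArg GroupLike.val h⟩
  have h := hg.mul_finrank_range (ζ := (1 : k)) (orderOf_pos γ) ((hv _).2 (pow_orderOf_eq_one γ))
    (fun j hj hlt h => (Nat.le_of_dvd hj (orderOf_dvd_of_pow_eq_one ((hv _).1 h))).not_gt hlt)
    (one_pow _)
  rw [← h, pow_mul, (hv _).2 (pow_orderOf_eq_one γ), one_pow]

end NicholsZoeller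

open Coalgebra HopfAlgebra TensorProduct

@[fun_prop]
theorem IsLinearMap.of_algHom {R A B : Type*} [CommSemiring R] [Semiring A] [Semiring B]
    [Algebra R A] [Algebra R B] (f : A →ₐ[R] B) : IsLinearMap R (fun x => f x) :=
  f.toLinearMap.isLinear

section AntipodeSquare

variable (k H : Type*) [Field k] [Ring H] [HopfAlgebra k H]

/-- The square of the antipode, as an algebra endomorphism. -/
noncomputable def antipodeSq : H →ₐ[k] H :=
  AlgHom.ofLinearMap (antipode k ∘ₗ antipode k) (by simp) fun x y => by
    simp [antipode_mul_antidistrib]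

variable {k H}

theorem antipodeSq_apply (x : H) : antipodeSq k H x = antipode k (antipode k x) := rfl

theorem sw_antipodeSq {M : Type*} [AddCommMonoid M] [Module k M] (F : H → H → M) (x : H)
    (hl : ∀ b, IsLinearMap k (fun a => F a b) := by fun_prop)
    (hr : ∀ a, IsLinearMap k (fun b => F a b) := by fun_prop) :
    sw k F (antipodeSq k H x) = sw k (fun a b => F (antipodeSq k H a) (antipodeSq k H b)) x := by
  rw [antipodeSq_apply, sw_antipode F, sw_antipode (fun a b => F (antipode k b) (antipode k a))]
  rfl

theorem counit_antipodeSq (x : H) : counit (R := k) (antipodeSq k H x) = counit (R := k) x := by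
  simp [antipodeSq_apply]

theorem IsGroupLikeElem.antipodeSq {g : H} (hg : IsGroupLikeElem k g) : antipodeSq k H g = g :=
  hg.antipode_antipode

theorem IsGroupLikeElem.antipodeSq_pow {g : H} (hg : IsGroupLikeElem k g) (m : ℕ) :
    (_root_.antipodeSq k H ^ m) g = g := by
  induction m with
  | zero => rfl
  | succ m ih => rw [pow_succ', AlgHom.mul_apply, ih, hg.antipodeSq]

variable [FiniteDimensional k H]

theorem DualHopf.antipodeSq_fn (f : DualHopf k H) (x : H) :
    (antipodeSq k (DualHopf k H) f).fn x = f.fn (antipodeSq k H x) := rfl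

theorem DualHopf.antipodeSq_pow_fn (m : ℕ) (f : DualHopf k H) (x : H) :
    ((antipodeSq k (DualHopf k H) ^ m) f).fn x = f.fn ((antipodeSq k H ^ m) x) := by
  induction m generalizing f with
  | zero => rfl
  | succ m ih =>
    rw [pow_succ, AlgHom.mul_apply, ih, antipodeSq_fn, pow_succ', AlgHom.mul_apply]

theorem AlgHom.apply_antipodeSq (χ : H →ₐ[k] k) (x : H) : χ (antipodeSq k H x) = χ x :=
  congrArg (fun f : DualHopf k H => f.fn x) (DualHopf.isGroupLikeElem_of_algHom χ).antipodeSq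

end AntipodeSquare

section Radford

variable {k H : Type*} [Field k] [Ring H] [HopfAlgebra k H]

namespace IntegralPair

variable [FiniteDimensional k H] (I : IntegralPair k H)

theorem eq_lam_smul_Lam {x : H} (hx : ∀ h : H, h * x = counit (R := k) h • x) :
    x = I.lam x • I.Lam := by
  conv_lhs => rw [← I.sw_lam_smul x]
  simp only [hx, counit_antipode, map_smul, smul_eq_mul]
  exact (sw_congr I.Lam fun a b => by rw [mul_comm, mul_smul]).trans
    ((sw_const_smul (I.lam x) (fun a b => counit (R := k) b • a) I.Lam).trans
      (congrArg _ (sw_counit_right (fun a => a) I.Lam)))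

theorem Lam_ne_zero : I.Lam ≠ 0 := fun h => by
  simpa [h] using I.lam_antipode_Lam

theorem lam_Lam : I.lam I.Lam = 1 := by
  have h := I.eq_lam_smul_Lam I.Lam_left
  have h1 : (1 - I.lam I.Lam) • I.Lam = 0 := by rw [sub_smul, one_smul, ← h, sub_self]
  exact ((smul_eq_zero.1 h1).resolve_right I.Lam_ne_zero |> sub_eq_zero.1).symm

theorem Lam_mul (h : H) : I.Lam * h = I.lam (I.Lam * h) • I.Lam :=
  I.eq_lam_smul_Lam fun x => by rw [← mul_assoc, I.Lam_left, smul_mul_assoc]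

/-- The modular character. -/
noncomputable def modularChar : H →ₐ[k] k :=
  AlgHom.ofLinearMap (I.lam ∘ₗ LinearMap.mulLeft k I.Lam)
    (by simp [lam_Lam]) fun x y => by
      simp only [LinearMap.comp_apply, LinearMap.mulLeft_apply]
      rw [← mul_assoc, I.Lam_mul x]
      simp [I.lam_Lam]

theorem Lam_mul_eq (h : H) : I.Lam * h = I.modularChar h • I.Lam := I.Lam_mul h

/-- The modular group-like element. -/
noncomputable def modularElt : H := sw k (fun a b => I.lam b • a) (antipode k I.Lam)

theorem sw_lam_smul_eq (x : H) : sw k (fun a b => I.lam b • a) x = I.lam x • I.modularElt := by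
  refine eq_of_forall_dual (k := k) fun φ => ?_
  have h1 := LinearMap.congr_fun (I.eq_smul_lam (cv φ I.lam) fun h => ?_) x
  · rw [LinearMap.smul_apply, smul_eq_mul, mul_comm] at h1
    rw [map_sw (L := φ), map_smul, modularElt, map_sw (L := φ)]
    simp only [map_smul, smul_eq_mul]
    simp only [cv_apply] at h1
    simpa only [mul_comm (φ _)] using h1
  · calc _ = sw k (fun x c => sw k (fun a b => (φ a * I.lam b) • c) x) h := by
          refine sw_congr h fun x c => ?_
          rw [cv_apply, sw_smul_const]
      _ = sw k (fun a x => sw k (fun b c => (φ a * I.lam b) • c) x) h :=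
          sw_assoc (fun a b c => (φ a * I.lam b) • c) h
      _ = sw k (fun a x => (φ a * I.lam x) • (1 : H)) h := by
          refine sw_congr h fun a x => ?_
          simp only [mul_smul]
          rw [sw_const_smul, I.lam_right]
      _ = cv φ I.lam h • 1 := sw_smul_const _ _ _

theorem isGroupLikeElem_modularElt : IsGroupLikeElem k I.modularElt where
  counit_eq_one := by
    rw [modularElt, map_sw (L := counit (R := k))]
    simp only [map_smul, smul_eq_mul, mul_comm (I.lam _)]
    rw [show sw k (fun a b => counit (R := k) a * I.lam b) (antipode k I.Lam) = _ from
      sw_counit_left (fun b => I.lam b) _, I.lam_antipode_Lam]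
  comul_eq_tmul_self := by
    have h1 : I.modularElt = sw k (fun a b => I.lam b • a) (antipode k I.Lam) := rfl
    rw [h1, map_sw (L := comul (R := k))]
    calc _ = sw k (fun x c => sw k (fun a b => I.lam c • (a ⊗ₜ[k] b)) x) (antipode k I.Lam) := by
          refine sw_congr _ fun x c => ?_
          rw [map_smul, sw_const_smul, sw_tmul]
      _ = sw k (fun a x => sw k (fun b c => I.lam c • (a ⊗ₜ[k] b)) x) (antipode k I.Lam) :=
          sw_assoc (fun a b c => I.lam c • (a ⊗ₜ[k] b)) _
      _ = sw k (fun a x => a ⊗ₜ[k] (I.lam x • I.modularElt)) (antipode k I.Lam) := by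
          refine sw_congr _ fun a x => ?_
          rw [← I.sw_lam_smul_eq, map_sw (L := fun z => a ⊗ₜ[k] z)]
          simp only [tmul_smul]
      _ = _ := by
          rw [← h1]
          refine Eq.trans ?_ (congrArg (fun z => z ⊗ₜ[k] I.modularElt) h1).symm
          refine Eq.trans ?_ (map_sw (L := fun z => z ⊗ₜ[k] I.modularElt) _ _).symm
          simp only [tmul_smul, smul_tmul']

theorem lam_mul_eq (y a : H) : I.lam (y * a) =
    sw k (fun u v => I.modularChar u • I.lam (antipodeSq k H v * y)) a := by
  have h1 : sw k (fun l m => I.lam (y * (l * a)) • antipode k m) I.Lam = sw k (fun u v =>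
      I.modularChar u •
        sw k (fun l m => I.lam (y * l) • antipode k (m * antipode k v)) I.Lam) a := by
    symm
    calc _ = sw k (fun u v => sw k (fun l m => sw k (fun c d =>
              I.lam (y * (l * c)) • antipode k (m * d * antipode k v)) u) I.Lam) a := by
          refine sw_congr a fun u v => ?_
          rw [← sw_mul (fun l m => I.lam (y * l) • antipode k (m * antipode k v)) I.Lam u,
            I.Lam_mul_eq]
          exact ((isLinearMap_sw (F := fun l m => I.lam (y * l) • antipode k (m * antipode k v))
            (by fun_prop) (by fun_prop) IsLinearMap.fun_id).map_smul _ _).symm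
      _ = sw k (fun l m => sw k (fun u v => sw k (fun c d =>
              I.lam (y * (l * c)) • antipode k (m * d * antipode k v)) u) a) I.Lam := sw_comm _ _ _
      _ = _ := by
          refine sw_congr _ fun l m => ?_
          refine (sw_assoc (fun c d v =>
              I.lam (y * (l * c)) • antipode k (m * d * antipode k v)) a).trans ?_
          refine (sw_congr a fun c u => ?_).trans
            (sw_counit_right (fun c => I.lam (y * (l * c)) • antipode k m) a)
          simp only [mul_assoc m]
          rw [sw_mul_antipode (fun z => I.lam (y * (l * c)) • antipode k (m * z)), mul_one]
  calc I.lam (y * a) = I.lam (sw k (fun l m => I.lam (y * (l * a)) • antipode k m) I.Lam) := by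
        rw [map_sw (L := I.lam)]
        conv_lhs => rw [← one_mul a, ← I.sw_lam_smul 1, ← sw_mul_const, ← sw_const_mul,
          map_sw (L := I.lam)]
        refine sw_congr _ fun l m => ?_
        simp [mul_comm]
    _ = _ := by
        rw [h1,
          map_sw (L := I.lam)]
        refine sw_congr _ fun u v => ?_
        simp only [antipode_mul_antidistrib, map_smul, ← mul_smul_comm, sw_const_mul]
        rw [I.sw_lam_smul_antipode, mul_smul_comm, map_smul]
        rfl

theorem lam_antipode_eq : ∃ c : k, c ≠ 0 ∧ ∀ x,
    I.lam (antipode k x) = c * I.lam (I.modularElt * x) := by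
  have hg := I.isGroupLikeElem_modularElt
  set g := I.modularElt with hgdef
  have h1 : ∀ y, sw k (fun a b => I.lam (antipode k a) • b) y =
      I.lam (antipode k y) • antipode k g := fun y => by
    apply antipode_injective (k := k)
    rw [map_sw (L := antipode k), map_smul, hg.antipode_antipode, hgdef, ← I.sw_lam_smul_eq,
      sw_antipode (fun a b => I.lam b • a)]
    simp only [map_smul]
  let δ : H →ₗ[k] k := I.lam ∘ₗ antipode k ∘ₗ LinearMap.mulLeft k (antipode k g)
  have hδ : ∀ h, sw k (fun a b => δ a • b) h = δ h • 1 := fun h => by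
    have h2 := h1 (antipode k g * h)
    rw [sw_mul (fun a b => I.lam (antipode k a) • b),
      sw_groupLike hg.antipode (fun a b => sw k (fun c d => I.lam (antipode k (a * c)) • (b * d)) h)]
      at h2
    have h3 := congrArg (fun z => g * z) h2
    simp only [← sw_const_mul, mul_smul_comm, ← mul_assoc, hg.mul_antipode_cancel, one_mul] at h3
    exact h3
  refine ⟨δ (antipode k I.Lam), fun h0 => ?_, fun x => ?_⟩
  · have h4 := I.eq_smul_lam δ hδ
    rw [h0, zero_smul] at h4
    have h5 := LinearMap.congr_fun h4 (g * I.Lam)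
    simp only [δ, LinearMap.comp_apply, LinearMap.mulLeft_apply, ← mul_assoc,
      hg.antipode_mul_cancel, one_mul, I.lam_antipode_Lam, LinearMap.zero_apply] at h5
    exact one_ne_zero h5
  · have h4 := LinearMap.congr_fun (I.eq_smul_lam δ hδ) (g * x)
    rw [LinearMap.smul_apply, smul_eq_mul] at h4
    rw [← h4]
    simp only [δ, LinearMap.comp_apply, LinearMap.mulLeft_apply, ← mul_assoc,
      hg.antipode_mul_cancel, one_mul]

/-- Radford's formula for the fourth power of the antipode. -/
theorem modularElt_mul (a : H) : I.modularElt * a =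
    (antipodeSq k H ^ 2) (hitL I.modularChar.toLinearMap
      (hitR (I.modularChar.toLinearMap ∘ₗ antipode k) a)) * I.modularElt := by
  set g := I.modularElt with hgdef
  refine sub_eq_zero.1 (I.nondeg _ fun x => ?_)
  rw [sub_mul, map_sub, sub_eq_zero]
  obtain ⟨c, hc, hμ⟩ := I.lam_antipode_eq
  have h1 : I.lam (g * (a * x)) =
      sw k (fun u v => I.modularChar (antipode k v) • I.lam (g * x * antipodeSq k H u)) a := by
    refine mul_left_cancel₀ hc ?_
    rw [hgdef, ← hμ, antipode_mul_antidistrib, I.lam_mul_eq,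
      sw_antipode (fun u v => I.modularChar u • I.lam (antipodeSq k H v * antipode k x)),
      ← sw_const_mul]
    refine sw_congr a fun u v => ?_
    rw [mul_smul_comm, mul_assoc I.modularElt, ← hμ, antipode_mul_antidistrib]
    rfl
  rw [mul_assoc, h1, hitR_apply, map_sw (L := fun z => I.lam ((antipodeSq k H ^ 2)
    (hitL I.modularChar.toLinearMap z) * g * x))]
  refine sw_congr a fun u v => ?_
  rw [I.lam_mul_eq, sw_antipodeSq (fun s t => I.modularChar s • I.lam (antipodeSq k H t * (g * x)))]
  simp only [map_smul, smul_mul_assoc, LinearMap.comp_apply, AlgHom.toLinearMap_apply]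
  congr 1
  rw [hitL_apply, map_sw (L := fun z => I.lam ((antipodeSq k H ^ 2) z * g * x))]
  refine sw_congr u fun s t => ?_
  simp only [AlgHom.apply_antipodeSq, map_smul, smul_mul_assoc, AlgHom.toLinearMap_apply, mul_assoc]
  rfl

end IntegralPair

end Radford

open Coalgebra HopfAlgebra TensorProduct

section RadfordDual

variable {k H : Type*} [Field k] [Ring H] [HopfAlgebra k H] [FiniteDimensional k H]

/-- Radford's formula for the fourth power of the antipode, iterated and in dual form. -/
theorem exists_radford : ∃ (g : H) (a : DualHopf k H), IsGroupLikeElem k g ∧ IsGroupLikeElem k a ∧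
    ∀ (m : ℕ) (f : DualHopf k H) (h : H),
      (a ^ m * (antipodeSq k (DualHopf k H) ^ (2 * m)) f * antipode k a ^ m).fn h =
        f.fn (g ^ m * h * antipode k g ^ m) := by
  obtain ⟨I⟩ := nonempty_integralPair (k := k) (H := H)
  have hg := I.isGroupLikeElem_modularElt
  have ha := DualHopf.isGroupLikeElem_of_algHom I.modularChar
  set g := I.modularElt with hgdef
  set a : DualHopf k H := DualHopf.mk I.modularChar.toLinearMap with hadef
  have h1 : ∀ (f : DualHopf k H) (h : H),
      (a * (antipodeSq k (DualHopf k H) ^ 2) f * antipode k a).fn h =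
        f.fn (g * h * antipode k g) := fun f h => by
    rw [hgdef, I.modularElt_mul, mul_assoc _ I.modularElt, ← hgdef, hg.mul_antipode_cancel, mul_one,
      ← DualHopf.antipodeSq_pow_fn, DualHopf.mul_eq, DualHopf.mul_eq]
    simp only [DualHopf.fn_mk]
    rw [hitR_apply, map_sw (L := fun z => ((antipodeSq k (DualHopf k H) ^ 2) f).fn
      (hitL I.modularChar.toLinearMap z)), cv_apply]
    refine sw_congr h fun u v => ?_
    rw [map_smul, map_smul, hitL_apply, map_sw (L := fun z =>
      ((antipodeSq k (DualHopf k H) ^ 2) f).fn z), cv_apply, smul_eq_mul, mul_comm]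
    simp only [map_smul, smul_eq_mul]
    rfl
  refine ⟨g, a, hg, ha, fun m => ?_⟩
  induction m with
  | zero => intro f h; simp
  | succ m ih =>
    intro f h
    have h2 : f.fn (g ^ (m + 1) * h * antipode k g ^ (m + 1)) =
        f.fn (g ^ m * (g * h * antipode k g) * antipode k g ^ m) := by
      simp only [pow_succ, pow_succ' (antipode k g), mul_assoc]
    rw [h2, ← ih, ← h1]
    congr 2
    rw [map_mul, map_mul, map_pow, map_pow, ha.antipodeSq_pow, ha.antipode.antipodeSq_pow,
      ← AlgHom.mul_apply, ← pow_add, pow_succ', pow_succ (antipode k a),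
      show 2 + 2 * m = 2 * (m + 1) by ring]
    simp only [mul_assoc]

end RadfordDual

open Coalgebra HopfAlgebra TensorProduct

section ScalarForm

variable {k C N M : Type*} [Field k] [AddCommGroup C] [Module k C] [Coalgebra k C]
  [FiniteDimensional k C] [AddCommGroup N] [Module k N] [AddCommGroup M] [Module k M]

/-- An identity between tensors, tested by functionals on the second factor. -/
theorem sw_eq_sum_of_forall_dual {ι : Type*} [Fintype ι] (L : C →ₗ[k] N) (x : C) (u : ι → N)
    (v : ι → C) (h : ∀ φ : C →ₗ[k] k, sw k (fun a b => φ b • L a) x = ∑ i, φ (v i) • u i)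
    (G : N → C → M) (hl : ∀ b, IsLinearMap k (fun a => G a b) := by fun_prop)
    (hr : ∀ a, IsLinearMap k (fun b => G a b) := by fun_prop) :
    sw k (fun a b => G (L a) b) x = ∑ i, G (u i) (v i) := by
  let B := Module.finBasis k C
  have hG : ∀ n b, G n b = ∑ j, B.coord j b • G n (B j) := fun n b => by
    conv_lhs => rw [← B.sum_repr b]
    exact (map_sum (IsLinearMap.mk' _ (hr n)) _ _).trans
      (Finset.sum_congr rfl fun j _ => (hr n).map_smul _ _)
  have hl' : ∀ b, IsLinearMap k (fun a => G (L a) b) := fun b => (hl b).fun_comp L.isLinear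
  calc _ = ∑ j, G (sw k (fun a b => B.coord j b • L a) x) (B j) := by
        rw [sw_congr x (fun a b => hG (L a) b), sw_sum]
        refine Finset.sum_congr rfl fun j _ => ?_
        rw [map_sw (L := fun z => G z (B j)) _ _ (hl _)]
        exact sw_congr x fun a b => ((hl _).map_smul _ _).symm
    _ = _ := by
        have h1 : ∀ j, G (∑ i, B.coord j (v i) • u i) (B j) =
            ∑ i, B.coord j (v i) • G (u i) (B j) := fun j =>
          (map_sum (IsLinearMap.mk' _ (hl (B j))) _ _).trans
            (Finset.sum_congr rfl fun i _ => (hl (B j)).map_smul _ _)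
        refine (Finset.sum_congr rfl fun j _ => ?_).trans
          ((Finset.sum_congr rfl fun j _ => h1 j).trans ?_)
        · exact congrArg (fun z => G z (B j)) (h (B.coord j))
        · rw [Finset.sum_comm]
          exact Finset.sum_congr rfl fun i _ => (hG (u i) (v i)).symm

end ScalarForm

section CyclicSubgroup

variable {k H : Type*} [Field k] [CharZero k] [Ring H] [HopfAlgebra k H]

theorem IsGroupLikeElem.antipode_pow_eq {g : H} (hg : IsGroupLikeElem k g) {p : ℕ}
    (hgp : g ^ p = 1) {i : ℕ} (hi : i ≤ p) : antipode k (g ^ i) = g ^ (p - i) := by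
  have h1 : g ^ i * g ^ (p - i) = 1 := by rw [← pow_add, Nat.add_sub_cancel' hi, hgp]
  calc antipode k (g ^ i) = antipode k (g ^ i) * (g ^ i * g ^ (p - i)) := by rw [h1, mul_one]
    _ = _ := by rw [← mul_assoc, (hg.pow (n := i)).antipode_mul_cancel, one_mul]

theorem IsGroupLikeElem.apply_antipode_pow {g : H} (hg : IsGroupLikeElem k g) {p : ℕ}
    (hgp : g ^ p = 1) {f : H →ₗ[k] k} (hf : ∀ i, 0 < i → i < p → f (g ^ i) = 0) {i : ℕ}
    (hi : i ∈ Finset.range p) (h0 : i ≠ 0) : f (antipode k (g ^ i)) = 0 := by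
  have := Finset.mem_range.1 hi
  rw [hg.antipode_pow_eq hgp this.le]
  exact hf _ (by omega) (by omega)

theorem eigIdem_one (p : ℕ) (g : H) :
    eigIdem p (1 : k) g = (p : k)⁻¹ • ∑ i ∈ Finset.range p, g ^ i := by
  simp [eigIdem]

variable [FiniteDimensional k H]

/-- Elements coinvariant with respect to the quotient by a cyclic group of group-like elements
lie in the span of this group. -/
theorem IsGroupLikeElem.eq_sum_of_coinvariant {g : H} (hg : IsGroupLikeElem k g) {p : ℕ}
    (hp : 0 < p) (hgp : g ^ p = 1) {f : H →ₗ[k] k} (hf1 : f 1 = 1)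
    (hf : ∀ i, 0 < i → i < p → f (g ^ i) = 0) {y : H}
    (hy : ∀ ψ : H →ₗ[k] k, sw k (fun a b => ψ b • (a * eigIdem p (1 : k) g)) y =
      ψ y • eigIdem p (1 : k) g) :
    y = ∑ i ∈ Finset.range p, f (antipode k (g ^ i) * y) • g ^ i := by
  have hp0 : (p : k) ≠ 0 := Nat.cast_ne_zero.2 hp.ne'
  have h1 := sw_eq_sum_of_forall_dual (ι := Unit) (LinearMap.mulRight k (eigIdem p (1 : k) g)) y
    (fun _ => eigIdem p (1 : k) g) (fun _ => y) (by simpa using hy)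
    (fun u v => sw k (fun c d => f (antipode k d * v) • c) u)
    (fun b => isLinearMap_sw (by fun_prop) (by fun_prop) IsLinearMap.fun_id) (by fun_prop)
  have hlin : ∀ v, IsLinearMap k (fun u => sw k (fun c d => f (antipode k d * v) • c) u) :=
    fun v => isLinearMap_sw (by fun_prop) (by fun_prop) IsLinearMap.fun_id
  have he : ∀ a v, sw k (fun c d => f (antipode k d * v) • c) (a * eigIdem p (1 : k) g) =
      (p : k)⁻¹ • ∑ i ∈ Finset.range p,
        sw k (fun c d => f (antipode k (d * g ^ i) * v) • (c * g ^ i)) a := fun a v => by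
    rw [eigIdem_one, mul_smul_comm, (hlin v).map_smul, Finset.mul_sum]
    refine congrArg _ ((map_sum (IsLinearMap.mk' _ (hlin v)) _ _).trans ?_)
    refine Finset.sum_congr rfl fun i _ => ?_
    refine (sw_mul (fun c d => f (antipode k d * v) • c) a (g ^ i)).trans (sw_congr a fun c d => ?_)
    rw [sw_groupLike (hg.pow (n := i)) (fun c' d' => f (antipode k (d * d') * v) • (c * c'))]
  have he1 : ∀ v, sw k (fun c d => f (antipode k d * v) • c) (eigIdem p (1 : k) g) =
      (p : k)⁻¹ • ∑ i ∈ Finset.range p, f (antipode k (g ^ i) * v) • g ^ i := fun v => by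
    rw [← one_mul (eigIdem p (1 : k) g), he]
    refine congrArg _ (Finset.sum_congr rfl fun i _ => ?_)
    rw [sw_one (fun c d => f (antipode k (d * g ^ i) * v) • (c * g ^ i)), one_mul]
  simp only [LinearMap.mulRight_apply, he, Finset.univ_unique, Finset.sum_const,
    Finset.card_singleton, one_smul, he1] at h1
  rw [sw_const_smul, sw_sum] at h1
  have h2 : ∀ i, sw k (fun a b => sw k (fun c d =>
      f (antipode k (d * g ^ i) * b) • (c * g ^ i)) a) y = f (antipode k (g ^ i)) • (y * g ^ i) := by
    intro i
    refine (sw_assoc (fun c d b => f (antipode k (d * g ^ i) * b) • (c * g ^ i)) y).trans ?_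
    refine (sw_congr y fun c x => ?_).trans
      (sw_counit_right (fun c => f (antipode k (g ^ i)) • (c * g ^ i)) y)
    simp only [antipode_mul_antidistrib, mul_assoc (antipode k (g ^ i))]
    rw [sw_antipode_mul (fun z => f (antipode k (g ^ i) * z) • (c * g ^ i)), mul_one]
  simp only [h2] at h1
  rw [Finset.sum_eq_single 0 (fun i hi h0 => by
    rw [hg.apply_antipode_pow hgp hf hi h0, zero_smul])
    (fun h => absurd (Finset.mem_range.2 hp) h)] at h1
  simpa [hf1, hp0] using h1

end CyclicSubgroup

open Coalgebra HopfAlgebra TensorProduct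

section SkewPrimitive

variable {k H : Type*} [Field k] [CharZero k] [Ring H] [HopfAlgebra k H] [FiniteDimensional k H]

theorem IsGroupLikeElem.exists_functional {g : H} (hg : IsGroupLikeElem k g) {p : ℕ}
    (hlt : ∀ i, 0 < i → i < p → g ^ i ≠ 1) :
    ∃ f : H →ₗ[k] k, f 1 = 1 ∧ ∀ i, 0 < i → i < p → f (g ^ i) = 0 := by
  have h1 : (GroupLike.val (1 : GroupLike k H)) ∉
      Submodule.span k (GroupLike.val '' {x : GroupLike k H | x ≠ 1}) :=
    (linearIndep_groupLikeVal (R := k) (A := H)).notMem_span_image (by simp)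
  obtain ⟨f, hf, hle⟩ := Submodule.exists_le_ker_of_notMem h1
  refine ⟨(f 1)⁻¹ • f, inv_mul_cancel₀ hf, fun i hi hip => ?_⟩
  have h2 : f (g ^ i) = 0 := hle (Submodule.subset_span
    ⟨⟨g ^ i, hg.pow⟩, fun h => hlt i hi hip (congrArg GroupLike.val h), rfl⟩)
  simp [h2]

variable {g : H} {p : ℕ}

theorem IsGroupLikeElem.sw_mul_eigIdem (hg : IsGroupLikeElem k g) (hp : 0 < p) (hgp : g ^ p = 1)
    {M : Type*} [AddCommGroup M] [Module k M] (F : H → H → M) (x : H)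
    (hl : ∀ b, IsLinearMap k (fun a => F a b) := by fun_prop)
    (hr : ∀ a, IsLinearMap k (fun b => F a b) := by fun_prop) :
    sw k (fun a b => F (a * eigIdem p (1 : k) g) b) (x * eigIdem p (1 : k) g) =
      sw k (fun a b => F (a * eigIdem p (1 : k) g) (b * eigIdem p (1 : k) g)) x := by
  have hp0 : (p : k) ≠ 0 := Nat.cast_ne_zero.2 hp.ne'
  have hge : ∀ i, g ^ i * eigIdem p (1 : k) g = eigIdem p (1 : k) g := fun i => by
    induction i with
    | zero => simp
    | succ i ih => rw [pow_succ, mul_assoc, mul_eigIdem (one_pow _) hgp hp, one_smul, ih]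
  have hl' : ∀ b, IsLinearMap k (fun a => F (a * eigIdem p (1 : k) g) b) :=
    fun b => (hl b).fun_comp (by fun_prop)
  have hlin : IsLinearMap k fun z => sw k (fun a b => F (a * eigIdem p (1 : k) g) b) z :=
    isLinearMap_sw hl' (fun _ => hr _) IsLinearMap.fun_id
  have h1 : ∀ i, sw k (fun a b => F (a * eigIdem p (1 : k) g) b) (x * g ^ i) =
      sw k (fun a b => F (a * eigIdem p (1 : k) g) (b * g ^ i)) x := fun i => by
    rw [sw_mul (fun a b => F (a * eigIdem p (1 : k) g) b) x (g ^ i) hl' (fun _ => hr _)]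
    refine sw_congr x fun a b => ?_
    rw [sw_groupLike (hg.pow (n := i)) (fun c d => F (a * c * eigIdem p (1 : k) g) (b * d))
      (fun d => (hl' _).fun_comp (by fun_prop)) (fun c => (hr _).fun_comp (by fun_prop)),
      mul_assoc, hge]
  conv_lhs => rw [eigIdem_one p g, mul_smul_comm, Finset.mul_sum]
  rw [← eigIdem_one p g, hlin.map_smul]
  refine (congrArg _ (map_sum hlin.mk' _ _)).trans ?_
  simp only [IsLinearMap.mk'_apply, h1]
  rw [← sw_sum, ← sw_const_smul]
  refine sw_congr x fun a b => ?_
  refine (congrArg _ (map_sum (hr (a * eigIdem p (1 : k) g)).mk' _ _).symm).trans ?_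
  rw [← map_smul, ← Finset.mul_sum, ← mul_smul_comm, ← eigIdem_one]
  rfl

/-- A skew primitive element modulo the right coset of a cyclic group of group-like elements
is fixed by a power of the square of the antipode. -/
theorem antipodeSq_pow_eq_self_of_skewPrimitive (hg : IsGroupLikeElem k g) (hp : 0 < p)
    (hgp : g ^ p = 1) (hlt : ∀ i, 0 < i → i < p → g ^ i ≠ 1) {X : H}
    (hXe : X * eigIdem p (1 : k) g = X)
    (hX : ∀ φ : H →ₗ[k] k, sw k (fun a b => φ (b * eigIdem p (1 : k) g) •
      (a * eigIdem p (1 : k) g)) X = φ X • eigIdem p (1 : k) g + φ (eigIdem p (1 : k) g) • X) :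
    (antipodeSq k H ^ p) X = X := by
  obtain ⟨f, hf1, hf⟩ := hg.exists_functional hlt
  have hp0 : (p : k) ≠ 0 := Nat.cast_ne_zero.2 hp.ne'
  set e := eigIdem p (1 : k) g with he
  let Θ : H → H := fun z => (p : k) • sw k (fun u v => f (antipode k v) • u) z
  have hΘ : IsLinearMap k Θ :=
    (isLinearMap_sw (by fun_prop) (by fun_prop) IsLinearMap.fun_id).fun_const_smul _
  have hΘe : Θ e = 1 := by
    have h1 : ∀ i, Θ (g ^ i) = (p : k) • f (antipode k (g ^ i)) • g ^ i := fun i =>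
      congrArg _ (sw_groupLike (hg.pow (n := i)) (fun u v => f (antipode k v) • u))
    have h2 : Θ (∑ i ∈ Finset.range p, g ^ i) = ∑ i ∈ Finset.range p, Θ (g ^ i) :=
      map_sum hΘ.mk' _ _
    rw [he, eigIdem_one, hΘ.map_smul, h2, Finset.sum_eq_single 0 (fun i hi h0 => by
      rw [h1, hg.apply_antipode_pow hgp hf hi h0, zero_smul, smul_zero])
      (fun h => absurd (Finset.mem_range.2 hp) h), h1]
    simp [hf1, hp0]
  obtain ⟨h, hh⟩ : ∃ h : H, ∀ φ : H →ₗ[k] k, sw k (fun a b => φ b • (a * e)) h =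
      φ h • e + φ 1 • X := by
    refine ⟨Θ X, fun φ => ?_⟩
    have hlin : IsLinearMap k fun z => sw k (fun a b => φ b • (a * e)) z :=
      isLinearMap_sw (by fun_prop) (by fun_prop) IsLinearMap.fun_id
    have hφΘ : IsLinearMap k fun z => φ (Θ z) := φ.isLinear.fun_comp hΘ
    calc _ = sw k (fun u v => φ (Θ v) • (u * e)) X := by
          simp only [Θ]
          rw [hlin.map_smul, map_sw (L := fun z => sw k (fun a b => φ b • (a * e)) z) _ X hlin,
            ← sw_const_smul]
          simp only [hlin.map_smul, map_smul, smul_assoc]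
          rw [sw_const_smul, sw_const_smul]
          refine congrArg _ ?_
          simp only [← sw_const_smul]
          refine (sw_assoc (fun a b c => f (antipode k c) • φ b • (a * e)) X).trans ?_
          refine sw_congr X fun a x => ?_
          rw [map_sw (L := fun z => φ z • (a * e))]
          simp [smul_smul]
      _ = sw k (fun u v => φ (Θ (v * e)) • (u * e)) X := by
          conv_lhs => rw [← hXe]
          exact hg.sw_mul_eigIdem hp hgp (fun u v => φ (Θ v) • u) X
      _ = _ := by
          have := hX hφΘ.mk'
          simp only [IsLinearMap.mk'_apply, hΘe] at this
          exact this
  let fi : ℕ → H →ₗ[k] k := fun i => f ∘ₗ LinearMap.mulLeft k (antipode k (g ^ i))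
  have hfi : ∀ i x, fi i x = f (antipode k (g ^ i) * x) := fun _ _ => rfl
  have hfij : ∀ i ∈ Finset.range p, ∀ j ∈ Finset.range p, fi i (g ^ j) = if i = j then 1 else 0 := by
    intro i hi j hj
    have hi := Finset.mem_range.1 hi
    have hj := Finset.mem_range.1 hj
    rw [hfi, hg.antipode_pow_eq hgp hi.le, ← pow_add]
    rcases lt_trichotomy i j with h | rfl | h
    · rw [if_neg h.ne, show p - i + j = p + (j - i) by omega, pow_add, hgp, one_mul]
      exact hf _ (by omega) (by omega)
    · rw [if_pos rfl, show p - i + i = p by omega, hgp, hf1]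
    · rw [if_neg h.ne']
      exact hf _ (by omega) (by omega)
  let α : ℕ → H := fun i => sw k (fun a b => fi i a • b) h - fi i h • 1
  have hlinφ : ∀ φ : H →ₗ[k] k, IsLinearMap k fun z => sw k (fun a b => φ b • a) z := fun φ =>
    isLinearMap_sw (by fun_prop) (by fun_prop) IsLinearMap.fun_id
  have hφ : ∀ φ : H →ₗ[k] k, sw k (fun a b => φ b • a) h =
      φ 1 • h + ∑ i ∈ Finset.range p, φ (α i) • g ^ i := by
    intro φ
    have h1 := hg.eq_sum_of_coinvariant hp hgp hf1 hf
      (y := sw k (fun a b => φ b • a) h - φ 1 • h) fun ψ => by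
        have hlin : IsLinearMap k fun z => sw k (fun a b => ψ b • (a * e)) z :=
          isLinearMap_sw (by fun_prop) (by fun_prop) IsLinearMap.fun_id
        let φ' : H →ₗ[k] k := ψ ∘ₗ (hlinφ φ).mk'
        have h2 : sw k (fun a b => ψ b • (a * e)) (sw k (fun a b => φ b • a) h) =
            sw k (fun a x => φ' x • (a * e)) h := by
          rw [map_sw (L := fun z => sw k (fun a b => ψ b • (a * e)) z) _ h hlin]
          simp only [hlin.map_smul, ← sw_const_smul]
          refine (sw_assoc (fun a b c => φ c • ψ b • (a * e)) h).trans ?_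
          refine sw_congr h fun a x => ?_
          simp only [φ', LinearMap.comp_apply, IsLinearMap.mk'_apply]
          rw [map_sw (L := fun z => ψ z • (a * e))]
          simp [smul_smul]
        have h3 : φ' 1 = φ 1 * ψ 1 := by
          simp only [φ', LinearMap.comp_apply, IsLinearMap.mk'_apply]
          rw [sw_one (fun a b => φ b • a), map_smul, smul_eq_mul]
        rw [hlin.map_sub, hlin.map_smul, h2, hh, hh, h3]
        simp only [φ', LinearMap.comp_apply, IsLinearMap.mk'_apply, map_sub, map_smul, smul_eq_mul,
          sub_smul, smul_add, smul_smul]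
        abel
    rw [sub_eq_iff_eq_add'] at h1
    refine h1.trans (congrArg _ (Finset.sum_congr rfl fun i _ => congrArg (· • g ^ i) ?_))
    rw [← hfi]
    simp only [α, map_sub, map_smul, smul_eq_mul]
    rw [map_sw (L := fun z => fi i z), map_sw (L := fun z => φ z), mul_comm (φ 1)]
    simp only [map_smul, smul_eq_mul, mul_comm]
  have hsw : ∀ (G : H → H → H)
      (hl : ∀ b, IsLinearMap k (fun a => G a b))
      (hr : ∀ a, IsLinearMap k (fun b => G a b)),
      sw k G h = G h 1 + ∑ i ∈ Finset.range p, G (g ^ i) (α i) := by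
    intro G hl hr
    have := sw_eq_sum_of_forall_dual (ι := Option (Fin p)) LinearMap.id h
      (fun i => i.elim h fun i => g ^ (i : ℕ)) (fun i => i.elim 1 fun i => α i)
      (fun φ => by simpa [Fintype.sum_option, Finset.sum_range] using hφ φ) G hl hr
    simpa [Fintype.sum_option, Finset.sum_range] using this
  have hα : ∀ i ∈ Finset.range p, ∀ (G : H → H → H)
      (hl : ∀ b, IsLinearMap k (fun a => G a b))
      (hr : ∀ a, IsLinearMap k (fun b => G a b)),
      sw k G (α i) = G (α i) 1 + G (g ^ i) (α i) := by
    intro i hi G hl hr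
    have hlin : IsLinearMap k fun z => sw k G z := isLinearMap_sw hl hr IsLinearMap.fun_id
    have hl1 : ∀ c x, IsLinearMap k fun b => fi i c • G b x := fun c x => (hl x).fun_const_smul _
    have hK : ∀ c, IsLinearMap k fun x => sw k (fun a b => fi i a • G b c) x := fun c =>
      isLinearMap_sw (by fun_prop) (fun _ => hl1 _ _) IsLinearMap.fun_id
    have h1 : sw k G (sw k (fun a b => fi i a • b) h) =
        sw k (fun x c => sw k (fun a b => fi i a • G b c) x) h := by
      rw [map_sw (L := fun z => sw k G z) _ h hlin]
      simp only [hlin.map_smul, ← sw_const_smul]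
      exact (sw_assoc (fun a b c => fi i a • G b c) h (by fun_prop) (fun _ _ => hl1 _ _)
        fun _ _ => (hr _).fun_const_smul _).symm
    have h2 : sw k (fun a b => fi i a • G b 1) h = G (sw k (fun a b => fi i a • b) h) 1 := by
      rw [map_sw (L := fun z => G z 1) _ h (hl 1)]
      simp only [(hl 1).map_smul]
    have h3 : ∀ j ∈ Finset.range p, sw k (fun a b => fi i a • G b (α j)) (g ^ j) =
        if i = j then G (g ^ i) (α i) else 0 := fun j hj => by
      rw [sw_groupLike (hg.pow (n := j)) (fun a b => fi i a • G b (α j)) (by fun_prop)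
        (fun _ => hl1 _ _), hfij i hi j hj]
      split_ifs with hij
      · rw [hij, one_smul]
      · rw [zero_smul]
    have h4 : sw k G (α i) = sw k G (sw k (fun a b => fi i a • b) h) - fi i h • G 1 1 := by
      simp only [α]
      rw [hlin.map_sub, hlin.map_smul, sw_one G hl hr]
    have h5 : G (α i) 1 = G (sw k (fun a b => fi i a • b) h) 1 - fi i h • G 1 1 := by
      simp only [α]
      rw [(hl 1).map_sub, (hl 1).map_smul]
    rw [h4, h1, hsw _ hK (fun _ => isLinearMap_sw_fun _ fun _ _ => (hr _).fun_const_smul _), h2,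
      Finset.sum_congr rfl h3, Finset.sum_ite_eq, if_pos hi, h5]
    abel
  have hεα : ∀ i ∈ Finset.range p, counit (R := k) (α i) = 0 := by
    intro i hi
    have h1 := sw_counit_right (k := k) (fun z => z) (α i)
    rw [hα i hi _ (by fun_prop) (by fun_prop)] at h1
    have h2 := congrArg (counit (R := k)) h1
    simpa [hg.pow.counit_eq_one] using h2
  have hθα : ∀ i ∈ Finset.range p, (antipodeSq k H ^ p) (α i) = α i := by
    intro i hi
    have h1 := sw_antipode_mul (k := k) (fun z => z) (α i)
    rw [hα i hi _ (by fun_prop) (by fun_prop), hεα i hi, zero_smul, mul_one] at h1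
    have h2 : antipode k (α i) = -(antipode k (g ^ i) * α i) := eq_neg_of_add_eq_zero_left h1
    have h3 : antipodeSq k H (α i) = antipode k (g ^ i) * α i * g ^ i := by
      rw [antipodeSq_apply, h2, map_neg, antipode_mul_antidistrib, h2,
        (hg.pow (n := i)).antipode_antipode, neg_mul, neg_neg]
    have h4 : ∀ m, (antipodeSq k H ^ m) (α i) = antipode k (g ^ i) ^ m * α i * (g ^ i) ^ m := by
      intro m
      induction m with
      | zero => simp
      | succ m ih =>
        rw [pow_succ, AlgHom.mul_apply, h3, map_mul, map_mul, ih, hg.pow.antipodeSq_pow,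
          hg.pow.antipode.antipodeSq_pow, pow_succ', pow_succ (g ^ i)]
        simp only [mul_assoc]
    rw [h4, ← pow_mul, mul_comm i p, pow_mul, hgp, one_pow, mul_one,
      hg.antipode_pow_eq hgp (Finset.mem_range.1 hi).le, ← pow_mul, mul_comm, pow_mul, hgp,
      one_pow, one_mul]
  have hhα : h = counit (R := k) h • 1 + ∑ i ∈ Finset.range p, α i := by
    have h1 := sw_counit_left (k := k) (fun z => z) h
    rw [hsw _ (by fun_prop) (by fun_prop)] at h1
    simpa [hg.pow.counit_eq_one] using h1.symm
  have hXα : X = ∑ i ∈ Finset.range p, α i * e := by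
    have h1 := hh (counit (R := k))
    rw [sw_counit_right (fun z => z * e)] at h1
    have h2 := congrArg (· * e) hhα
    simp only [add_mul, smul_mul_assoc, one_mul, Finset.sum_mul] at h2
    rw [h2, Bialgebra.counit_one, one_smul, add_right_inj] at h1
    exact h1.symm
  have hge : (antipodeSq k H ^ p) e = e := by
    rw [he, eigIdem_one, map_smul, map_sum]
    simp only [hg.pow.antipodeSq_pow]
  rw [hXα, map_sum]
  exact Finset.sum_congr rfl fun i hi => by rw [map_mul, hθα i hi, hge]

end SkewPrimitive

open Coalgebra HopfAlgebra TensorProduct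

section EigenSystem

variable {k H : Type*} [Field k] [Ring H] [HopfAlgebra k H]

variable (k) in
/-- An eigenbasis, together with its dual basis, of the square of the antipode on a left ideal
`H e`, where the eigenvalues come in opposite pairs. -/
structure EigenSystem (e : H) where
  /-- the eigenvectors -/
  w : Fin 4 → H
  /-- the coordinate functionals, extended to `H` along right multiplication by `e` -/
  φ : Fin 4 → H →ₗ[k] k
  /-- the eigenvalues -/
  μ : Fin 4 → k
  c : k
  c_ne_zero : c ≠ 0
  μ_eq : μ = ![1, -1, c, -c]
  expand : ∀ h, h * e = ∑ a, φ a h • w a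
  w_mul : ∀ a, w a * e = w a
  φ_w : ∀ a b, φ a (w b) = if a = b then 1 else 0
  antipodeSq_w : ∀ a, antipodeSq k H (w a) = μ a • w a
  φ_antipodeSq : ∀ a h, φ a (antipodeSq k H h) = μ a * φ a h
  φ_mul : ∀ a h, φ a (h * e) = φ a h

theorem IsGroupLikeElem.antipodeSq_eigIdem {g : H} (hg : IsGroupLikeElem k g) (n : ℕ) (ζ : k) :
    _root_.antipodeSq k H (eigIdem n ζ g) = eigIdem n ζ g := by
  simp [eigIdem, hg.antipodeSq]

variable [IsAlgClosed k] [CharZero k] [FiniteDimensional k H]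

theorem IsGroupLikeElem.nonempty_eigenSystem {g : H} (hg : IsGroupLikeElem k g) {p : ℕ}
    (hp : 0 < p) (hgp : g ^ p = 1) (hlt : ∀ i, 0 < i → i < p → g ^ i ≠ 1)
    (hdim : Module.finrank k H = 4 * p) {n : ℕ} (hn : 0 < n)
    (hθ : _root_.antipodeSq k H ^ n = 1)
    (htr : ∀ i, LinearMap.trace k H (LinearMap.mulRight k (g ^ i) ∘ₗ
      (_root_.antipodeSq k H).toLinearMap) = 0) {ζ : k} (hζ : ζ ^ p = 1) :
    Nonempty (EigenSystem k (eigIdem p ζ g)) := by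
  set e := eigIdem p ζ g with he
  have hee : e * e = e := eigIdem_mul_self hζ hgp hp
  have hθe : _root_.antipodeSq k H e = e := hg.antipodeSq_eigIdem p ζ
  set W := LinearMap.range (LinearMap.mulRight k e) with hW
  have hWfin : Module.finrank k W = 4 := by
    have := hg.mul_finrank_range hp hgp hlt hζ
    rw [hdim, mul_comm 4] at this
    exact Nat.eq_of_mul_eq_mul_left hp this
  have hWe : ∀ x ∈ W, x * e = x := by
    rintro _ ⟨y, rfl⟩
    simp [mul_assoc, hee]
  let F : H →ₗ[k] H := LinearMap.mulRight k e ∘ₗ (_root_.antipodeSq k H).toLinearMap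
  have hFW : ∀ x, F x ∈ W := fun x => ⟨_, rfl⟩
  have hF : ∀ x ∈ W, F x = _root_.antipodeSq k H x := fun x hx => by
    conv_rhs => rw [← hWe x hx, map_mul, hθe]
    rfl
  let T : Module.End k W := F.restrict fun x _ => hFW x
  have hTcoe : ∀ x : W, (T x : H) = _root_.antipodeSq k H x := fun x => hF x x.2
  have hTpow : ∀ m (x : W), ((T ^ m) x : H) = (_root_.antipodeSq k H ^ m) x := fun m => by
    induction m with
    | zero => intro x; rfl
    | succ m ih => intro x; rw [pow_succ', Module.End.mul_apply, hTcoe, ih, pow_succ']; rfl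
  have hT : T ^ n = 1 := LinearMap.ext fun x => Subtype.ext (by rw [hTpow, hθ]; rfl)
  have htrT : LinearMap.trace k W T = 0 := by
    rw [LinearMap.trace_restrict_eq_of_forall_mem W F hFW]
    have : F = (p : k)⁻¹ • ∑ j ∈ Finset.range p, (ζ⁻¹) ^ j •
        (LinearMap.mulRight k (g ^ j) ∘ₗ (_root_.antipodeSq k H).toLinearMap) := by
      refine LinearMap.ext fun x => ?_
      simp [F, he, eigIdem, smul_pow, Finset.mul_sum]
    rw [this, map_smul, map_sum]
    simp [htr]
  have he0 : (⟨e, 1, by simp⟩ : W) ≠ 0 := fun h => by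
    have h0 : e = 0 := congrArg Subtype.val h
    have : W = ⊥ := by rw [hW, h0]; simp
    rw [this, finrank_bot] at hWfin
    exact absurd hWfin (by norm_num)
  obtain ⟨b, c, hc, h0, h1, h2, h3⟩ := Module.End.exists_eigenbasis_four hWfin hn hT htrT he0
    (Subtype.ext ((hTcoe _).trans hθe))
  let μ : Fin 4 → k := ![1, -1, c, -c]
  have hb : ∀ a, T (b a) = μ a • b a := by
    refine Fin.forall_fin_succ.2 ⟨h0.trans (one_smul k _).symm, Fin.forall_fin_succ.2
      ⟨h1.trans (neg_one_smul k _).symm, Fin.forall_fin_succ.2 ⟨h2, Fin.forall_fin_succ.2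
        ⟨h3.trans (neg_smul c _).symm, fun i => i.elim0⟩⟩⟩⟩
  let R : H →ₗ[k] W := (LinearMap.mulRight k e).rangeRestrict
  have hR : ∀ x, (R x : H) = x * e := fun x => rfl
  have hRθ : ∀ h, R (_root_.antipodeSq k H h) = T (R h) := fun h => Subtype.ext (by
    rw [hR, hTcoe, hR, map_mul, hθe])
  have hbT : ∀ a x, b.coord a (T x) = μ a * b.coord a x := fun a x => by
    have : b.coord a ∘ₗ T = μ a • b.coord a := b.ext fun i => by
      rw [LinearMap.comp_apply, hb, LinearMap.smul_apply, map_smul, smul_eq_mul, smul_eq_mul,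
        b.coord_apply, b.repr_self, Finsupp.single_apply]
      split_ifs with h
      · rw [h]
      · simp
    exact LinearMap.congr_fun this x
  exact ⟨{
    w := fun a => b a
    φ := fun a => b.coord a ∘ₗ R
    μ := μ
    c := c
    c_ne_zero := hc
    μ_eq := rfl
    expand := fun h => by
      rw [← hR]
      conv_lhs => rw [← b.sum_repr (R h)]
      rw [Submodule.coe_sum]
      rfl
    w_mul := fun a => hWe _ (b a).2
    φ_w := fun a a' => by
      have : R (b a') = b a' := Subtype.ext (by rw [hR]; exact hWe _ (b a').2)
      simp [this, Finsupp.single_apply, eq_comm]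
    antipodeSq_w := fun a => by
      rw [← hTcoe, hb]; rfl
    φ_antipodeSq := fun a h => by
      rw [LinearMap.comp_apply, LinearMap.comp_apply, hRθ, hbT]
    φ_mul := fun a h => by
      have : R (h * e) = R h := Subtype.ext (by rw [hR, hR, mul_assoc, hee])
      rw [LinearMap.comp_apply, this]; rfl }⟩

namespace EigenSystem

omit [IsAlgClosed k] [CharZero k] [FiniteDimensional k H]

variable {e : H} (E : EigenSystem k e)
include E

theorem sw_mul_mul {M : Type*} [AddCommGroup M] [Module k M] (F : H → H → M) (X : H)
    (hl : ∀ b, IsLinearMap k (fun a => F a b) := by fun_prop)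
    (hr : ∀ a, IsLinearMap k (fun b => F a b) := by fun_prop) :
    sw k (fun a b => F (a * e) (b * e)) X =
      ∑ i, ∑ j, sw k (fun a b => E.φ i a * E.φ j b) X • F (E.w i) (E.w j) := by
  have h1 : ∀ a b, F (a * e) (b * e) =
      ∑ i, ∑ j, (E.φ i a * E.φ j b) • F (E.w i) (E.w j) := fun a b => by
    rw [E.expand a]
    refine (map_sum (hl _).mk' _ _).trans (Finset.sum_congr rfl fun i _ => ?_)
    simp only [IsLinearMap.mk'_apply, (hl _).map_smul]
    rw [E.expand b]
    refine (congrArg _ (map_sum (hr _).mk' _ _)).trans ?_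
    simp only [IsLinearMap.mk'_apply, (hr _).map_smul, Finset.smul_sum, smul_smul]
  rw [sw_congr X h1, sw_sum]
  refine Finset.sum_congr rfl fun i _ => ?_
  rw [sw_sum]
  exact Finset.sum_congr rfl fun j _ => sw_smul_const _ _ _

theorem apply_eq {f : H →ₗ[k] k} (hf : ∀ h, f (h * e) = f h) (h : H) :
    f h = ∑ a, f (E.w a) * E.φ a h := by
  rw [← hf h, E.expand h, map_sum]
  exact Finset.sum_congr rfl fun a _ => by rw [map_smul, smul_eq_mul, mul_comm]

theorem apply_w_eq_zero {f : H →ₗ[k] k} (hf : ∀ h, f (antipodeSq k H h) = f h) {a : Fin 4}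
    (ha : E.μ a ≠ 1) : f (E.w a) = 0 := by
  have h1 := hf (E.w a)
  rw [E.antipodeSq_w, map_smul, smul_eq_mul] at h1
  exact (mul_left_eq_self₀.1 h1).resolve_left ha

theorem μ_pow_four (hc : E.c ^ 4 = 1) (a : Fin 4) : E.μ a ^ 4 = 1 := by
  rw [E.μ_eq]
  fin_cases a <;> simp [hc, Even.neg_pow (by decide : Even 4)]

end EigenSystem

end EigenSystem

open Coalgebra HopfAlgebra TensorProduct

section TrivialEigenspace

variable {k H : Type*} [Field k] [CharZero k] [Ring H] [HopfAlgebra k H] [FiniteDimensional k H]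

theorem counit_eigIdem_one {g : H} (hg : IsGroupLikeElem k g) {p : ℕ} (hp : 0 < p) :
    counit (R := k) (eigIdem p (1 : k) g) = 1 := by
  have hp0 : (p : k) ≠ 0 := Nat.cast_ne_zero.2 hp.ne'
  rw [eigIdem_one, map_smul, map_sum]
  simp [(hg.pow).counit_eq_one, hp0]

/-- The eigenvalues of the square of the antipode on `H e` are fourth roots of unity if `e` is the
averaging idempotent of a group-like element of odd order. -/
theorem EigenSystem.pow_four_eq_one {g : H} (hg : IsGroupLikeElem k g) {p : ℕ} (hp : Odd p)
    (hgp : g ^ p = 1) (hlt : ∀ i, 0 < i → i < p → g ^ i ≠ 1)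
    {e : H} (he : e = eigIdem p (1 : k) g) (E : EigenSystem k e) : E.c ^ 4 = 1 := by
  by_contra hc
  have hp' := hp.pos
  have hee := eigIdem_mul_self (ζ := (1 : k)) (one_pow p) hgp hp'
  have hθe := hg.antipodeSq_eigIdem p (1 : k)
  have hεe := counit_eigIdem_one hg hp'
  rw [← he] at hee hθe hεe
  have hμ0 : E.μ 0 = 1 := by rw [E.μ_eq]; rfl
  have hμ1 : E.μ 1 = -1 := by rw [E.μ_eq]; rfl
  have hμ2 : E.μ 2 = E.c := by rw [E.μ_eq]; rfl
  have hμ3 : E.μ 3 = -E.c := by rw [E.μ_eq]; rfl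
  have c1 : E.c ≠ 1 := fun h => hc (by rw [h, one_pow])
  have c2 : E.c ≠ -1 := fun h => hc (by rw [h]; norm_num)
  have c3 : E.c * E.c ≠ 1 := fun h => hc (by linear_combination (E.c ^ 2 + 1) * h)
  have c4 : E.c * E.c ≠ -1 := fun h => hc (by linear_combination (E.c ^ 2 - 1) * h)
  have h20 : (-1 : k) ≠ 1 := by norm_num
  have hee1 : e = E.φ 0 1 • E.w 0 := by
    have h1 := E.expand 1
    have h2 : ∀ a, E.μ a ≠ 1 → E.φ a 1 = 0 := fun a ha => by
      have := E.φ_antipodeSq a 1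
      rw [map_one] at this
      exact (mul_left_eq_self₀.1 this.symm).resolve_left ha
    rw [one_mul, Fin.sum_univ_four, h2 1 (by rw [hμ1]; exact h20), h2 2 (by rwa [hμ2]),
      h2 3 (by rw [hμ3]; exact fun h => c2 (by rw [← h, neg_neg]))] at h1
    simpa using h1
  set s := E.φ 0 1 with hs
  have hs0 : s * counit (R := k) (E.w 0) = 1 := by
    rw [← hεe]
    conv_rhs => rw [hee1]
    rw [map_smul, smul_eq_mul]
  have hε1 : counit (R := k) (E.w 1) = 0 :=
    E.apply_w_eq_zero (f := counit) counit_antipodeSq (by rw [hμ1]; exact h20)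
  have hεw : ∀ x, counit (R := k) (x * e) = counit x := fun x => by
    rw [Bialgebra.counit_mul, hεe, mul_one]
  let C : Fin 4 → Fin 4 → k := fun i j => sw k (fun a b => E.φ i a * E.φ j b) (E.w 1)
  have hC : ∀ i j, E.μ i * E.μ j ≠ -1 → C i j = 0 := fun i j hij => by
    have h1 : IsLinearMap k fun z => sw k (fun a b => E.φ i a * E.φ j b) z :=
      isLinearMap_sw (by fun_prop) (by fun_prop) IsLinearMap.fun_id
    have h2 := sw_antipodeSq (k := k) (fun a b => E.φ i a * E.φ j b) (E.w 1)
    rw [E.antipodeSq_w, hμ1, h1.map_smul] at h2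
    simp only [E.φ_antipodeSq, mul_mul_mul_comm] at h2
    rw [sw_const_mul] at h2
    have h3 : (E.μ i * E.μ j + 1) * C i j = 0 := by
      simp only [C]
      rw [neg_one_smul] at h2
      linear_combination -h2
    exact (mul_eq_zero.1 h3).resolve_left fun h => hij (eq_neg_of_add_eq_zero_left h)
  have hsum : ∀ (F : H → H → H) (hl : ∀ b, IsLinearMap k (fun a => F a b))
      (hr : ∀ a, IsLinearMap k (fun b => F a b)), sw k (fun a b => F (a * e) (b * e)) (E.w 1) =
      C 0 1 • F (E.w 0) (E.w 1) + C 1 0 • F (E.w 1) (E.w 0) := by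
    intro F hl hr
    rw [E.sw_mul_mul F (E.w 1) hl hr]
    change ∑ i, ∑ j, C i j • F (E.w i) (E.w j) = _
    have hz : ∀ i j, E.μ i * E.μ j ≠ -1 → C i j • F (E.w i) (E.w j) = 0 := fun i j h => by
      rw [hC i j h, zero_smul]
    have n1 : -E.c ≠ -1 := fun h => c1 (neg_injective h)
    have n2 : -E.c ≠ 1 := fun h => c2 (by rw [← h, neg_neg])
    simp only [Fin.sum_univ_four]
    rw [hz 0 0, hz 0 2, hz 0 3, hz 1 1, hz 1 2, hz 1 3, hz 2 0, hz 2 1, hz 2 2, hz 2 3, hz 3 0,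
      hz 3 1, hz 3 2, hz 3 3]
    · simp
    all_goals
      simp only [hμ0, hμ1, hμ2, hμ3, one_mul, mul_one, neg_mul, mul_neg, neg_neg, ne_eq, neg_inj]
      first | assumption | exact fun h => c1 (neg_injective (by simpa using h)) | norm_num
  have hw1 : E.w 1 ≠ 0 := fun h => by
    have := E.φ_w 1 1
    rw [h] at this
    simp at this
  have hC10 : C 1 0 = s := by
    have h1 := hsum (fun a b => counit (R := k) b • a) (by fun_prop) (by fun_prop)
    simp only [hεw, hε1] at h1
    rw [sw_counit_right (fun a => a * e), E.w_mul] at h1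
    have h2 : (1 - C 1 0 * counit (R := k) (E.w 0)) • E.w 1 = 0 := by
      rw [sub_smul, one_smul, mul_smul, sub_eq_zero]
      simpa using h1
    have h3 := (smul_eq_zero.1 h2).resolve_right hw1
    linear_combination (- s) * h3 - C 1 0 * hs0
  have hC01 : C 0 1 = s := by
    have h1 := hsum (fun a b => counit (R := k) a • b) (by fun_prop) (by fun_prop)
    simp only [hεw, hε1] at h1
    rw [sw_counit_left (fun a => a * e), E.w_mul] at h1
    have h2 : (1 - C 0 1 * counit (R := k) (E.w 0)) • E.w 1 = 0 := by
      rw [sub_smul, one_smul, mul_smul, sub_eq_zero]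
      simpa using h1
    have h3 := (smul_eq_zero.1 h2).resolve_right hw1
    linear_combination (- s) * h3 - C 0 1 * hs0
  have hfix := antipodeSq_pow_eq_self_of_skewPrimitive hg hp' hgp hlt (X := E.w 1)
    (by rw [← he, E.w_mul]) fun φ => by
    rw [← he]
    refine (hsum (fun a b => φ b • a) (by fun_prop) (by fun_prop)).trans ?_
    have h1 : φ e = s * φ (E.w 0) := by
      conv_lhs => rw [hee1]
      rw [map_smul, smul_eq_mul]
    have h2 : φ (E.w 1) • e = s • φ (E.w 1) • E.w 0 :=
      (congrArg _ hee1).trans (smul_comm _ _ _)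
    rw [hC01, hC10, h1, h2, mul_smul]
  have hpow : ∀ m, (antipodeSq k H ^ m) (E.w 1) = (-1 : k) ^ m • E.w 1 := fun m => by
    induction m with
    | zero => simp
    | succ m ih => rw [pow_succ, AlgHom.mul_apply, E.antipodeSq_w, hμ1, map_smul, ih, smul_smul,
        pow_succ']
  rw [hpow, hp.neg_one_pow] at hfix
  have h2 : (2 : k) • E.w 1 = 0 := by
    rw [neg_one_smul, neg_eq_iff_add_eq_zero] at hfix
    rw [two_smul, hfix]
  exact hw1 ((smul_eq_zero.1 h2).resolve_left two_ne_zero)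

end TrivialEigenspace

open Coalgebra HopfAlgebra TensorProduct

section HitAction

variable {k H : Type*} [Field k] [Ring H] [HopfAlgebra k H]

theorem hitL_mul (χ : H →ₐ[k] k) (x y : H) :
    hitL χ.toLinearMap (x * y) = hitL χ.toLinearMap x * hitL χ.toLinearMap y := by
  simp only [hitL_apply, AlgHom.toLinearMap_apply]
  rw [sw_mul (fun a b => χ a • b), ← sw_mul_const]
  refine sw_congr x fun a b => ?_
  rw [← sw_const_mul]
  exact sw_congr y fun c d => by simp [smul_smul, mul_comm]

theorem hitL_antipodeSq [FiniteDimensional k H] (χ : H →ₐ[k] k) (x : H) :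
    hitL χ.toLinearMap (antipodeSq k H x) = antipodeSq k H (hitL χ.toLinearMap x) := by
  simp only [hitL_apply, AlgHom.toLinearMap_apply]
  rw [sw_antipodeSq (fun a b => χ a • b), map_sw (L := fun z => antipodeSq k H z)]
  simp only [AlgHom.apply_antipodeSq, map_smul]

theorem hitL_surjective (χ : H →ₐ[k] k) : Function.Surjective (hitL χ.toLinearMap) := by
  intro h
  refine ⟨sw k (fun a b => χ (antipode k a) • b) h, ?_⟩
  rw [map_sw (L := fun z => hitL χ.toLinearMap z)]
  simp only [map_smul, hitL_apply, AlgHom.toLinearMap_apply, ← sw_const_smul]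
  refine (sw_assoc (fun a b c => χ (antipode k a) • χ b • c) h).symm.trans ?_
  refine (sw_congr h fun x c => ?_).trans (sw_counit_left (fun c => c) h)
  simp only [smul_smul, ← map_mul]
  rw [sw_antipode_mul (fun z => χ z • c), map_one, one_smul]

theorem hitL_eigIdem [CharZero k] (χ : H →ₐ[k] k) {g : H} (hg : IsGroupLikeElem k g) (n : ℕ)
    (ζ : k) :
    hitL χ.toLinearMap (eigIdem n ζ g) = eigIdem n (ζ * (χ g)⁻¹) g := by
  have h1 : ∀ j : ℕ, hitL χ.toLinearMap (g ^ j) = χ g ^ j • g ^ j := fun j => by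
    rw [hitL_apply, sw_groupLike (hg.pow (n := j)) (fun a b => χ.toLinearMap a • b)]
    simp
  simp only [eigIdem, smul_pow, map_smul, map_sum, h1, smul_smul, mul_inv, inv_inv, mul_pow]

end HitAction

namespace EigenSystem

variable {k H : Type*} [Field k] [Ring H] [HopfAlgebra k H] {e : H} (E : EigenSystem k e)
include E

theorem antipodeSq_pow_four (hc : E.c ^ 4 = 1) (h : H) : (antipodeSq k H ^ 4) (h * e) = h * e := by
  rw [E.expand, map_sum]
  refine Finset.sum_congr rfl fun a _ => ?_
  have h1 : ∀ m, (antipodeSq k H ^ m) (E.w a) = E.μ a ^ m • E.w a := fun m => by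
    induction m with
    | zero => simp
    | succ m ih => rw [pow_succ, AlgHom.mul_apply, E.antipodeSq_w, map_smul, ih, smul_smul,
        pow_succ']
  rw [map_smul, h1, E.μ_pow_four hc, one_smul]

theorem not_linearIndependent [CharZero k] (f : Fin 3 → H →ₗ[k] k)
    (hfe : ∀ i h, f i (h * e) = f i h) (hfθ : ∀ i h, f i (antipodeSq k H h) = f i h) :
    ¬ LinearIndependent k f := by
  classical
  intro hLI
  have h20 : (-1 : k) ≠ 1 := by norm_num
  have hμ1 : E.μ 1 ≠ 1 := by rw [E.μ_eq]; exact h20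
  obtain ⟨b, hb⟩ : ∃ b, ∀ i, f i ∈ Submodule.span k
      (({E.φ 0, E.φ b} : Finset (H →ₗ[k] k)) : Set (H →ₗ[k] k)) := by
    obtain ⟨b, c, hbc, hμ⟩ : ∃ b c : Fin 4, (b = 2 ∧ c = 3 ∨ b = 3 ∧ c = 2) ∧ E.μ c ≠ 1 := by
      by_cases hc : E.c = 1
      · refine ⟨2, 3, .inl ⟨rfl, rfl⟩, ?_⟩
        rw [E.μ_eq]
        change -E.c ≠ 1
        rw [hc]
        exact h20
      · refine ⟨3, 2, .inr ⟨rfl, rfl⟩, ?_⟩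
        rw [E.μ_eq]
        exact hc
    refine ⟨b, fun i => ?_⟩
    have h1 : f i = f i (E.w 0) • E.φ 0 + f i (E.w b) • E.φ b := LinearMap.ext fun h => by
      have h2 := E.apply_eq (hfe i) h
      rw [Fin.sum_univ_four, E.apply_w_eq_zero (hfθ i) hμ1, zero_mul, add_zero] at h2
      have h3 := E.apply_w_eq_zero (hfθ i) hμ
      rcases hbc with ⟨rfl, rfl⟩ | ⟨rfl, rfl⟩
      · simpa [h3] using h2
      · simpa [h3] using h2
    rw [h1]
    exact Submodule.add_mem _ (Submodule.smul_mem _ _ (Submodule.subset_span (by simp)))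
      (Submodule.smul_mem _ _ (Submodule.subset_span (by simp)))
  have h1 := finrank_span_eq_card hLI
  have h2 : Submodule.span k (Set.range f) ≤ _ := Submodule.span_le.2 (Set.range_subset_iff.2 hb)
  have : FiniteDimensional k (Submodule.span k
      (({E.φ 0, E.φ b} : Finset (H →ₗ[k] k)) : Set (H →ₗ[k] k))) :=
    FiniteDimensional.span_finset k _
  have h3 := Submodule.finrank_mono h2
  have h4 := (finrank_span_finset_le_card (R := k) ({E.φ 0, E.φ b} : Finset (H →ₗ[k] k))).trans
    Finset.card_le_two
  rw [Set.finrank] at h4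
  rw [h1, Fintype.card_fin] at h3
  omega

end EigenSystem

section CharacterCase

variable {k H : Type*} [Field k] [CharZero k] [Ring H] [HopfAlgebra k H] [FiniteDimensional k H]

theorem EigenSystem.antipodeSq_pow_four_eq_one {g : H} (hg : IsGroupLikeElem k g) {p : ℕ}
    (hp : p.Prime) (hodd : Odd p) (hgp : g ^ p = 1) (hlt : ∀ i, 0 < i → i < p → g ^ i ≠ 1)
    {e : H} (he : e = eigIdem p (1 : k) g) (E : EigenSystem k e) {γ : DualHopf k H}
    (hγ : IsGroupLikeElem k γ) (hγp : γ ^ p = 1) (hγ1 : γ ≠ 1) : antipodeSq k H ^ 4 = 1 := by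
  have hc := E.pow_four_eq_one hg hodd hgp hlt he
  let χ := DualHopf.toAlgHom hγ
  have hχp : χ g ^ p = 1 := by rw [← map_pow, hgp, map_one]
  have hχ1 : χ g ≠ 1 := by
    intro hχg
    have hfe : ∀ f : H →ₐ[k] k, f g = 1 → ∀ h, f (h * e) = f h := fun f hf h => by
      have hp0 : (p : k) ≠ 0 := Nat.cast_ne_zero.2 hp.ne_zero
      rw [map_mul, he, eigIdem_one, map_smul, map_sum]
      simp [hf, hp0]
    have hord : orderOf (⟨γ, hγ⟩ : GroupLike k (DualHopf k H)) = p :=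
      have := Fact.mk hp
      orderOf_eq_prime (GroupLike.val_injective hγp) fun h => hγ1 (congrArg GroupLike.val h)
    have hγn : ∀ n : ℕ, IsGroupLikeElem k (γ ^ n) := fun n => hγ.pow
    have hg1 : ∀ n, DualHopf.toAlgHom (hγn n) g = 1 := fun n => by
      induction n with
      | zero => exact hg.counit_eq_one
      | succ n ih =>
        rw [DualHopf.toAlgHom_apply] at ih ⊢
        rw [pow_succ, DualHopf.mul_eq, DualHopf.fn_mk, cv_apply,
          sw_groupLike hg (fun a b => (γ ^ n).fn a * γ.fn b), ih, one_mul]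
        exact hχg
    refine E.not_linearIndependent (fun i => (γ ^ (i : ℕ)).fn)
      (fun i h => hfe (DualHopf.toAlgHom (hγn i)) (hg1 i) h)
      (fun i h => (DualHopf.toAlgHom (hγn i)).apply_antipodeSq h) ?_
    have h1 := (linearIndep_groupLikeVal (R := k) (A := DualHopf k H)).comp
      (fun i : Fin 3 => (⟨γ, hγ⟩ : GroupLike k (DualHopf k H)) ^ (i : ℕ)) fun i j hij => by
        have h3 : 3 ≤ p := by
          have := hp.two_le
          rcases hodd with ⟨m, rfl⟩
          omega
        exact Fin.ext (pow_injOn_Iio_orderOf (by rw [hord]; exact Set.mem_Iio.2 (by omega))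
          (by rw [hord]; exact Set.mem_Iio.2 (by omega)) hij)
    exact h1.map' (DualHopf.equiv k H).toLinearMap (LinearEquiv.ker _)
  have hω : IsPrimitiveRoot (χ g)⁻¹ p := by
    have := Fact.mk hp
    have := IsPrimitiveRoot.orderOf (χ g)⁻¹
    rwa [orderOf_eq_prime (by rw [inv_pow, hχp, inv_one]) (by simpa using hχ1)] at this
  have hcomm : ∀ (m : ℕ) x, (antipodeSq k H ^ m) (hitL χ.toLinearMap x) =
      hitL χ.toLinearMap ((antipodeSq k H ^ m) x) := fun m => by
    induction m with
    | zero => intro x; rfl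
    | succ m ih => intro x; rw [pow_succ', AlgHom.mul_apply, AlgHom.mul_apply, ih, hitL_antipodeSq]
  have hstep : ∀ (m : ℕ) x, (antipodeSq k H ^ 4) (x * eigIdem p ((χ g)⁻¹ ^ m) g) =
      x * eigIdem p ((χ g)⁻¹ ^ m) g := fun m => by
    induction m with
    | zero =>
      intro x
      rw [pow_zero, ← he, E.antipodeSq_pow_four hc]
    | succ m ih =>
      intro x
      obtain ⟨y, rfl⟩ := hitL_surjective χ x
      rw [pow_succ (χ g)⁻¹ m, ← hitL_eigIdem χ hg, ← hitL_mul, hcomm, ih]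
  refine AlgHom.ext fun x => ?_
  rw [← mul_one x, ← sum_eigIdem (g := g) hω hp.pos, Finset.mul_sum, map_sum]
  exact Finset.sum_congr rfl fun m _ => hstep m x

end CharacterCase

open Coalgebra HopfAlgebra TensorProduct

theorem sw_zero {k C M : Type*} [CommSemiring k] [AddCommMonoid C] [Module k C] [Coalgebra k C]
    [AddCommMonoid M] [Module k M] (h : C) : sw k (fun _ _ => (0 : M)) h = 0 :=
  Finset.sum_const_zero

section Adjoint

variable {k H ι : Type*} [Field k] [Ring H] [HopfAlgebra k H] [Fintype ι]

/-- A complete family of orthogonal idempotents `e` of `H` whose span is stable under the right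
adjoint action of `H`, together with the matrix `c` of that action. -/
structure AdjointSystem (k : Type*) {H ι : Type*} [Field k] [Ring H] [HopfAlgebra k H] [Fintype ι]
    (e : ι → H) where
  /-- the matrix coefficients of the action -/
  c : ι → ι → H →ₗ[k] k
  mul_self : ∀ l, e l * e l = e l
  mul_of_ne : ∀ l m, l ≠ m → e l * e m = 0
  ne_zero : ∀ l, e l ≠ 0
  sum_eq_one : ∑ l, e l = 1
  adj : ∀ m h, sw k (fun a b => antipode k a * e m * b) h = ∑ l, c l m h • e l

namespace AdjointSystem

variable {e : ι → H} (A : AdjointSystem k e)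
include A

theorem sum_smul_mul (a : ι → k) (l : ι) : (∑ m, a m • e m) * e l = a l • e l := by
  classical
  rw [Finset.sum_mul, Finset.sum_eq_single l]
  · rw [smul_mul_assoc, A.mul_self]
  · intro m _ hm
    rw [smul_mul_assoc, A.mul_of_ne _ _ hm, smul_zero]
  · simp

theorem coeff_ext {a b : ι → k} (h : ∑ m, a m • e m = ∑ m, b m • e m) (l : ι) : a l = b l := by
  have h1 := A.sum_smul_mul a l
  rw [h, A.sum_smul_mul] at h1
  exact (smul_left_injective k (A.ne_zero l) h1).symm

theorem smul_eq (l m : ι) (h : H) :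
    A.c l m h • e l = sw k (fun a b => antipode k a * e m * b) h * e l := by
  rw [A.adj, A.sum_smul_mul]

theorem coeff_eq_zero {l m : ι} (h0 : ∀ h, e m * h * e l = 0) : A.c l m = 0 := by
  refine LinearMap.ext fun h => ?_
  have h1 := A.smul_eq l m h
  rw [← sw_mul_const] at h1
  have h2 : A.c l m h • e l = (0 : k) • e l := by
    rw [h1, zero_smul]
    refine (sw_congr h fun a b => ?_).trans (sw_zero h)
    rw [mul_assoc, mul_assoc, ← mul_assoc (e m), h0, mul_zero]
  exact smul_left_injective k (A.ne_zero l) h2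

theorem mul_mul_eq (l m : ι) (h : H) :
    e m * h * e l = sw k (fun a b => A.c l m b • (a * e l)) h := by
  have h1 : sw k (fun a b => sw k (fun c d => a * (antipode k c * e m * d)) b) h = e m * h := by
    refine (sw_assoc (fun a c d => a * (antipode k c * e m * d)) h).symm.trans ?_
    refine (sw_congr h fun x d => ?_).trans (sw_counit_left (fun d => e m * d) h)
    simp only [← mul_assoc]
    rw [sw_mul_antipode (fun z => z * e m * d) x, one_mul]
  rw [← h1, ← sw_mul_const]
  refine sw_congr h fun a b => ?_
  rw [sw_const_mul, A.adj, mul_assoc, A.sum_smul_mul, mul_smul_comm]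

theorem sum_coeff (l : ι) (h : H) : ∑ m, A.c l m h = counit (R := k) h := by
  have h1 : ∑ m, sw k (fun a b => antipode k a * e m * b) h = counit (R := k) h • 1 := by
    rw [← sw_sum]
    simp only [← Finset.mul_sum, ← Finset.sum_mul, A.sum_eq_one, mul_one]
    exact sw_antipode_mul (fun z => z) h
  simp only [A.adj] at h1
  rw [Finset.sum_comm, ← A.sum_eq_one, Finset.smul_sum] at h1
  simp only [← Finset.sum_smul] at h1
  exact A.coeff_ext (a := fun l => ∑ m, A.c l m h) h1 l

theorem coeff_one_self (l : ι) : A.c l l 1 = 1 := by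
  have h1 := A.smul_eq l l 1
  rw [sw_one (fun a b => antipode k a * e l * b), antipode_one, one_mul, mul_one, A.mul_self] at h1
  exact smul_left_injective k (A.ne_zero l) (h1.trans (one_smul k _).symm)

theorem cv_coeff [DecidableEq ι] (l m n : ι) :
    cv (A.c l m) (A.c l n) = if m = n then A.c l m else 0 := by
  refine LinearMap.ext fun h => ?_
  have h1 : cv (A.c l m) (A.c l n) h • e l =
      sw k (fun a b => antipode k a * e m * e n * b) h * e l := by
    rw [cv_apply, ← sw_smul_const, ← sw_mul_const]
    calc sw k (fun a b => (A.c l m a * A.c l n b) • e l) h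
        = sw k (fun a b => sw k (fun u v => sw k (fun x y =>
            antipode k u * e m * v * (antipode k x * e n * y) * e l) b) a) h := by
          refine sw_congr h fun a b => ?_
          have : ∀ u v, sw k (fun x y =>
            antipode k u * e m * v * (antipode k x * e n * y) * e l) b =
              (antipode k u * e m * v) * (A.c l n b • e l) := fun u v => by
            rw [A.smul_eq, ← sw_mul_const, ← sw_const_mul]
            exact sw_congr b fun x y => by simp only [mul_assoc]
          simp only [this]
          rw [sw_mul_const, A.adj, mul_smul_comm, A.sum_smul_mul, smul_smul, mul_comm]
      _ = sw k (fun a b => sw k (fun u v => sw k (fun x y =>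
            antipode k a * e m * u * (antipode k x * e n * y) * e l) v) b) h := by
          exact sw_assoc (fun u v b => sw k (fun x y =>
            antipode k u * e m * v * (antipode k x * e n * y) * e l) b) h
      _ = sw k (fun a b => antipode k a * e m * e n * b * e l) h := by
          refine sw_congr h fun a b => ?_
          refine (sw_assoc (fun u x y => 
            antipode k a * e m * u * (antipode k x * e n * y) * e l) b).symm.trans ?_
          refine (sw_congr b fun z y => ?_).trans (sw_counit_left (fun y => 
            antipode k a * e m * e n * y * e l) b)
          rw [show (fun u x => antipode k a * e m * u * (antipode k x * e n * y) * e l) =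
            fun u x => (fun z => antipode k a * e m * z * (e n * y) * e l) (u * antipode k x) by
              funext u x; simp only [mul_assoc]]
          rw [sw_mul_antipode (fun z => antipode k a * e m * z * (e n * y) * e l) z]
          simp only [mul_one, mul_assoc]
  refine smul_left_injective k (A.ne_zero l) (h1.trans ?_)
  split_ifs with hmn
  · subst hmn
    simp only [mul_assoc _ (e m) (e m), A.mul_self, A.smul_eq]
  · simp only [mul_assoc _ (e m) (e n), A.mul_of_ne m n hmn]
    rw [LinearMap.zero_apply, zero_smul]
    simp only [mul_zero, zero_mul]
    rw [sw_zero, zero_mul]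

theorem coeff_mul (l m : ι) (x y : H) : A.c l m (x * y) = ∑ n, A.c n m x * A.c l n y := by
  refine A.coeff_ext (a := fun l => A.c l m (x * y)) (b := fun l => ∑ n, A.c n m x * A.c l n y) ?_ l
  rw [← A.adj, sw_mul (fun a b => antipode k a * e m * b) x y]
  calc sw k (fun a b => sw k (fun c d => antipode k (a * c) * e m * (b * d)) y) x
      = sw k (fun c d => antipode k c * (∑ n, A.c n m x • e n) * d) y := by
        rw [sw_comm (fun a b c d => antipode k (a * c) * e m * (b * d)) x y]
        refine sw_congr y fun c d => ?_
        rw [← A.adj, ← sw_const_mul, ← sw_mul_const]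
        refine sw_congr x fun a b => ?_
        rw [antipode_mul_antidistrib]
        simp only [mul_assoc]
    _ = ∑ n, A.c n m x • sw k (fun c d => antipode k c * e n * d) y := by
        simp only [Finset.mul_sum, Finset.sum_mul, mul_smul_comm, smul_mul_assoc]
        rw [sw_sum]
        exact Finset.sum_congr rfl fun n _ => sw_const_smul _ _ _
    _ = _ := by
        simp only [A.adj, Finset.smul_sum, smul_smul, Finset.sum_smul]
        exact Finset.sum_comm

end AdjointSystem

end Adjoint

open Coalgebra HopfAlgebra TensorProduct

section CentralIdempotent

variable {k H : Type*} [Field k] [CharZero k] [Ring H] [HopfAlgebra k H]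
  {g : H} {p : ℕ}

theorem pow_mul_eigIdem_one (hp : 0 < p) (hgp : g ^ p = 1) (i : ℕ) :
    g ^ i * eigIdem p (1 : k) g = eigIdem p (1 : k) g := by
  induction i with
  | zero => simp
  | succ i ih => rw [pow_succ, mul_assoc, mul_eigIdem (one_pow _) hgp hp, one_smul, ih]

theorem IsGroupLikeElem.antipode_eigIdem_one (hg : IsGroupLikeElem k g) (hp : 0 < p)
    (hgp : g ^ p = 1) : antipode k (eigIdem p (1 : k) g) = eigIdem p (1 : k) g := by
  rw [eigIdem_one, map_smul, map_sum]
  congr 1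
  have h1 : ∑ i ∈ Finset.range p, antipode k (g ^ i) =
      ∑ i ∈ Finset.range p, g ^ (p - 1 - i) * g := by
    refine Finset.sum_congr rfl fun i hi => ?_
    have := Finset.mem_range.1 hi
    rw [hg.antipode_pow_eq hgp this.le, ← pow_succ]
    congr 1
    omega
  rw [h1, Finset.sum_range_reflect (fun i => g ^ i * g) p]
  simp only [← pow_succ]
  have h2 := Finset.sum_range_succ' (fun i => g ^ i) p
  rw [Finset.sum_range_succ, hgp, pow_zero] at h2
  exact (add_right_cancel h2).symm

/-- If conjugation by `g` is a power of the square of the antipode which fixes `H e`, where `e`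
is the averaging idempotent of the group generated by `g`, then `e` is central. -/
theorem IsGroupLikeElem.commute_eigIdem_one [FiniteDimensional k H] (hg : IsGroupLikeElem k g)
    (hp : 0 < p) (hgp : g ^ p = 1) {n : ℕ}
    (hn : ∀ h, (_root_.antipodeSq k H ^ n) h * g = g * h)
    (hfix : ∀ h, (_root_.antipodeSq k H ^ n) (h * eigIdem p (1 : k) g) = h * eigIdem p (1 : k) g)
    (h : H) : h * eigIdem p (1 : k) g = eigIdem p (1 : k) g * h := by
  have hp0 : (p : k) ≠ 0 := Nat.cast_ne_zero.2 hp.ne'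
  have h1 : ∀ h, g * (h * eigIdem p (1 : k) g) = h * eigIdem p (1 : k) g := fun h => by
    rw [← hn, hfix, mul_assoc, ← (commute_eigIdem (k := k) (n := p) (ζ := (1 : k)) (g := g)).eq,
      mul_eigIdem (one_pow _) hgp hp, one_smul]
  have h2 : ∀ (i : ℕ) h, g ^ i * (h * eigIdem p (1 : k) g) = h * eigIdem p (1 : k) g := fun i => by
    induction i with
    | zero => simp
    | succ i ih => intro h; rw [pow_succ, mul_assoc, h1, ih]
  have h3 : ∀ h, eigIdem p (1 : k) g * (h * eigIdem p (1 : k) g) = h * eigIdem p (1 : k) g := by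
    intro h
    conv_lhs => rw [eigIdem_one]
    rw [smul_mul_assoc, Finset.sum_mul]
    simp only [← eigIdem_one, h2]
    rw [Finset.sum_const, Finset.card_range, ← Nat.cast_smul_eq_nsmul k, smul_smul,
      inv_mul_cancel₀ hp0, one_smul]
  obtain ⟨x, rfl⟩ := antipode_surjective (k := k) h
  have h4 := congrArg (antipode k) (h3 x)
  rw [antipode_mul_antidistrib, antipode_mul_antidistrib, hg.antipode_eigIdem_one hp hgp] at h4
  have h5 := h3 (antipode k x)
  rw [← mul_assoc] at h5
  rw [← h5, h4]

variable [FiniteDimensional k H] (hg : IsGroupLikeElem k g) (hgp : g ^ p = 1)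
  (hcen : ∀ h : H, h * eigIdem p (1 : k) g = eigIdem p (1 : k) g * h)
include hg hgp hcen

theorem IsGroupLikeElem.adjoint_coinvariant (hp : 0 < p) (j : ℕ) (h : H) (ψ : H →ₗ[k] k) :
    sw k (fun a b => ψ b • (a * eigIdem p (1 : k) g))
        (sw k (fun a b => antipode k a * g ^ j * b) h) =
      ψ (sw k (fun a b => antipode k a * g ^ j * b) h) • eigIdem p (1 : k) g := by
  set e := eigIdem p (1 : k) g with he
  have hge : ∀ z, g ^ j * z * e = z * e := fun z => by
    rw [mul_assoc, hcen, ← mul_assoc, pow_mul_eigIdem_one hp hgp]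
  have hexp : ∀ x y, sw k (fun a b => ψ b • (a * e)) (antipode k x * g ^ j * y) =
      sw k (fun a b => sw k (fun c d =>
        ψ (antipode k a * g ^ j * d) • (antipode k b * c * e)) y) x := fun x y => by
    rw [sw_mul (fun a b => ψ b • (a * e)) (antipode k x * g ^ j) y]
    rw [sw_mul (fun a b => sw k (fun c d => ψ (b * d) • (a * c * e)) y) (antipode k x) (g ^ j)]
    refine (sw_congr _ fun a b => sw_groupLike (hg.pow (n := j))
      (fun u v => sw k (fun c d => ψ (b * v * d) • (a * u * c * e)) y)).trans ?_
    refine (sw_antipode (fun a b => sw k (fun c d =>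
      ψ (b * g ^ j * d) • (a * g ^ j * c * e)) y) x).trans ?_
    refine sw_congr _ fun a b => sw_congr _ fun c d => ?_
    rw [mul_assoc (antipode k b), mul_assoc (antipode k b), hge, ← mul_assoc]
  have hlin : IsLinearMap k fun z => sw k (fun a b => ψ b • (a * e)) z :=
    isLinearMap_sw (by fun_prop) (by fun_prop) IsLinearMap.fun_id
  rw [map_sw (L := fun z => sw k (fun a b => ψ b • (a * e)) z) _ _ hlin]
  rw [map_sw (L := fun z => ψ z), ← sw_smul_const]
  simp only [hexp]
  refine (sw_assoc (fun a b y => sw k (fun c d =>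
    ψ (antipode k a * g ^ j * d) • (antipode k b * c * e)) y) h).trans ?_
  refine sw_congr h fun a z => ?_
  refine (sw_assoc (fun b c d =>
    ψ (antipode k a * g ^ j * d) • (antipode k b * c * e)) z).symm.trans ?_
  refine (sw_congr z fun x d => ?_).trans
    (sw_counit_left (fun d => ψ (antipode k a * g ^ j * d) • e) z)
  rw [sw_antipode_mul (fun z => ψ (antipode k a * g ^ j * d) • (z * e)), one_mul]

theorem IsGroupLikeElem.nonempty_adjointSystem (hp : 0 < p)
    (hlt : ∀ i, 0 < i → i < p → g ^ i ≠ 1) {ζ : k} (hζ : IsPrimitiveRoot ζ p) :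
    ∃ A : AdjointSystem k (fun l : Fin p => eigIdem p (ζ ^ (l : ℕ)) g),
      ∀ l m h, A.c l m (_root_.antipodeSq k H h) = A.c l m h ∧ A.c l m (g * h) = A.c l m h := by
  have hp0 : (p : k) ≠ 0 := Nat.cast_ne_zero.2 hp.ne'
  obtain ⟨f, hf1, hf⟩ := hg.exists_functional hlt
  have hζl : ∀ l : ℕ, (ζ ^ l) ^ p = 1 := fun l => by rw [← pow_mul, mul_comm, pow_mul, hζ.pow_eq_one, one_pow]
  set e : Fin p → H := fun l => eigIdem p (ζ ^ (l : ℕ)) g with he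
  have hsum : ∑ l, e l = 1 := by
    rw [← sum_eigIdem (g := g) hζ hp, Finset.sum_range]
  have hmul : ∀ l, e l * e l = e l := fun l => eigIdem_mul_self (hζl _) hgp hp
  have hmul0 : ∀ l m, l ≠ m → e l * e m = 0 := fun l m hlm =>
    eigIdem_mul_eigIdem (hζl _) (hζl _) hgp hp fun h =>
      hlm (Fin.ext (hζ.pow_inj l.2 m.2 h))
  have hfe : ∀ l, f (e l) = (p : k)⁻¹ := fun l => by
    simp only [he, eigIdem, map_smul, map_sum, smul_pow]
    rw [Finset.sum_eq_single 0 (fun i hi h0 => by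
      rw [hf i (by omega) (Finset.mem_range.1 hi), smul_zero])
      (fun h => absurd (Finset.mem_range.2 hp) h)]
    simp [hf1]
  have hne : ∀ l, e l ≠ 0 := fun l h0 => by
    have := hfe l
    rw [h0, map_zero] at this
    exact inv_ne_zero hp0 this.symm
  have hpow : ∀ i, g ^ i = ∑ l : Fin p, (ζ ^ (l : ℕ)) ^ i • e l := fun i => by
    rw [← mul_one (g ^ i), ← hsum, Finset.mul_sum]
    refine Finset.sum_congr rfl fun l _ => ?_
    induction i with
    | zero => simp
    | succ i ih => rw [pow_succ', mul_assoc, ih, mul_smul_comm,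
        mul_eigIdem (hζl _) hgp hp, smul_smul, pow_succ]
  have hspan : ∀ m h, ∃ a : Fin p → k,
      sw k (fun a b => antipode k a * e m * b) h = ∑ l, a l • e l := by
    intro m h
    have h1 : sw k (fun a b => antipode k a * e m * b) h = (p : k)⁻¹ • ∑ j ∈ Finset.range p,
        ((ζ ^ (m : ℕ))⁻¹) ^ j • sw k (fun a b => antipode k a * g ^ j * b) h := by
      simp only [← sw_const_smul]
      rw [← sw_sum, ← sw_const_smul]
      refine sw_congr h fun a b => ?_
      simp only [he, eigIdem, smul_pow, mul_smul_comm, smul_mul_assoc, Finset.mul_sum,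
        Finset.sum_mul]
    have h2 : sw k (fun a b => antipode k a * e m * b) h ∈ Submodule.span k (Set.range e) := by
      rw [h1]
      refine Submodule.smul_mem _ _ (Submodule.sum_mem _ fun j _ => Submodule.smul_mem _ _ ?_)
      rw [hg.eq_sum_of_coinvariant hp hgp hf1 hf (hg.adjoint_coinvariant hgp hcen hp j h)]
      refine Submodule.sum_mem _ fun i _ => Submodule.smul_mem _ _ ?_
      rw [hpow]
      exact Submodule.sum_mem _ fun l _ => Submodule.smul_mem _ _ (Submodule.subset_span ⟨l, rfl⟩)
    obtain ⟨a, ha⟩ := (Submodule.mem_span_range_iff_exists_fun k).1 h2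
    exact ⟨a, ha.symm⟩
  let c : Fin p → Fin p → H →ₗ[k] k := fun l m => (p : k) •
    (f ∘ₗ LinearMap.mulLeft k (e l) ∘ₗ IsLinearMap.mk'
      (fun h => sw k (fun a b => antipode k a * e m * b) h)
      (isLinearMap_sw (by fun_prop) (by fun_prop) IsLinearMap.fun_id))
  have hc : ∀ l m h, c l m h = p * f (e l * sw k (fun a b => antipode k a * e m * b) h) :=
    fun _ _ _ => rfl
  have hadj : ∀ m h, sw k (fun a b => antipode k a * e m * b) h = ∑ l, c l m h • e l := by
    intro m h
    obtain ⟨a, ha⟩ := hspan m h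
    rw [ha]
    refine Finset.sum_congr rfl fun l _ => ?_
    rw [hc, ha, Finset.mul_sum, Finset.sum_eq_single l
      (fun i _ hi => by rw [mul_smul_comm, hmul0 _ _ hi.symm, smul_zero]) (by simp),
      mul_smul_comm, hmul, map_smul, hfe, smul_eq_mul, mul_comm (a l), mul_inv_cancel_left₀ hp0]
  refine ⟨⟨c, hmul, hmul0, hne, hsum, hadj⟩, fun l m h => ⟨?_, ?_⟩⟩
  · change c l m (_root_.antipodeSq k H h) = c l m h
    have hθe : ∀ l, _root_.antipodeSq k H (e l) = e l := fun l => hg.antipodeSq_eigIdem p _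
    have h1 : sw k (fun a b => antipode k a * e m * b) (_root_.antipodeSq k H h) =
        _root_.antipodeSq k H (sw k (fun a b => antipode k a * e m * b) h) := by
      rw [sw_antipodeSq (fun a b => antipode k a * e m * b),
        map_sw (L := fun z => _root_.antipodeSq k H z)]
      refine sw_congr h fun a b => ?_
      rw [map_mul, map_mul, hθe]
      rfl
    rw [hc, h1, hadj, map_sum]
    simp only [map_smul, hθe]
    rw [← hadj, ← hc]
  · change c l m (g * h) = c l m h
    have h1 : sw k (fun a b => antipode k a * e m * b) (g * h) =
        sw k (fun a b => antipode k a * e m * b) h := by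
      rw [sw_mul (fun a b => antipode k a * e m * b),
        sw_groupLike hg (fun a b => sw k (fun c d => antipode k (a * c) * e m * (b * d)) h)]
      refine sw_congr h fun a b => ?_
      rw [antipode_mul_antidistrib, mul_assoc, ← mul_assoc (e m), ← (commute_eigIdem : Commute g (e m)).eq,
        ← mul_assoc, mul_assoc (antipode k a), ← mul_assoc (antipode k g), hg.antipode_mul_cancel,
        one_mul]
    rw [hc, h1, ← hc]

end CentralIdempotent

open Coalgebra HopfAlgebra TensorProduct

section Block

variable {k H : Type*} [Field k] [CharZero k] [Ring H] [HopfAlgebra k H]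
  {g : H} {p : ℕ}

/-- If conjugation by `g` is the eighth power of the square of the antipode, then an
eigensystem on the left ideal generated by an eigenprojection of `g` splits in two halves. -/
theorem EigenSystem.exists_of_conj (hg : IsGroupLikeElem k g) (hp : 0 < p) (hgp : g ^ p = 1)
    (hconj : ∀ h, (antipodeSq k H ^ 8) h * g = g * h) {ζ η : k} (hζ : ζ ^ p = 1) (hη : η ^ p = 1)
    (hne : ζ ≠ η) (E : EigenSystem k (eigIdem p ζ g)) {y : H}
    (hy : eigIdem p η g * y * eigIdem p ζ g ≠ 0) :
    (∀ h, h * eigIdem p ζ g = eigIdem p ζ g * h * eigIdem p ζ g +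
      eigIdem p η g * h * eigIdem p ζ g) ∧
    ∃ x, eigIdem p ζ g * x = x ∧ ∀ h, ∃ s t : k,
      eigIdem p ζ g * h * eigIdem p ζ g = s • eigIdem p ζ g + t • x := by
  have h20 : (1 : k) ≠ -1 := by norm_num
  have hθ : ∀ m a, (antipodeSq k H ^ m) (E.w a) = E.μ a ^ m • E.w a := fun m a => by
    induction m with
    | zero => simp
    | succ m ih => rw [pow_succ, AlgHom.mul_apply, E.antipodeSq_w, map_smul, ih, smul_smul,
        pow_succ']
  have hwg : ∀ a, E.w a * g = ζ • E.w a := fun a => by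
    rw [← E.w_mul a, mul_assoc, ← (commute_eigIdem : Commute g (eigIdem p ζ g)).eq,
      mul_eigIdem hζ hgp hp, mul_smul_comm]
  have hgw : ∀ a, g * E.w a = (E.μ a ^ 8 * ζ) • E.w a := fun a => by
    rw [← hconj, hθ, smul_mul_assoc, hwg, smul_smul]
  have hw0 : ∀ a, E.w a ≠ 0 := fun a h => by
    have := E.φ_w a a
    rw [h, map_zero, if_pos rfl] at this
    exact zero_ne_one this
  have hμp : ∀ a, (E.μ a ^ 8 * ζ) ^ p = 1 := fun a => by
    have h1 : ∀ i : ℕ, g ^ i * E.w a = (E.μ a ^ 8 * ζ) ^ i • E.w a := fun i => by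
      induction i with
      | zero => simp
      | succ i ih => rw [pow_succ, mul_assoc, hgw, mul_smul_comm, ih, smul_smul,
          pow_succ' (E.μ a ^ 8 * ζ)]
    have h2 := h1 p
    rw [hgp, one_mul] at h2
    exact smul_left_injective k (hw0 a) (h2.symm.trans (one_smul k _).symm)
  have hμ0 : E.μ 0 = 1 := by rw [E.μ_eq]; rfl
  have hμ1 : E.μ 1 = -1 := by rw [E.μ_eq]; rfl
  have hμ2 : E.μ 2 = E.c := by rw [E.μ_eq]; rfl
  have hμ3 : E.μ 3 = -E.c := by rw [E.μ_eq]; rfl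
  have hg01 : ∀ a, a = 0 ∨ a = 1 → g * E.w a = ζ • E.w a := fun a ha => by
    rw [hgw]
    rcases ha with rfl | rfl
    · rw [hμ0, one_pow, one_mul]
    · rw [hμ1]; norm_num
  have hg23 : ∀ a, a = 2 ∨ a = 3 → g * E.w a = (E.c ^ 8 * ζ) • E.w a := fun a ha => by
    rw [hgw]
    rcases ha with rfl | rfl
    · rw [hμ2]
    · rw [hμ3, Even.neg_pow (by decide)]
  have hcη : E.c ^ 8 * ζ = η := by
    by_contra hcη
    refine hy ?_
    have hcp := hμp 2
    rw [hμ2] at hcp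
    rw [mul_assoc, E.expand, Finset.mul_sum]
    refine Finset.sum_eq_zero fun a _ => ?_
    rw [mul_smul_comm]
    fin_cases a
    · exact (congrArg _ (eigIdem_mul_of_mul_eq (hg01 0 (.inl rfl)) hne hζ hη)).trans (smul_zero _)
    · exact (congrArg _ (eigIdem_mul_of_mul_eq (hg01 1 (.inr rfl)) hne hζ hη)).trans (smul_zero _)
    · exact (congrArg _ (eigIdem_mul_of_mul_eq (hg23 2 (.inl rfl)) hcη hcp hη)).trans (smul_zero _)
    · exact (congrArg _ (eigIdem_mul_of_mul_eq (hg23 3 (.inr rfl)) hcη hcp hη)).trans (smul_zero _)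
  rw [hcη] at hg23
  have hζ01 : ∀ a, a = 0 ∨ a = 1 → eigIdem p ζ g * E.w a = E.w a := fun a ha =>
    eigIdem_mul_of_mul_eq_self (hg01 a ha) hζ hp
  have hη01 : ∀ a, a = 0 ∨ a = 1 → eigIdem p η g * E.w a = 0 := fun a ha =>
    eigIdem_mul_of_mul_eq (hg01 a ha) hne hζ hη
  have hζ23 : ∀ a, a = 2 ∨ a = 3 → eigIdem p ζ g * E.w a = 0 := fun a ha =>
    eigIdem_mul_of_mul_eq (hg23 a ha) hne.symm hη hζ
  have hη23 : ∀ a, a = 2 ∨ a = 3 → eigIdem p η g * E.w a = E.w a := fun a ha =>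
    eigIdem_mul_of_mul_eq_self (hg23 a ha) hη hp
  refine ⟨fun h => ?_, E.w 1, hζ01 1 (.inr rfl), ?_⟩
  · rw [mul_assoc, mul_assoc, E.expand, Fin.sum_univ_four]
    simp only [mul_add, mul_smul_comm, hζ01 0 (.inl rfl), hζ01 1 (.inr rfl), hη01 0 (.inl rfl),
      hη01 1 (.inr rfl), hζ23 2 (.inl rfl), hζ23 3 (.inr rfl), hη23 2 (.inl rfl),
      hη23 3 (.inr rfl), smul_zero, add_zero, zero_add]
    abel
  · have hexp : ∀ h, eigIdem p ζ g * h * eigIdem p ζ g = E.φ 0 h • E.w 0 + E.φ 1 h • E.w 1 := by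
      intro h
      rw [mul_assoc, E.expand, Fin.sum_univ_four]
      simp only [mul_add, mul_smul_comm, hζ01 0 (.inl rfl), hζ01 1 (.inr rfl),
        hζ23 2 (.inl rfl), hζ23 3 (.inr rfl), smul_zero, add_zero]
    have he := hexp (eigIdem p ζ g)
    have hφ1 : E.φ 1 (eigIdem p ζ g) = 0 := by
      have h1 := E.φ_antipodeSq 1 (eigIdem p ζ g)
      rw [hg.antipodeSq_eigIdem, hμ1, neg_one_mul] at h1
      exact self_eq_neg.1 h1
    rw [hφ1, zero_smul, add_zero, eigIdem_mul_self hζ hgp hp, eigIdem_mul_self hζ hgp hp] at he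
    have h0 : E.φ 0 (eigIdem p ζ g) ≠ 0 := fun h0 => by
      rw [h0, zero_smul] at he
      exact hw0 0 ((E.w_mul 0).symm.trans ((congrArg _ he).trans (mul_zero _)))
    refine fun h => ⟨E.φ 0 h * (E.φ 0 (eigIdem p ζ g))⁻¹, E.φ 1 h, ?_⟩
    rw [hexp]
    refine congrArg (· + _) (Eq.trans ?_ (congrArg _ he.symm))
    rw [smul_smul, inv_mul_cancel_right₀ h0]

end Block

namespace AdjointSystem

variable {k H ι : Type*} [Field k] [CharZero k] [Ring H] [HopfAlgebra k H]
  [FiniteDimensional k H] [Fintype ι] {e : ι → H} (A : AdjointSystem k e)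
include A

/-- The coefficients in the row `i` determine those in the row `j` when these are the only
nonzero entries of the row `i` and the coefficients span a space of dimension at most two. -/
theorem coeff_eq_of_block [DecidableEq ι] {i j : ι} (hij : i ≠ j)
    (hi : ∀ m, m ≠ i → m ≠ j → A.c i m = 0) (h0 : A.c i j ≠ 0)
    (hdep : ∀ f : Fin 3 → H →ₗ[k] k, (∀ n, ∃ l m, f n = A.c l m) → ¬ LinearIndependent k f) :
    A.c j j = A.c i i ∧ A.c j i ≠ 0 := by
  have hsum : ∀ h, A.c i i h + A.c i j h = counit (R := k) h := fun h => by
    rw [← A.sum_coeff i h, Finset.sum_eq_add i j hij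
      (fun m _ hm => by rw [hi m hm.1 hm.2, LinearMap.zero_apply]) (by simp) (by simp)]
  have hii : cv (A.c i i) (A.c i i) = A.c i i := by rw [A.cv_coeff, if_pos rfl]
  have hjj : cv (A.c j j) (A.c j j) = A.c j j := by rw [A.cv_coeff, if_pos rfl]
  have hiijj : cv (A.c i j) (A.c i j) = A.c i j := by rw [A.cv_coeff, if_pos rfl]
  have hiij : cv (A.c i i) (A.c i j) = 0 := by rw [A.cv_coeff, if_neg hij]
  have hiji : cv (A.c i j) (A.c i i) = 0 := by rw [A.cv_coeff, if_neg hij.symm]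
  let ξ : DualHopf k H := .mk (A.c i i)
  have hξ0 : ξ ≠ 1 := fun h => h0 <| by
    refine LinearMap.ext fun x => ?_
    have h1 := hsum x
    have h2 : A.c i i = counit := congrArg DualHopf.fn h
    rwa [h2, add_eq_left] at h1
  have hji0 : A.c j i ≠ 0 := fun hji => by
    let χ : H →ₐ[k] k := AlgHom.ofLinearMap (A.c i i) (A.coeff_one_self i) fun x y => by
      rw [A.coeff_mul, Finset.sum_eq_add i j hij
        (fun m _ hm => by rw [hi m hm.1 hm.2, LinearMap.zero_apply, mul_zero]) (by simp) (by simp),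
        hji, LinearMap.zero_apply, zero_mul, add_zero]
    have hgl : IsGroupLikeElem k ξ := DualHopf.isGroupLikeElem_of_algHom χ
    have hidem : ξ * ξ = ξ := by
      rw [DualHopf.mul_eq]
      exact congrArg DualHopf.mk hii
    refine hξ0 ?_
    have h1 := hgl.antipode_mul_cancel
    rw [← one_mul ξ, ← h1, mul_assoc, hidem]
  have hne : A.c j j ≠ (counit : H →ₗ[k] k) := fun hj => by
    have h1 : cv (A.c j j) (A.c j i) = 0 := by rw [A.cv_coeff, if_neg hij.symm]
    rw [hj, counit_cv] at h1
    exact hji0 h1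
  refine ⟨?_, hji0⟩
  have h1 := hdep ![A.c i i, A.c i j, A.c j j] (by
    intro n
    fin_cases n
    · exact ⟨i, i, rfl⟩
    · exact ⟨i, j, rfl⟩
    · exact ⟨j, j, rfl⟩)
  obtain ⟨t, ht, n, hn⟩ := Fintype.not_linearIndependent_iff.1 h1
  let ξ' : DualHopf k H := .mk (A.c i j)
  let δ : DualHopf k H := .mk (A.c j j)
  have hξ : ξ * ξ = ξ := (DualHopf.mul_eq _ _).trans (congrArg DualHopf.mk hii)
  have hξ' : ξ' * ξ' = ξ' := (DualHopf.mul_eq _ _).trans (congrArg DualHopf.mk hiijj)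
  have hδ : δ * δ = δ := (DualHopf.mul_eq _ _).trans (congrArg DualHopf.mk hjj)
  have hξξ' : ξ * ξ' = 0 := (DualHopf.mul_eq _ _).trans (congrArg DualHopf.mk hiij)
  have hξ'ξ : ξ' * ξ = 0 := (DualHopf.mul_eq _ _).trans (congrArg DualHopf.mk hiji)
  have hξ1 : ξ ≠ 0 := fun h => by
    have h2 : A.c i i 1 = 0 := congrArg (fun f => DualHopf.fn f 1) h
    rw [A.coeff_one_self] at h2
    exact one_ne_zero h2
  have hξ'1 : ξ' ≠ 0 := fun h => h0 (congrArg DualHopf.fn h)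
  have ht' : t 0 • ξ + t 1 • ξ' + t 2 • δ = 0 := by
    rw [Fin.sum_univ_three] at ht
    exact congrArg DualHopf.mk ht
  have ht2 : t 2 ≠ 0 := fun ht2 => by
    rw [ht2, zero_smul, add_zero] at ht'
    have h2 := congrArg (ξ * ·) ht'
    have h3 := congrArg (ξ' * ·) ht'
    simp only [mul_add, mul_smul_comm, hξ, hξ', hξξ', hξ'ξ, smul_zero, add_zero, zero_add,
      mul_zero, smul_eq_zero, hξ1, hξ'1, or_false] at h2 h3
    refine hn ?_
    fin_cases n
    · exact h2
    · exact h3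
    · exact ht2
  obtain ⟨s, t, hst⟩ : ∃ s t : k, δ = s • ξ + t • ξ' := by
    refine ⟨-((t 2)⁻¹ * t 0), -((t 2)⁻¹ * t 1), ?_⟩
    have h2 : (t 2)⁻¹ • (t 0 • ξ + t 1 • ξ' + t 2 • δ) = 0 := by rw [ht', smul_zero]
    simp only [smul_add, smul_smul, inv_mul_cancel₀ ht2, one_smul] at h2
    rw [neg_smul, neg_smul, ← neg_add]
    exact eq_neg_of_add_eq_zero_right h2
  have hfn : A.c j j = s • A.c i i + t • A.c i j := congrArg DualHopf.fn hst
  have hs : s = 1 := by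
    have h2 := LinearMap.congr_fun hfn 1
    have h3 := hsum 1
    rw [A.coeff_one_self, Bialgebra.counit_one, add_eq_left] at h3
    rw [LinearMap.add_apply, LinearMap.smul_apply, LinearMap.smul_apply, A.coeff_one_self,
      A.coeff_one_self, h3, smul_zero, add_zero, smul_eq_mul, mul_one] at h2
    exact h2.symm
  have ht0 : t * t = t := by
    have h2 := congrArg (ξ' * ·) hδ
    rw [hst] at h2
    simp only [mul_add, add_mul, mul_smul_comm, smul_mul_assoc, hξ, hξ', hξξ', hξ'ξ, smul_zero,
      add_zero, zero_add, smul_smul] at h2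
    exact smul_left_injective k hξ'1 h2
  rcases IsIdempotentElem.iff_eq_zero_or_one.1 ht0 with rfl | rfl
  · rw [hfn, hs, one_smul, zero_smul, add_zero]
  · refine absurd (LinearMap.ext fun h => ?_) hne
    rw [hfn, hs, one_smul, one_smul, LinearMap.add_apply, hsum]

end AdjointSystem

open Coalgebra HopfAlgebra TensorProduct

section SimpleModule

variable {k H V : Type*} [Field k] [Ring H] [HopfAlgebra k H]
  [AddCommGroup V] [Module k V] [Module H V] [IsScalarTower k H V]

theorem exists_smul_eq_of_corner [IsAlgClosed k] [FiniteDimensional k V] [IsSimpleModule H V]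
    {e x : H} (he : e * e = e) (hx : e * x = x)
    (hcorner : ∀ h, ∃ s t : k, e * h * e = s • e + t • x) {v₀ : V} (hv₀ : e • v₀ ≠ 0) :
    ∃ u : V, u ≠ 0 ∧ e • u = u ∧ ∀ v : V, ∃ r : k, e • v = r • u := by
  let ρ := Algebra.lsmul k k V (A := H)
  have hρ : ∀ (h : H) (v : V), ρ h v = h • v := fun _ _ => rfl
  let W : Submodule k V := LinearMap.range (ρ e)
  have hW : ∀ w ∈ W, e • w = w := by
    rintro _ ⟨v, rfl⟩
    rw [hρ, ← mul_smul, he]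
  have hxW : ∀ w ∈ W, ρ x w ∈ W := fun w _ => ⟨x • w, by rw [hρ, hρ, ← mul_smul, hx]⟩
  have : Nontrivial W := ⟨⟨⟨e • v₀, ⟨v₀, rfl⟩⟩, 0, fun h => hv₀ (congrArg Subtype.val h)⟩⟩
  obtain ⟨r, hr⟩ := Module.End.exists_eigenvalue ((ρ x).restrict hxW)
  obtain ⟨⟨u, huW⟩, hu, hu0⟩ := hr.exists_hasEigenvector
  have hxu : x • u = r • u := congrArg Subtype.val (Module.End.mem_eigenspace_iff.1 hu)
  have hu0' : u ≠ 0 := fun h => hu0 (Subtype.ext h)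
  refine ⟨u, hu0', hW u huW, fun v => ?_⟩
  obtain ⟨h, rfl⟩ := IsSimpleModule.toSpanSingleton_surjective H hu0' v
  obtain ⟨s, t, hst⟩ := hcorner h
  refine ⟨s + t * r, ?_⟩
  rw [LinearMap.toSpanSingleton_apply, ← mul_smul]
  conv_lhs => rw [← hW u huW]
  rw [← mul_smul, hst, add_smul, smul_assoc, smul_assoc, hxu, hW u huW, smul_smul, add_smul]

theorem exists_algHom_of_smul {u : V} (hu : u ≠ 0) (h : ∀ x : H, ∃ r : k, x • u = r • u) :
    ∃ χ : H →ₐ[k] k, ∀ x : H, x • u = χ x • u := by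
  choose r hr using h
  have hinj := smul_left_injective k hu
  refine ⟨AlgHom.ofLinearMap ⟨⟨r, fun x y => hinj ?_⟩, fun c x => hinj ?_⟩ (hinj ?_) fun x y => hinj ?_, hr⟩
  · change r (x + y) • u = (r x + r y) • u
    rw [← hr, add_smul, add_smul, hr, hr]
  · change r (c • x) • u = (c * r x) • u
    rw [← hr, smul_assoc, hr, mul_smul]
  · change r 1 • u = (1 : k) • u
    rw [← hr, one_smul, one_smul]
  · change r (x * y) • u = (r x * r y) • u
    rw [← hr, mul_smul, hr y, ← algebraMap_smul H (r y), ← mul_smul, ← Algebra.commutes, mul_smul,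
      hr x, algebraMap_smul, smul_smul, mul_comm]

theorem trace_lsmul_eq_one [FiniteDimensional k V] {e : H} {u : V} (hu : u ≠ 0) (heu : e • u = u)
    (he : ∀ v : V, ∃ r : k, e • v = r • u) :
    LinearMap.trace k V (Algebra.lsmul k k V e) = 1 := by
  have h1 : LinearMap.IsProj (Submodule.span k {u}) (Algebra.lsmul k k V e) := by
    refine ⟨fun v => ?_, fun v hv => ?_⟩
    · obtain ⟨r, hr⟩ := he v
      exact Submodule.mem_span_singleton.2 ⟨r, hr.symm⟩
    · obtain ⟨r, rfl⟩ := Submodule.mem_span_singleton.1 hv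
      rw [map_smul]
      exact congrArg _ heu
  rw [h1.trace, finrank_span_singleton hu, Nat.cast_one]

/-- The functional `h ↦ tr (e m • z h)` on a module, where `z h = h₂ S(h₁)`. -/
theorem AdjointSystem.trace_lsmul {ι : Type*} [Fintype ι] {e : ι → H} (A : AdjointSystem k e)
    [FiniteDimensional k V] (m : ι) (h : H) :
    LinearMap.trace k V (Algebra.lsmul k k V (e m * sw k (fun a b => b * antipode k a) h)) =
      ∑ l, A.c l m h * LinearMap.trace k V (Algebra.lsmul k k V (e l)) := by
  let τ : H →ₗ[k] k := LinearMap.trace k V ∘ₗ (Algebra.lsmul k k V (A := H)).toLinearMap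
  have hτ : ∀ x y, τ (x * y) = τ (y * x) := fun x y => by
    change LinearMap.trace k V (Algebra.lsmul k k V (x * y)) =
      LinearMap.trace k V (Algebra.lsmul k k V (y * x))
    rw [map_mul (Algebra.lsmul k k V), map_mul (Algebra.lsmul k k V), LinearMap.trace_mul_comm]
  have h1 : τ (∑ l, A.c l m h • e l) = ∑ l, A.c l m h * τ (e l) := by
    simp [map_sum]
  refine Eq.trans ?_ h1
  change τ _ = _
  rw [← A.adj, ← sw_const_mul, map_sw (L := fun z => τ z), map_sw (L := fun z => τ z)]
  refine sw_congr h fun a b => ?_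
  rw [← mul_assoc, hτ, mul_assoc]

variable {g : H} {p : ℕ}

theorem IsGroupLikeElem.commute_sw_mul_antipode [CharZero k] (hg : IsGroupLikeElem k g)
    (hp : 0 < p) (hgp : g ^ p = 1)
    (hcen : ∀ h : H, h * eigIdem p (1 : k) g = eigIdem p (1 : k) g * h) (h : H) :
    Commute g (sw k (fun a b => b * antipode k a) h) := by
  have hp0 : (p : k) ≠ 0 := Nat.cast_ne_zero.2 hp.ne'
  have hr : ∀ (i : ℕ) h, sw k (fun a b => b * antipode k a) (h * g ^ i) =
      sw k (fun a b => b * antipode k a) h := fun i h => by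
    rw [sw_mul (fun a b => b * antipode k a) h (g ^ i)]
    refine sw_congr h fun a b => ?_
    rw [sw_groupLike (hg.pow (n := i)) (fun c d => b * d * antipode k (a * c)),
      antipode_mul_antidistrib, mul_assoc, ← mul_assoc (g ^ i), (hg.pow (n := i)).mul_antipode_cancel,
      one_mul]
  have hl : ∀ h, sw k (fun a b => b * antipode k a) (g * h) * g =
      g * sw k (fun a b => b * antipode k a) h := fun h => by
    rw [sw_mul (fun a b => b * antipode k a) g h,
      sw_groupLike hg (fun a b => sw k (fun c d => b * d * antipode k (a * c)) h), ← sw_mul_const,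
      ← sw_const_mul]
    refine sw_congr h fun a b => ?_
    rw [antipode_mul_antidistrib]
    simp only [mul_assoc, hg.antipode_mul_cancel, mul_one]
  have he : ∀ h, sw k (fun a b => b * antipode k a) (h * eigIdem p (1 : k) g) =
      sw k (fun a b => b * antipode k a) h := fun h => by
    have hlin : IsLinearMap k fun z : H => sw k (fun a b => b * antipode k a) z :=
      isLinearMap_sw (by fun_prop) (by fun_prop) IsLinearMap.fun_id
    rw [eigIdem_one, mul_smul_comm, Finset.mul_sum, hlin.map_smul]
    refine (congrArg _ (map_sum hlin.mk' _ _)).trans ?_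
    simp only [IsLinearMap.mk'_apply, hr]
    rw [Finset.sum_const, Finset.card_range, ← Nat.cast_smul_eq_nsmul k, smul_smul,
      inv_mul_cancel₀ hp0, one_smul]
  change g * _ = _ * g
  rw [← hl, ← he (g * h), hcen, ← mul_assoc,
    ← (commute_eigIdem : Commute g (eigIdem p (1 : k) g)).eq, mul_eigIdem (one_pow _) hgp hp,
    one_smul, ← hcen, he]

end SimpleModule

open Coalgebra HopfAlgebra TensorProduct

theorem Commute.eigIdem_left {k A : Type*} [Field k] [CharZero k] [Ring A] [Algebra k A] {g z : A}
    (h : Commute g z) (n : ℕ) (ζ : k) : Commute (eigIdem n ζ g) z :=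
  (Commute.sum_left _ _ _ fun j _ => (h.smul_left ζ⁻¹).pow_left j).smul_left (n : k)⁻¹

section NoncentralBlock

variable {k H V ι : Type*} [Field k] [CharZero k] [Ring H] [HopfAlgebra k H]
  [AddCommGroup V] [Module k V] [Module H V] [IsScalarTower k H V] [FiniteDimensional k V]
  [Fintype ι] [DecidableEq ι]

theorem AdjointSystem.sw_mul_antipode_smul {e : ι → H} (A : AdjointSystem k e) {i j : ι} (hij : i ≠ j)
    (hV : ∀ l, l ≠ i → l ≠ j → ∀ v : V, e l • v = 0) {u u' : V} (hu : u ≠ 0) (heu : e i • u = u)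
    (he : ∀ v : V, ∃ r : k, e i • v = r • u) (hu' : u' ≠ 0) (heu' : e j • u' = u')
    (he' : ∀ v : V, ∃ r : k, e j • v = r • u')
    (hz : ∀ h, Commute (e i) (sw k (fun a b => b * antipode k a) h))
    (hc : ∀ h, A.c i i h + A.c j i h = counit (R := k) h) (h : H) (v : V) :
    sw k (fun a b => b * antipode k a) h • e i • v = counit (R := k) h • e i • v := by
  set z := sw k (fun a b => b * antipode k a) h with hz'
  have htr0 : ∀ l, l ≠ i → l ≠ j → LinearMap.trace k V (Algebra.lsmul k k V (e l)) = 0 := by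
    intro l hli hlj
    rw [show Algebra.lsmul k k V (e l) = 0 from LinearMap.ext (hV l hli hlj), map_zero]
  have h1 := A.trace_lsmul (V := V) i h
  rw [Finset.sum_eq_add i j hij (fun l _ hl => by rw [htr0 l hl.1 hl.2, mul_zero]) (by simp)
    (by simp), trace_lsmul_eq_one hu heu he, trace_lsmul_eq_one hu' heu' he', mul_one, mul_one, hc,
    ← hz'] at h1
  obtain ⟨t, ht⟩ := he (z • u)
  have hzu : z • u = t • u := by
    conv_lhs => rw [← heu]
    rw [← mul_smul, ← (hz h).eq, mul_smul, ht]
  have hze : Algebra.lsmul k k V (e i * z) = t • Algebra.lsmul k k V (e i) := by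
    refine LinearMap.ext fun v => ?_
    obtain ⟨r, hr⟩ := he v
    change (e i * z) • v = t • e i • v
    rw [(hz h).eq, mul_smul, hr, ← algebraMap_smul H r, ← mul_smul, ← Algebra.commutes, mul_smul,
      hzu, algebraMap_smul, smul_comm, algebraMap_smul]
  rw [hze, map_smul, trace_lsmul_eq_one hu heu he, smul_eq_mul, mul_one] at h1
  obtain ⟨r, hr⟩ := he v
  rw [hr, ← h1, ← algebraMap_smul H r, ← mul_smul, ← Algebra.commutes, mul_smul,
      hzu, algebraMap_smul, smul_comm, algebraMap_smul]

/-- If `h₂ S(h₁)` acts by `ε(h)`, then the square of the antipode acts trivially. -/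
theorem antipodeSq_smul_of_sw_mul_antipode [FiniteDimensional k H]
    (hV : ∀ (h : H) (v : V), sw k (fun a b => b * antipode k a) h • v = counit (R := k) h • v) (h : H)
    (v : V) : antipodeSq k H h • v = h • v := by
  have h1 : ∀ (h : H) (v : V), sw k (fun a b => antipode k a * antipodeSq k H b) h • v =
      counit (R := k) h • v := fun h v => by
    have := hV (antipode k h) v
    rwa [sw_antipode (fun a b => b * antipode k a), counit_antipode] at this
  have h2 : sw k (fun a b => a * sw k (fun c d => antipode k c * antipodeSq k H d) b) h =
      antipodeSq k H h := by
    simp only [← sw_const_mul]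
    refine (sw_assoc (fun a c d => a * (antipode k c * antipodeSq k H d)) h).symm.trans ?_
    refine (sw_congr h fun x d => ?_).trans (sw_counit_left (fun d => antipodeSq k H d) h)
    simp only [← mul_assoc]
    rw [sw_mul_antipode (fun z => z * antipodeSq k H d) x, one_mul]
  have hlin : ∀ F : H → H → H, sw k F h • v = sw k (fun a b => F a b • v) h := fun F =>
    map_sw (L := fun z : H => z • v) F h
      ⟨fun x y => add_smul x y v, fun c x => smul_assoc c x v⟩
  rw [← h2, hlin]
  simp only [mul_smul, h1]
  refine Eq.trans (sw_congr h fun a b => ?_) ((hlin fun a b => counit (R := k) b • a).symm.trans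
    (congrArg (· • v) (sw_counit_right (k := k) (fun a => a) h)))
  rw [← algebraMap_smul H (counit b), ← mul_smul, ← Algebra.commutes, mul_smul, algebraMap_smul,
    smul_assoc]

end NoncentralBlock

open Coalgebra HopfAlgebra TensorProduct

section Conjugation

variable {k H : Type*} [Field k] [CharZero k] [IsAlgClosed k] [Ring H] [HopfAlgebra k H]
  [FiniteDimensional k H] {g : H} {p : ℕ}

theorem commute_of_corner_eq_zero {ζ : k} (hζ : IsPrimitiveRoot ζ p) (hp : 0 < p) (hgp : g ^ p = 1)
    (h0 : ∀ i j : Fin p, i ≠ j → ∀ h,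
      eigIdem p (ζ ^ (j : ℕ)) g * h * eigIdem p (ζ ^ (i : ℕ)) g = 0) (h : H) : Commute g h := by
  have hζl : ∀ l : ℕ, (ζ ^ l) ^ p = 1 := fun l => by
    rw [← pow_mul, mul_comm, pow_mul, hζ.pow_eq_one, one_pow]
  have hsum : ∑ l : Fin p, eigIdem p (ζ ^ (l : ℕ)) g = 1 := by
    rw [← sum_eigIdem (g := g) hζ hp, Finset.sum_range]
  have h1 : h = ∑ l : Fin p, eigIdem p (ζ ^ (l : ℕ)) g * h * eigIdem p (ζ ^ (l : ℕ)) g := by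
    conv_lhs => rw [← mul_one h, ← one_mul h, ← hsum, Finset.mul_sum]
    refine Finset.sum_congr rfl fun i _ => ?_
    rw [Finset.sum_mul, Finset.sum_mul, Finset.sum_eq_single i (fun j _ hj => h0 i j hj.symm h)
      (by simp)]
  rw [h1]
  refine Commute.sum_right _ _ _ fun l _ => ?_
  change g * _ = _ * g
  rw [mul_assoc _ _ g, ← (commute_eigIdem : Commute g (eigIdem p (ζ ^ (l : ℕ)) g)).eq,
    mul_eigIdem (hζl _) hgp hp, mul_assoc, ← mul_assoc g, mul_eigIdem (hζl _) hgp hp,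
    smul_mul_assoc, mul_smul_comm, mul_assoc]

theorem IsGroupLikeElem.commute_of_conj (hg : IsGroupLikeElem k g) (hp : p.Prime) (hodd : Odd p)
    (hgp : g ^ p = 1) (hlt : ∀ i, 0 < i → i < p → g ^ i ≠ 1)
    (hdim : Module.finrank k H = 4 * p) {ζ : k} (hζ : IsPrimitiveRoot ζ p)
    (hE : ∀ l : ℕ, Nonempty (EigenSystem k (eigIdem p (ζ ^ l) g)))
    (hconj : ∀ h, (_root_.antipodeSq k H ^ 8) h * g = g * h)
    (hγ : ∀ γ : DualHopf k H, IsGroupLikeElem k γ → γ ^ p = 1 → γ = 1) (h : H) :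
    Commute g h := by
  have hζl : ∀ l : ℕ, (ζ ^ l) ^ p = 1 := fun l => by
    rw [← pow_mul, mul_comm, pow_mul, hζ.pow_eq_one, one_pow]
  have hζne : ∀ i j : Fin p, i ≠ j → ζ ^ (i : ℕ) ≠ ζ ^ (j : ℕ) := fun i j hij h =>
    hij (Fin.ext (hζ.pow_inj i.2 j.2 h))
  obtain ⟨E₀⟩ : Nonempty (EigenSystem k (eigIdem p (1 : k) g)) := by
    have := hE 0
    rwa [pow_zero] at this
  have hcen : ∀ h : H, h * eigIdem p (1 : k) g = eigIdem p (1 : k) g * h := by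
    refine hg.commute_eigIdem_one hp.pos hgp hconj fun h => ?_
    have h1 := E₀.antipodeSq_pow_four (E₀.pow_four_eq_one hg hodd hgp hlt rfl)
    rw [show 8 = 4 + 4 from rfl, pow_add, AlgHom.mul_apply, h1, h1]
  set e : Fin p → H := fun l => eigIdem p (ζ ^ (l : ℕ)) g with he
  obtain ⟨A, hA⟩ : ∃ A : AdjointSystem k e, ∀ l m h,
      A.c l m (_root_.antipodeSq k H h) = A.c l m h ∧ A.c l m (g * h) = A.c l m h :=
    hg.nonempty_adjointSystem hgp hcen hp.pos hlt hζ
  have hdep : ∀ f : Fin 3 → H →ₗ[k] k, (∀ n, ∃ l m, f n = A.c l m) → ¬ LinearIndependent k f := by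
    intro f hf
    refine E₀.not_linearIndependent f (fun n h => ?_) fun n h => ?_
    · obtain ⟨l, m, hn⟩ := hf n
      have h1 : ∀ i : ℕ, A.c l m (g ^ i * h) = A.c l m h := fun i => by
        induction i with
        | zero => rw [pow_zero, one_mul]
        | succ i ih => rw [pow_succ', mul_assoc, (hA l m _).2, ih]
      rw [hn, hcen, eigIdem_one, smul_mul_assoc, Finset.sum_mul, map_smul, map_sum]
      simp only [h1]
      rw [Finset.sum_const, Finset.card_range, ← Nat.cast_smul_eq_nsmul k, smul_smul,
        inv_mul_cancel₀ (Nat.cast_ne_zero.2 hp.ne_zero), one_smul]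
    · obtain ⟨l, m, hn⟩ := hf n
      rw [hn, (hA l m h).1]
  refine commute_of_corner_eq_zero hζ hp.pos hgp (fun i j hij => ?_) h
  by_contra hcon
  obtain ⟨y, hy⟩ := not_forall.1 hcon
  have hblock : ∀ i j : Fin p, i ≠ j → ∀ y, e j * y * e i ≠ 0 →
      (∀ h, h * e i = e i * h * e i + e j * h * e i) ∧
        ∃ x, e i * x = x ∧ ∀ h, ∃ s t : k, e i * h * e i = s • e i + t • x := fun i j hij y hy => by
    obtain ⟨E⟩ := hE i
    exact E.exists_of_conj hg hp.pos hgp hconj (hζl i) (hζl j) (hζne i j hij) hy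
  have hzero : ∀ i j : Fin p, i ≠ j → (∀ h, h * e i = e i * h * e i + e j * h * e i) →
      ∀ m, m ≠ i → m ≠ j → A.c i m = 0 := fun i j hij hb m hmi hmj => by
    refine A.coeff_eq_zero fun h => ?_
    rw [mul_assoc, hb, mul_add, mul_assoc (e i), ← mul_assoc (e m), A.mul_of_ne m i hmi, zero_mul,
      mul_assoc (e j), ← mul_assoc (e m), A.mul_of_ne m j hmj, zero_mul, add_zero]
  obtain ⟨hbi, xi, hxi, hci⟩ := hblock i j hij y hy
  have hcij : A.c i j ≠ 0 := fun h0 => hy <| by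
    rw [A.mul_mul_eq i j y, h0]
    simp only [LinearMap.zero_apply, zero_smul]
    exact sw_zero y
  obtain ⟨hjj, hji⟩ := A.coeff_eq_of_block hij (hzero i j hij hbi) hcij hdep
  obtain ⟨y', hy'⟩ : ∃ y', e i * y' * e j ≠ 0 := by
    by_contra! hcon
    exact hji (A.coeff_eq_zero hcon)
  obtain ⟨hbj, xj, hxj, hcj⟩ := hblock j i hij.symm y' hy'
  have hsum : ∀ i j : Fin p, i ≠ j → (∀ m, m ≠ i → m ≠ j → A.c i m = 0) → ∀ h,
      A.c i i h + A.c i j h = counit (R := k) h := fun i j hij hi h => by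
    rw [← A.sum_coeff i h, Finset.sum_eq_add i j hij
      (fun m _ hm => by rw [hi m hm.1 hm.2, LinearMap.zero_apply]) (by simp) (by simp)]
  have hsi := hsum i j hij (hzero i j hij hbi)
  have hsj := hsum j i hij.symm (hzero j i hij.symm hbj)
  have hi0 : (i : ℕ) ≠ 0 := fun hi0 => hy <| by
    change e j * y * e i = 0
    have h1 : e i = eigIdem p (1 : k) g := by simp only [he, hi0, pow_zero]
    rw [mul_assoc, h1, hcen, ← h1, ← mul_assoc, A.mul_of_ne j i hij.symm, zero_mul]
  -- a simple module on which `e i` does not vanish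
  obtain ⟨M, hM, hMi⟩ : ∃ M : Submodule H H, IsCoatom M ∧ e i ∉ M := by
    have h1 : Submodule.span H {1 - e i} ≠ ⊤ := fun h => by
      obtain ⟨a, ha⟩ := Submodule.mem_span_singleton.1 (h ▸ Submodule.mem_top : (1 : H) ∈ _)
      have := congrArg (· * e i) ha
      simp only [smul_eq_mul, mul_assoc, sub_mul, one_mul, A.mul_self, sub_self, mul_zero] at this
      exact A.ne_zero i this.symm
    obtain ⟨M, hM, hle⟩ := (eq_top_or_exists_le_coatom _).resolve_left h1
    refine ⟨M, hM, fun hi => hM.1 ?_⟩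
    refine Ideal.eq_top_of_unit_mem (I := M) 1 1 ?_ (one_mul 1)
    rw [← sub_add_cancel 1 (e i)]
    exact M.add_mem (hle (Submodule.mem_span_singleton_self _)) hi
  have hsimple : IsSimpleModule H (H ⧸ M) := isSimpleModule_iff_isCoatom.2 hM
  have hv₀ : e i • (Submodule.Quotient.mk 1 : H ⧸ M) ≠ 0 := by
    rw [← Submodule.Quotient.mk_smul, smul_eq_mul, mul_one]
    exact fun h => hMi ((Submodule.Quotient.mk_eq_zero M).1 h)
  generalize (Submodule.Quotient.mk 1 : H ⧸ M) = v₀ at hv₀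
  obtain ⟨u, hu0, hu, hui⟩ := exists_smul_eq_of_corner (k := k) (A.mul_self i) hxi hci hv₀
  have hgen : ∀ v : H ⧸ M, ∃ h : H, v = h • u := fun v => by
    obtain ⟨h, hh⟩ := IsSimpleModule.toSpanSingleton_surjective H hu0 v
    exact ⟨h, hh.symm⟩
  have hsplit : ∀ v : H ⧸ M, v = e i • v + e j • v := fun v => by
    obtain ⟨h, rfl⟩ := hgen v
    have h1 := congrArg (· • u) (hbi h)
    simp only [add_smul, mul_smul, hu] at h1
    exact h1
  by_cases hj0 : ∀ v : H ⧸ M, e j • v = 0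
  · -- the module is one-dimensional
    have h1 : ∀ x : H, ∃ r : k, x • u = r • u := fun x => by
      obtain ⟨r, hr⟩ := hui (x • u)
      exact ⟨r, by rw [hsplit (x • u), hj0, add_zero, hr]⟩
    obtain ⟨χ, hχ⟩ := exists_algHom_of_smul (k := k) (V := H ⧸ M) hu0 h1
    have hχg : χ g = ζ ^ (i : ℕ) := by
      refine smul_left_injective k hu0 ?_
      change χ g • u = ζ ^ (i : ℕ) • u
      rw [← hχ]
      conv_lhs => rw [← hu]
      rw [← mul_smul, he, mul_eigIdem (hζl i) hgp hp.pos, smul_assoc]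
      exact congrArg _ hu
    have hgl := DualHopf.isGroupLikeElem_of_algHom χ
    have h4 : DualHopf.mk χ.toLinearMap ^ 4 = 1 := by
      refine hγ _ hgl.pow ?_
      rw [← pow_mul, ← hdim, ← DualHopf.finrank_eq k H]
      exact hgl.pow_finrank_eq_one
    have h4g : χ g ^ 4 = 1 := by
      have h1 : ∀ m : ℕ, (DualHopf.mk χ.toLinearMap ^ m).fn g = χ g ^ m := fun m => by
        induction m with
        | zero => rw [pow_zero, pow_zero]; exact hg.counit_eq_one
        | succ m ih =>
          rw [pow_succ, DualHopf.mul_eq, DualHopf.fn_mk, cv_apply, DualHopf.fn_mk,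
            sw_groupLike hg (fun a b => (DualHopf.mk χ.toLinearMap ^ m).fn a * χ.toLinearMap b), ih,
            pow_succ]
          rfl
      rw [← h1, h4]
      exact hg.counit_eq_one
    rw [hχg, ← pow_mul] at h4g
    have h5 := (Nat.Prime.dvd_mul hp).1 (hζ.dvd_of_pow_eq_one _ h4g)
    rcases h5 with h5 | h5
    · exact absurd (Nat.le_of_dvd (Nat.pos_of_ne_zero hi0) h5) (by omega)
    · have h6 : p ∣ 2 ^ 2 := by simpa using h5
      have := (Nat.prime_dvd_prime_iff_eq hp Nat.prime_two).1 (hp.dvd_of_dvd_pow h6)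
      rw [this] at hodd
      exact absurd hodd (by decide)
  · obtain ⟨v₁, hv₁⟩ := not_forall.1 hj0
    obtain ⟨u', hu'0, hu', huj⟩ := exists_smul_eq_of_corner (k := k) (A.mul_self j) hxj hcj hv₁
    have hV : ∀ l, l ≠ i → l ≠ j → ∀ v : H ⧸ M, e l • v = 0 := fun l hli hlj v => by
      rw [hsplit v, smul_add, ← mul_smul, ← mul_smul, A.mul_of_ne l i hli, A.mul_of_ne l j hlj,
        zero_smul, add_zero]
    have hz : ∀ l h, Commute (e l) (sw k (fun a b => b * antipode k a) h) := fun l h =>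
      (hg.commute_sw_mul_antipode hp.pos hgp hcen h).eigIdem_left _ _
    have hz1 : ∀ (h : H) (v : H ⧸ M), sw k (fun a b => b * antipode k a) h • v =
        counit (R := k) h • v := fun h v => by
      rw [hsplit v, smul_add, smul_add, A.sw_mul_antipode_smul hij hV hu0 hu hui hu'0 hu' huj (hz i)
        (fun h => by rw [← hjj, hsj]),
        A.sw_mul_antipode_smul hij.symm (fun l h1 h2 => hV l h2 h1) hu'0 hu' huj hu0 hu hui (hz j)
        (fun h => by rw [hjj, hsi])]
    have hθ := antipodeSq_smul_of_sw_mul_antipode hz1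
    have hθ8 : ∀ (n : ℕ) (h : H) (v : H ⧸ M), (_root_.antipodeSq k H ^ n) h • v = h • v := fun n => by
      induction n with
      | zero => intro h v; rfl
      | succ n ih => intro h v; rw [pow_succ', AlgHom.mul_apply, hθ, ih]
    have hcomm : ∀ (h : H) (v : H ⧸ M), (h * g) • v = (g * h) • v := fun h v => by
      rw [← hconj, mul_smul, mul_smul, hθ8]
    obtain ⟨x, hx⟩ := hgen u'
    have h1 : g • u' = ζ ^ (i : ℕ) • u' := by
      have h2 : g • u = ζ ^ (i : ℕ) • u := by
        conv_lhs => rw [← hu]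
        rw [← mul_smul, he, mul_eigIdem (hζl i) hgp hp.pos, smul_assoc]
        exact congrArg _ hu
      rw [hx, ← mul_smul, ← hcomm, mul_smul, h2, ← algebraMap_smul H, ← mul_smul,
        ← Algebra.commutes, mul_smul, algebraMap_smul]
    have h2 : g • u' = ζ ^ (j : ℕ) • u' := by
      conv_lhs => rw [← hu']
      rw [← mul_smul, he, mul_eigIdem (hζl j) hgp hp.pos, smul_assoc]
      exact congrArg _ hu'
    exact hζne i j hij (smul_left_injective k hu'0 (h1.symm.trans h2))

end Conjugation

open Coalgebra HopfAlgebra TensorProduct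

section PrimeOrder

variable {k H : Type*} [Field k] [CharZero k] [IsAlgClosed k] [Ring H] [HopfAlgebra k H]
  [FiniteDimensional k H]

theorem IsGroupLikeElem.antipodeSq_pow_eight_eq_one {g : H} {p : ℕ} (hg : IsGroupLikeElem k g)
    (hp : p.Prime) (hodd : Odd p) (hgp : g ^ p = 1) (hg1 : g ≠ 1)
    (hdim : Module.finrank k H = 4 * p) {n : ℕ} (hn : 0 < n)
    (hθ : _root_.antipodeSq k H ^ n = 1)
    (htr : ∀ i, LinearMap.trace k H (LinearMap.mulRight k (g ^ i) ∘ₗ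
      (_root_.antipodeSq k H).toLinearMap) = 0)
    (hconj : (∀ γ : DualHopf k H, IsGroupLikeElem k γ → γ ^ p = 1 → γ = 1) →
      ∀ h, (_root_.antipodeSq k H ^ 8) h * g = g * h) :
    _root_.antipodeSq k H ^ 8 = 1 := by
  have := Fact.mk hp
  have hlt : ∀ i, 0 < i → i < p → g ^ i ≠ 1 := fun i hi hip h =>
    absurd (Nat.le_of_dvd hi (orderOf_eq_prime hgp hg1 ▸ orderOf_dvd_of_pow_eq_one h)) (by omega)
  have : NeZero (p : k) := ⟨Nat.cast_ne_zero.2 hp.ne_zero⟩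
  obtain ⟨ζ, hζ⟩ := HasEnoughRootsOfUnity.exists_primitiveRoot k p
  have hE : ∀ l : ℕ, Nonempty (EigenSystem k (eigIdem p (ζ ^ l) g)) := fun l =>
    hg.nonempty_eigenSystem hp.pos hgp hlt hdim hn hθ htr
      (by rw [← pow_mul, mul_comm, pow_mul, hζ.pow_eq_one, one_pow])
  by_cases hγ : ∀ γ : DualHopf k H, IsGroupLikeElem k γ → γ ^ p = 1 → γ = 1
  · refine AlgHom.ext fun h => ?_
    have h1 := hconj hγ h
    rw [(hg.commute_of_conj hp hodd hgp hlt hdim hζ hE (hconj hγ) hγ h).eq] at h1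
    have h2 := congrArg (· * g ^ (p - 1)) h1
    simp only [mul_assoc, ← pow_succ', Nat.sub_add_cancel hp.one_le, hgp, mul_one] at h2
    exact h2
  · push Not at hγ
    obtain ⟨γ, hγ, hγp, hγ1⟩ := hγ
    obtain ⟨E⟩ := hE 0
    rw [show 8 = 4 * 2 from rfl, pow_mul,
      E.antipodeSq_pow_four_eq_one hg hp hodd hgp hlt (by rw [pow_zero]) hγ hγp hγ1, one_pow]

end PrimeOrder

open Coalgebra HopfAlgebra TensorProduct

section Dimension

variable {k H : Type*} [Field k] [Ring H] [HopfAlgebra k H] [FiniteDimensional k H]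

theorem trace_mulRight_comp_antipodeSq {g : H} :
    LinearMap.trace k H (LinearMap.mulRight k g ∘ₗ (_root_.antipodeSq k H).toLinearMap) =
      LinearMap.trace k H
        (LinearMap.mulLeft k (antipode k g) ∘ₗ (_root_.antipodeSq k H).toLinearMap) := by
  rw [← LinearMap.trace_conj' _ (antipodeEquiv k H)]
  congr 1
  refine LinearMap.ext fun x => ?_
  obtain ⟨y, rfl⟩ := (antipodeEquiv k H).surjective x
  have h1 : ∀ z, antipodeEquiv k H z = antipode k z := fun z => rfl
  have h2 : (antipodeEquiv k H).symm (antipode k y) = y := (antipodeEquiv k H).symm_apply_apply y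
  simp only [LinearEquiv.conj_apply, LinearMap.comp_apply, LinearEquiv.coe_coe, h2, LinearMap.mulRight_apply, LinearMap.mulLeft_apply,
    AlgHom.toLinearMap_apply, antipodeSq_apply, h1, antipode_mul_antidistrib]

theorem DualHopf.trace_mulRight_antipodeSq (I : IntegralPair k H)
    (hε : counit (R := k) I.Lam = 0) {γ : DualHopf k H} (hγ : IsGroupLikeElem k γ) :
    LinearMap.trace k (DualHopf k H)
      (LinearMap.mulRight k γ ∘ₗ (antipodeSq k (DualHopf k H)).toLinearMap) = 0 := by
  have hγ' : IsGroupLikeElem k (antipode k γ) := hγ.antipode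
  rw [trace_mulRight_comp_antipodeSq, ← I.trace_antipode_sq_hitL hε (toAlgHom hγ'),
    ← LinearMap.trace_transpose' ((antipode k ∘ₗ antipode k) ∘ₗ hitL (toAlgHom hγ').toLinearMap),
    ← LinearMap.trace_conj' _ (equiv k H)]
  congr 1
  refine LinearMap.ext fun φ => LinearMap.ext fun h => ?_
  obtain ⟨f, rfl⟩ := (equiv k H).surjective φ
  rw [LinearEquiv.conj_apply_apply, LinearEquiv.symm_apply_apply, LinearMap.comp_apply,
    LinearMap.mulLeft_apply, mul_eq]
  change cv (antipode k γ).fn (antipodeSq k (DualHopf k H) f).fn h =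
    f.fn (antipode k (antipode k (hitL (toAlgHom hγ').toLinearMap h)))
  rw [cv_apply, ← antipodeSq_apply, ← antipodeSq_fn, hitL_apply,
    map_sw (L := (antipodeSq k (DualHopf k H) f).fn) _ _ (by fun_prop)]
  refine sw_congr h fun u v => ?_
  rw [map_smul, smul_eq_mul]
  rfl

variable [CharZero k] [IsAlgClosed k]

theorem antipodeSq_pow_eight_eq_one {p : ℕ} (hp : p.Prime) (hodd : Odd p)
    (hdim : Module.finrank k H = 4 * p) (hns : ¬ IsSemisimpleRing H) :
    antipodeSq k H ^ 8 = 1 := by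
  obtain ⟨I⟩ := nonempty_integralPair (k := k) (H := H)
  have hε : counit (R := k) I.Lam = 0 := by
    by_contra h
    exact hns (I.isSemisimpleRing h)
  obtain ⟨g, a, hg, ha, hga⟩ := exists_radford (k := k) (H := H)
  have hgN : g ^ (4 * p) = 1 := hdim ▸ hg.pow_finrank_eq_one
  have hD : Module.finrank k (DualHopf k H) = 4 * p := (DualHopf.finrank_eq k H).trans hdim
  have haN : a ^ (4 * p) = 1 := hD ▸ ha.pow_finrank_eq_one
  have hSgN : antipode k g ^ (4 * p) = 1 := hdim ▸ hg.antipode.pow_finrank_eq_one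
  have hSaN : antipode k a ^ (4 * p) = 1 := hD ▸ ha.antipode.pow_finrank_eq_one
  have hθD : antipodeSq k (DualHopf k H) ^ (2 * (4 * p)) = 1 := by
    refine AlgHom.ext fun f => DualHopf.fn_injective (LinearMap.ext fun h => ?_)
    have h1 := hga (4 * p) f h
    rwa [haN, hSaN, hgN, hSgN, one_mul, mul_one, one_mul, mul_one] at h1
  have hdual : ∀ n, antipodeSq k (DualHopf k H) ^ n = 1 → antipodeSq k H ^ n = 1 := fun n hn => by
    refine AlgHom.ext fun h => eq_of_forall_dual (k := k) fun f => ?_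
    rw [← DualHopf.fn_mk f, ← DualHopf.antipodeSq_pow_fn, hn]
    rfl
  have hpos : 0 < 2 * (4 * p) := by have := hp.pos; omega
  have hgg : g ^ 4 * antipode k g ^ 4 = 1 := by
    rw [← Commute.mul_pow (hg.mul_antipode_cancel.trans hg.antipode_mul_cancel.symm),
      hg.mul_antipode_cancel, one_pow]
  have hgg' : antipode k g ^ 4 * g ^ 4 = 1 := by
    rw [← Commute.mul_pow (hg.antipode_mul_cancel.trans hg.mul_antipode_cancel.symm),
      hg.antipode_mul_cancel, one_pow]
  have haa : a ^ 4 * antipode k a ^ 4 = 1 := by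
    rw [← Commute.mul_pow (ha.mul_antipode_cancel.trans ha.antipode_mul_cancel.symm),
      ha.mul_antipode_cancel, one_pow]
  have haa' : antipode k a ^ 4 * a ^ 4 = 1 := by
    rw [← Commute.mul_pow (ha.antipode_mul_cancel.trans ha.mul_antipode_cancel.symm),
      ha.antipode_mul_cancel, one_pow]
  by_cases hg4 : g ^ 4 = 1
  · rw [hg4, one_mul] at hgg
    have hconj : ∀ f, a ^ 4 * (antipodeSq k (DualHopf k H) ^ 8) f * antipode k a ^ 4 = f :=
      fun f => DualHopf.fn_injective (LinearMap.ext fun h => by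
        rw [hga 4 f h, hg4, hgg, one_mul, mul_one])
    refine hdual 8 ?_
    by_cases ha4 : a ^ 4 = 1
    · rw [ha4, one_mul] at haa
      refine AlgHom.ext fun f => ?_
      have h1 := hconj f
      rwa [ha4, haa, one_mul, mul_one] at h1
    · refine ha.antipode.pow.antipodeSq_pow_eight_eq_one (g := antipode k a ^ 4) hp hodd
        (by rw [← pow_mul, hSaN]) (fun h => ha4 (by rw [h, mul_one] at haa; exact haa)) hD hpos hθD
        (fun i => DualHopf.trace_mulRight_antipodeSq I hε ha.antipode.pow.pow) fun _ f => ?_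
      conv_rhs => rw [← hconj f]
      rw [← mul_assoc, ← mul_assoc, haa', one_mul]
  · refine hg.pow.antipodeSq_pow_eight_eq_one (g := g ^ 4) hp hodd (by rw [← pow_mul, hgN]) hg4 hdim
      hpos (hdual _ hθD) (fun i => I.trace_antipode_sq_mul hε _) fun hγ h => ?_
    have ha4 : a ^ 4 = 1 := hγ _ ha.pow (by rw [← pow_mul, haN])
    rw [ha4, one_mul] at haa
    have h1 : (antipodeSq k H ^ 8) h = g ^ 4 * h * antipode k g ^ 4 :=
      eq_of_forall_dual (k := k) fun f => by
        have h2 := hga 4 (DualHopf.mk f) h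
        rwa [ha4, haa, one_mul, mul_one, DualHopf.antipodeSq_pow_fn, DualHopf.fn_mk] at h2
    rw [h1, mul_assoc, hgg', mul_one]

end Dimension

open Coalgebra HopfAlgebra TensorProduct

section ProjectiveCover

theorem Module.End.two_dvd_finrank_of_trace_eq_zero {k P : Type*} [Field k] [CharZero k]
    [IsAlgClosed k] [AddCommGroup P] [Module k P] [FiniteDimensional k P] {T : Module.End k P}
    {c : k} (hc : c ≠ 0) (hT : ∀ μ, T.HasEigenvalue μ → μ ^ 8 = c)
    (htr : LinearMap.trace k P T = 0) : 2 ∣ Module.finrank k P := by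
  obtain ⟨d, hd⟩ := IsAlgClosed.exists_pow_nat_eq c (n := 8) (by norm_num)
  have hs : T.charpoly.Splits := IsAlgClosed.splits _
  have hcard : Module.finrank k P = Fintype.card (Fin T.charpoly.roots.toList.length) := by
    rw [Fintype.card_fin, Multiset.length_toList, ← hs.natDegree_eq_card_roots,
      LinearMap.charpoly_natDegree]
  rw [hcard]
  refine two_dvd_card_of_sum_eq_zero (k := k)
    (a := fun i => d⁻¹ * T.charpoly.roots.toList.get i) (fun i => ?_) ?_
  · have h1 := Multiset.mem_toList.1 (List.get_mem T.charpoly.roots.toList i)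
    rw [mul_pow, hT _ ((Module.End.hasEigenvalue_iff_isRoot_charpoly T _).2
      (Polynomial.isRoot_of_mem_roots h1)), inv_pow, hd, inv_mul_cancel₀ hc]
  · rw [← Finset.mul_sum]
    have h1 : ∑ i, T.charpoly.roots.toList.get i = T.charpoly.roots.sum := by
      conv_rhs => rw [← Multiset.coe_toList T.charpoly.roots, Multiset.sum_coe]
      rw [← List.sum_ofFn, List.ofFn_get]
    rw [h1, ← Module.End.trace_eq_sum_roots_charpoly_of_splits hs, htr, mul_zero]

variable {k H P V : Type*} [Field k] [CharZero k] [IsAlgClosed k] [Ring H] [HopfAlgebra k H]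
  [FiniteDimensional k H] [AddCommGroup V] [Module k V] [Module H V] [IsScalarTower k H V]
  [AddCommGroup P] [Module k P] [Module H P] [IsScalarTower k H P]

theorem two_dvd_finrank_of_superfluous (hθ : antipodeSq k H ^ 8 = 1)
    (htr : ∀ a : H, LinearMap.trace k H (LinearMap.mulRight k a ∘ₗ
      (antipodeSq k H).toLinearMap) = 0) [IsSimpleModule H V] [Module.Projective H P]
    (τ : V ≃ₗ[k] V) (hτ : ∀ (h : H) v, τ (h • v) = antipodeSq k H h • τ v) (π : P →ₗ[H] V)
    (hπ : Function.Surjective π)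
    (hker : ∀ N : Submodule H P, N ⊔ LinearMap.ker π = ⊤ → N = ⊤) : 2 ∣ Module.finrank k P := by
  have : Nontrivial V := IsSimpleModule.nontrivial H V
  have : FiniteDimensional k V := by
    obtain ⟨v, hv⟩ := exists_ne (0 : V)
    exact Module.Finite.of_surjective ((LinearMap.toSpanSingleton H V v).restrictScalars k)
      (IsSimpleModule.toSpanSingleton_surjective H hv)
  have hτn : ∀ (n : ℕ) (h : H) v, (τ.toLinearMap ^ n) (h • v) =
      (antipodeSq k H ^ n) h • (τ.toLinearMap ^ n) v := fun n => by
    induction n with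
    | zero => intro h v; rfl
    | succ n ih =>
      intro h v
      rw [pow_succ', pow_succ', Module.End.mul_apply, ih, AlgHom.mul_apply, Module.End.mul_apply]
      exact hτ _ _
  obtain ⟨c, hc⟩ := Module.End.exists_eigenvalue (τ.toLinearMap ^ 8)
  obtain ⟨v₀, hv, hv₀⟩ := hc.exists_hasEigenvector
  rw [Module.End.mem_eigenspace_iff] at hv
  have hcv : ∀ v : V, (τ.toLinearMap ^ 8) v = c • v := fun v => by
    obtain ⟨h, rfl⟩ := IsSimpleModule.toSpanSingleton_surjective H hv₀ v
    rw [LinearMap.toSpanSingleton_apply, hτn, hθ, hv]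
    change h • c • v₀ = c • h • v₀
    rw [← algebraMap_smul H, ← mul_smul, ← Algebra.commutes, mul_smul, algebraMap_smul]
  have hc0 : c ≠ 0 := fun h0 => by
    have h1 : Function.Injective (τ.toLinearMap ^ 8 : Module.End k V) := by
      rw [Module.End.coe_pow]
      exact Function.Injective.iterate τ.injective 8
    exact hv₀ (h1 (by rw [hv, h0, zero_smul, map_zero]))
  obtain ⟨p₀, rfl⟩ := hπ v₀
  have hsurj : Function.Surjective (LinearMap.toSpanSingleton H P p₀) := by
    refine LinearMap.range_eq_top.1 (hker _ (eq_top_iff.2 fun x _ => ?_))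
    obtain ⟨h, hh⟩ := IsSimpleModule.toSpanSingleton_surjective H hv₀ (π x)
    rw [← add_sub_cancel (h • p₀) x]
    refine Submodule.add_mem_sup ⟨h, rfl⟩ ?_
    rw [LinearMap.mem_ker, map_sub, map_smul, ← hh, LinearMap.toSpanSingleton_apply, sub_self]
  have : FiniteDimensional k P := Module.Finite.of_surjective
    ((LinearMap.toSpanSingleton H P p₀).restrictScalars k) hsurj
  obtain ⟨s, hs⟩ := Module.projective_lifting_property _ LinearMap.id hsurj
  have hsp : ∀ x, s x • p₀ = x := fun x => LinearMap.congr_fun hs x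
  obtain ⟨a, ha⟩ := hπ (τ (π p₀))
  let ψ : Module.End k P := (LinearMap.toSpanSingleton H P a).restrictScalars k ∘ₗ
    (antipodeSq k H).toLinearMap ∘ₗ s.restrictScalars k
  have hψ : ∀ x, ψ x = antipodeSq k H (s x) • a := fun x => rfl
  have hψπ : ∀ (n : ℕ) x, π ((ψ ^ n) x) = (τ.toLinearMap ^ n) (π x) := fun n => by
    induction n with
    | zero => intro x; rfl
    | succ n ih =>
      intro x
      rw [pow_succ', pow_succ', Module.End.mul_apply, Module.End.mul_apply, ← ih, hψ, map_smul, ha,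
        ← hτ, ← map_smul, hsp]
      rfl
  have hψn : ∀ (n : ℕ) (h : H) x, (ψ ^ n) (h • x) = (antipodeSq k H ^ n) h • (ψ ^ n) x :=
    fun n => by
      induction n with
      | zero => intro h x; rfl
      | succ n ih =>
        intro h x
        rw [pow_succ', pow_succ', Module.End.mul_apply, ih, AlgHom.mul_apply, Module.End.mul_apply,
          hψ, hψ, map_smul, smul_eq_mul, map_mul, mul_smul]
  refine Module.End.two_dvd_finrank_of_trace_eq_zero (T := ψ) hc0 (fun μ hμ => ?_) ?_
  · by_contra hne
    obtain ⟨x, hx, hx0⟩ := hμ.exists_hasEigenvector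
    let Φ : P →ₗ[H] P :=
      { toFun := fun x => (ψ ^ 8) x - μ ^ 8 • x
        map_add' := fun x y => by rw [map_add, smul_add, add_sub_add_comm]
        map_smul' := fun h x => by
          rw [hψn, hθ, RingHom.id_apply, smul_sub, ← algebraMap_smul H (μ ^ 8), ← mul_smul,
            Algebra.commutes, mul_smul, algebraMap_smul]
          rfl }
    have hΦ : ∀ x, Φ x = (ψ ^ 8) x - μ ^ 8 • x := fun x => rfl
    have hΦs : Function.Surjective Φ := by
      refine LinearMap.range_eq_top.1 (hker _ (eq_top_iff.2 fun y _ => ?_))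
      rw [← add_sub_cancel (Φ ((c - μ ^ 8)⁻¹ • y)) y]
      refine Submodule.add_mem_sup ⟨_, rfl⟩ ?_
      have hπk : ∀ (r : k) z, π (r • z) = r • π z := (π.restrictScalars k).map_smul
      rw [LinearMap.mem_ker, map_sub, hΦ, map_sub, hψπ, hcv, hπk (μ ^ 8), hπk, ← sub_smul, smul_smul,
        mul_inv_cancel₀ (sub_ne_zero.2 fun h => hne h.symm), one_smul, sub_self]
    have hΦi : Function.Injective Φ :=
      (LinearMap.injective_iff_surjective (f := Φ.restrictScalars k)).2 hΦs
    refine hx0 (hΦi ?_)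
    rw [hΦ, map_zero, sub_eq_zero]
    have hn : ∀ n : ℕ, (ψ ^ n) x = μ ^ n • x := fun n => by
      induction n with
      | zero => simp
      | succ n ih =>
        rw [pow_succ', Module.End.mul_apply, ih, map_smul, Module.End.mem_eigenspace_iff.1 hx,
          smul_smul, pow_succ]
    exact hn 8
  · rw [← htr (s a), show ψ = ((LinearMap.toSpanSingleton H P a).restrictScalars k ∘ₗ
      (antipodeSq k H).toLinearMap) ∘ₗ s.restrictScalars k from rfl, LinearMap.trace_comp_comm']
    congr 1
    refine LinearMap.ext fun h => ?_
    exact s.map_smul _ _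

end ProjectiveCover
/-- `π : P →ₗ[H] V` exhibits `P` as a projective cover of the `H`-module `V`:  `P` is
projective, `π` is surjective, and `ker π` is superfluous in `P`. -/
def IsProjectiveCoverOf {H P V : Type} [Ring H] [AddCommGroup P] [Module H P]
    [AddCommGroup V] [Module H V] (π : P →ₗ[H] V) : Prop :=
  Module.Projective H P ∧ Function.Surjective π ∧
    ∀ N : Submodule H P, N ⊔ LinearMap.ker π = ⊤ → N = ⊤

/-- The trivial `H`-module structure on `k`, given by the counit of the bialgebra `H`. -/
noncomputable def trivialModuleOfCounit (k H : Type) [CommSemiring k] [Semiring H]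
    [Bialgebra k H] : Module H k :=
  Module.compHom k (Bialgebra.counitAlgHom k H).toRingHom

attribute [local instance] trivialModuleOfCounit

/-- for a non-semisimple Hopf algebra `H` of dimension `4p` (`p` an odd prime)
over an algebraically closed field of characteristic zero, with antipode `S`:
`S^16 = id`; for every simple `H`-module `V` with `V ≅ V^∨∨` the projective cover of `V` has
even dimension; and in particular the projective cover of the trivial module has even
dimension.  (Here `V ≅ V^∨∨` is expressed, via the canonical identification of `V^∨∨` with
the `S²`-twist of `V`, as the existence of a `k`-linear automorphism `ψ` of `V` with
`ψ (h • v) = S²(h) • ψ v`.) -/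
theorem nonsemisimple_dim_4p_antipode_sixteen_and_even_proj_covers
    (k : Type) [Field k] [IsAlgClosed k] [CharZero k]
    (p : ℕ) (hp : p.Prime) (hodd : Odd p)
    (H : Type) [Ring H] [HopfAlgebra k H]
    (hdim : Module.finrank k H = 4 * p)
    (hns : ¬ IsSemisimpleRing H) :
    ((HopfAlgebra.antipode (R := k) (A := H) : Module.End k H) ^ 16 = LinearMap.id) ∧
    (∀ (V : Type) [AddCommGroup V] [Module k V] [Module H V] [IsScalarTower k H V],
      IsSimpleModule H V →
      (∃ ψ : V ≃ₗ[k] V, ∀ (h : H) (v : V),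
        ψ (h • v) = HopfAlgebra.antipode (R := k) (HopfAlgebra.antipode (R := k) h) • ψ v) →
      ∀ (P : Type) [AddCommGroup P] [Module k P] [Module H P] [IsScalarTower k H P]
        (π : P →ₗ[H] V), IsProjectiveCoverOf π → 2 ∣ Module.finrank k P) ∧
    (∀ (P : Type) [AddCommGroup P] [Module k P] [Module H P] [IsScalarTower k H P]
      (π : P →ₗ[H] k), IsProjectiveCoverOf π → 2 ∣ Module.finrank k P) := by
  have : FiniteDimensional k H :=
    FiniteDimensional.of_finrank_pos (by rw [hdim]; have := hp.pos; omega)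
  have hθ := antipodeSq_pow_eight_eq_one hp hodd hdim hns
  obtain ⟨I⟩ := nonempty_integralPair (k := k) (H := H)
  have hε : Coalgebra.counit (R := k) I.Lam = 0 := by
    by_contra h
    exact hns (I.isSemisimpleRing h)
  refine ⟨LinearMap.ext fun h => ?_, ?_, ?_⟩
  · have h1 : ∀ (n : ℕ) (x : H), ((HopfAlgebra.antipode k : Module.End k H) ^ (2 * n)) x =
        (antipodeSq k H ^ n) x := fun n => by
      induction n with
      | zero => intro x; rfl
      | succ n ih =>
        intro x
        rw [mul_add, mul_one, pow_add, Module.End.mul_apply, ih, pow_succ (antipodeSq k H),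
          AlgHom.mul_apply]
        rfl
    rw [show 16 = 2 * 8 from rfl, h1, hθ]
    rfl
  · intro V _ _ _ _ hV ⟨ψ, hψ⟩ P _ _ _ _ π ⟨hP, hπ, hker⟩
    exact two_dvd_finrank_of_superfluous hθ (I.trace_antipode_sq_mul hε) ψ hψ π hπ hker
  · intro P _ _ _ _ π ⟨hP, hπ, hker⟩
    have hsmul : ∀ (h : H) (r : k), h • r = Coalgebra.counit (R := k) h * r := fun _ _ => rfl
    have : IsScalarTower k H k := ⟨fun r h x => by
      rw [hsmul, hsmul, map_smul]; exact mul_assoc _ _ _⟩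
    have : IsSimpleModule H k := by
      refine isSimpleModule_iff_toSpanSingleton_surjective.2 ⟨inferInstance, fun x hx y => ?_⟩
      refine ⟨algebraMap k H (y * x⁻¹), ?_⟩
      rw [LinearMap.toSpanSingleton_apply, hsmul, Bialgebra.counit_algebraMap,
        inv_mul_cancel_right₀ hx]
    refine two_dvd_finrank_of_superfluous (V := k) hθ (I.trace_antipode_sq_mul hε)
      (LinearEquiv.refl k k) (fun h v => ?_) π hπ hker
    rw [LinearEquiv.refl_apply, LinearEquiv.refl_apply, hsmul, hsmul, counit_antipodeSq]
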